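/- Let 𝓛 be a subcategory of Λ-lat of bounded h-length (there is an integer b with l_R(h(M)) ≤ b for all M in 𝓛) containing infinitely many pairwise non-isomorphic indecomposable objects. Then Λ has strongly unbounded lattice type: there is an infinite strictly increasing sequence b_1 < b_2 < ⋯ of integers such that, for each i, there are infinitely many pairwise non-isomorphic indecomposable Λ-lattices of h-length b_i. -/

import Mathlib

universe u

open IsLocalRing

noncomputable section

namespace BT

/-- The length of a module, defined as the Krull dimension of its lattice of
submodules (which agrees with the usual composition-series length). -/
def moduleLength (A : Type u) [Ring A] (M : Type u) [AddCommGroup M] [Module A M] :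
    WithBot ℕ∞ :=
  Order.krullDim (Submodule A M)

/-- `M` is a maximal Cohen-Macaulay module over the local ring `R`: it admits an
`M`-regular sequence contained in the maximal ideal whose length is `dim R`
(i.e. `depth_R M = dim R`). -/
def IsMCM (R : Type u) [CommRing R] [IsLocalRing R]
    (M : Type u) [AddCommGroup M] [Module R M] : Prop :=
  ∃ rs : List R, (∀ r ∈ rs, r ∈ maximalIdeal R) ∧ RingTheory.Sequence.IsRegular M rs ∧
    (rs.length : WithBot ℕ∞) = ringKrullDim R

/-- The `n`-th Ext group of two `R`-modules. -/
def extGroup (R : Type u) [CommRing R] (n : ℕ)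
    (A B : Type u) [AddCommGroup A] [Module R A] [AddCommGroup B] [Module R B] : Type u :=
  ((Ext R (ModuleCat.{u} R) n).obj (Opposite.op (ModuleCat.of R A))).obj (ModuleCat.of R B)

instance (R : Type u) [CommRing R] (n : ℕ)
    (A B : Type u) [AddCommGroup A] [Module R A] [AddCommGroup B] [Module R B] :
    AddCommGroup (extGroup R n A B) :=
  inferInstanceAs (AddCommGroup
    (((Ext R (ModuleCat.{u} R) n).obj (Opposite.op (ModuleCat.of R A))).obj (ModuleCat.of R B)))

instance (R : Type u) [CommRing R] (n : ℕ)
    (A B : Type u) [AddCommGroup A] [Module R A] [AddCommGroup B] [Module R B] :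
    Module R (extGroup R n A B) :=
  inferInstanceAs (Module R
    (((Ext R (ModuleCat.{u} R) n).obj (Opposite.op (ModuleCat.of R A))).obj (ModuleCat.of R B)))

/-- `ω` is a canonical module for the Cohen-Macaulay local ring `R`: it is a
finitely generated module with `Ext^i_R(k, ω) = 0` for `i ≠ dim R` and
`Ext^{dim R}_R(k, ω) ≅ k`. -/
def IsCanonicalModule (R : Type u) [CommRing R] [IsLocalRing R]
    (ω : Type u) [AddCommGroup ω] [Module R ω] : Prop :=
  Module.Finite R ω ∧ ∃ d : ℕ, (d : WithBot ℕ∞) = ringKrullDim R ∧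
    (∀ i : ℕ, i ≠ d → Subsingleton (extGroup R i (ResidueField R) ω)) ∧
    Nonempty (extGroup R d (ResidueField R) ω ≃ₗ[R] ResidueField R)

/-- A homomorphism of `Λ`-modules factors through a projective `Λ`-module. -/
def FactorsThroughProjective (Λ : Type u) [Ring Λ] {M N : Type u}
    [AddCommGroup M] [Module Λ M] [AddCommGroup N] [Module Λ N] (f : M →ₗ[Λ] N) : Prop :=
  ∃ (P : Type u) (_ : AddCommGroup P) (_ : Module Λ P), Module.Projective Λ P ∧
    ∃ (g : M →ₗ[Λ] P) (h : P →ₗ[Λ] N), h.comp g = f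

section StableHom

variable (R : Type u) [CommRing R] (Λ : Type u) [Ring Λ] [Algebra R Λ]
variable (M N : Type u) [AddCommGroup M] [Module Λ M]
  [AddCommGroup N] [Module Λ N] [Module R N] [IsScalarTower R Λ N]

/-- The `R`-submodule of `Hom_Λ(M, N)` consisting of the homomorphisms that
factor through a projective `Λ`-module. -/
def projTrivial : Submodule R (M →ₗ[Λ] N) where
  carrier := {f | FactorsThroughProjective Λ f}
  zero_mem' := ⟨Λ, inferInstance, inferInstance, inferInstance, 0, 0, by ext; simp⟩
  add_mem' := by
    rintro f₁ f₂ ⟨P₁, _, _, hP₁, g₁, h₁, rfl⟩ ⟨P₂, _, _, hP₂, g₂, h₂, rfl⟩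
    exact ⟨P₁ × P₂, inferInstance, inferInstance, inferInstance,
      g₁.prod g₂, h₁.comp (LinearMap.fst Λ P₁ P₂) + h₂.comp (LinearMap.snd Λ P₁ P₂),
      by ext m; simp⟩
  smul_mem' := by
    rintro r f ⟨P, _, _, hP, g, h, rfl⟩
    exact ⟨P, inferInstance, inferInstance, hP, g, r • h, by ext m; simp⟩

/-- The stable Hom `Hom-bar_Λ(M, N)`: homomorphisms modulo those factoring
through projectives, as an `R`-module. -/
def stableHom : Type u := (M →ₗ[Λ] N) ⧸ projTrivial R Λ M N

instance : AddCommGroup (stableHom R Λ M N) :=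
  inferInstanceAs (AddCommGroup ((M →ₗ[Λ] N) ⧸ projTrivial R Λ M N))

instance : Module R (stableHom R Λ M N) :=
  inferInstanceAs (Module R ((M →ₗ[Λ] N) ⧸ projTrivial R Λ M N))

end StableHom

/-- The `h`-length of `M` (relative to a fixed module `G`): the length over `R`
of `h(M) = Hom-bar_Λ(M, M ⊕ G)`. -/
def hLength (R : Type u) [CommRing R] (Λ : Type u) [Ring Λ] [Algebra R Λ]
    (M : Type u) [AddCommGroup M] [Module Λ M] [Module R M] [IsScalarTower R Λ M]
    (G : Type u) [AddCommGroup G] [Module Λ G] [Module R G] [IsScalarTower R Λ G] :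
    WithBot ℕ∞ :=
  moduleLength R (stableHom R Λ M (M × G))

/-- A module is indecomposable if it is nonzero and admits no nontrivial direct
sum decomposition. -/
def IsIndecomposable (Λ : Type u) [Ring Λ] (M : Type u) [AddCommGroup M] [Module Λ M] : Prop :=
  Nontrivial M ∧ ∀ A B : Submodule Λ M, IsCompl A B → A = ⊥ ∨ B = ⊥

/-- `Ext¹_Λ(M, Y) = 0`, expressed by the splitting of extensions: every
surjection onto `M` with kernel isomorphic to `Y` splits. -/
def Ext1Vanishes (Λ : Type u) [Ring Λ] (M Y : Type u)
    [AddCommGroup M] [Module Λ M] [AddCommGroup Y] [Module Λ Y] : Prop :=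
  ∀ (E : Type u) (_ : AddCommGroup E) (_ : Module Λ E) (g : E →ₗ[Λ] M),
    Function.Surjective g → Nonempty ((LinearMap.ker g) ≃ₗ[Λ] Y) →
      ∃ s : M →ₗ[Λ] E, g.comp s = LinearMap.id

/-- A homomorphism `f : X → C` is right minimal if every endomorphism `g` of `X`
with `f ∘ g = f` is an isomorphism. -/
def RightMinimal (Λ : Type u) [Ring Λ] {X C : Type u} [AddCommGroup X] [Module Λ X]
    [AddCommGroup C] [Module Λ C] (f : X →ₗ[Λ] C) : Prop :=
  ∀ g : X →ₗ[Λ] X, f.comp g = f → Function.Bijective g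

/-- Multiplication by `s ∈ R` on `M` lifts along `g : E → M`. -/
def SmulLiftsAlong (R : Type u) [CommRing R] (Λ : Type u) [Ring Λ] [Algebra R Λ]
    {E M : Type u} [AddCommGroup E] [Module Λ E] [AddCommGroup M] [Module Λ M]
    (s : R) (g : E →ₗ[Λ] M) : Prop :=
  ∃ h : M →ₗ[Λ] E, ∀ m, g (h m) = algebraMap R Λ s • m

/-- The localization `M_p` of the finitely generated `Λ`-module `M` is a
projective `Λ_p`-module.  (For a finitely generated module over a noetherian
algebra this is equivalent to the following lifting property: for every
surjection of `Λ`-modules onto `M`, multiplication by some `s ∉ p` lifts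
along it.) -/
def LocallyProjectiveAt (R : Type u) [CommRing R] (Λ : Type u) [Ring Λ] [Algebra R Λ]
    (p : Ideal R) (M : Type u) [AddCommGroup M] [Module Λ M] : Prop :=
  ∀ (E : Type u) (_ : AddCommGroup E) (_ : Module Λ E) (g : E →ₗ[Λ] M),
    Function.Surjective g → ∃ s ∉ p, SmulLiftsAlong R Λ s g

/-- The action of `a : Λ` on a `Λ`-module `M`, as an `R`-linear map. -/
def actionMap (R : Type u) [CommRing R] (Λ : Type u) [Ring Λ] [Algebra R Λ]
    (M : Type u) [AddCommGroup M] [Module Λ M] [Module R M] [IsScalarTower R Λ M]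
    (a : Λ) : M →ₗ[R] M where
  toFun m := a • m
  map_add' := smul_add a
  map_smul' r m := smul_comm a r m

/-- For a left `Λ`-module `M`, the module `Hom_R(M, ω)` is a right `Λ`-module,
i.e. a left `Λᵐᵒᵖ`-module, via `(aᵒᵖ • f) m = f (a • m)`. -/
instance omegaDualModule (R : Type u) [CommRing R] (Λ : Type u) [Ring Λ] [Algebra R Λ]
    (ω : Type u) [AddCommGroup ω] [Module R ω]
    (M : Type u) [AddCommGroup M] [Module Λ M] [Module R M] [IsScalarTower R Λ M] :
    Module Λᵐᵒᵖ (M →ₗ[R] ω) where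
  smul a f := f.comp (actionMap R Λ M a.unop)
  one_smul f := LinearMap.ext fun m => congrArg f (one_smul Λ m)
  mul_smul a b f := LinearMap.ext fun m => congrArg f (mul_smul b.unop a.unop m)
  smul_zero _ := LinearMap.ext fun _ => rfl
  smul_add _ _ _ := LinearMap.ext fun _ => rfl
  add_smul a b f := LinearMap.ext fun m => by
    show f ((a.unop + b.unop) • m) = f (a.unop • m) + f (b.unop • m)
    rw [add_smul, map_add]
  zero_smul f := LinearMap.ext fun m => by
    show f ((0 : Λ) • m) = 0
    rw [zero_smul, map_zero]

/-- `M` is a `Λ`-lattice: it is finitely generated, maximal Cohen-Macaulay as an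
`R`-module, `M_p` is `Λ_p`-projective for every non-maximal prime `p`, and
`Hom_R(M, ω)_p` is `Λ_p^op`-projective for every non-maximal prime `p`. -/
def IsLattice (R : Type u) [CommRing R] [IsLocalRing R]
    (Λ : Type u) [Ring Λ] [Algebra R Λ]
    (ω : Type u) [AddCommGroup ω] [Module R ω]
    (M : Type u) [AddCommGroup M] [Module Λ M] [Module R M] [IsScalarTower R Λ M] : Prop :=
  Module.Finite Λ M ∧ IsMCM R M ∧
    (∀ p : Ideal R, p.IsPrime → p ≠ maximalIdeal R → LocallyProjectiveAt R Λ p M) ∧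
    (∀ p : Ideal R, p.IsPrime → p ≠ maximalIdeal R →
      LocallyProjectiveAt R Λᵐᵒᵖ p (M →ₗ[R] ω))

/-- `Y` is a lat-injective module: it is a lattice and `Ext¹_Λ(M, Y) = 0` for
every `Λ`-lattice `M`. -/
def IsLatInjective (R : Type u) [CommRing R] [IsLocalRing R]
    (Λ : Type u) [Ring Λ] [Algebra R Λ]
    (ω : Type u) [AddCommGroup ω] [Module R ω]
    (Y : Type u) [AddCommGroup Y] [Module Λ Y] [Module R Y] [IsScalarTower R Λ Y] : Prop :=
  IsLattice R Λ ω Y ∧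
    ∀ (M : Type u) (_ : AddCommGroup M) (_ : Module Λ M) (_ : Module R M)
      (_ : IsScalarTower R Λ M), IsLattice R Λ ω M → Ext1Vanishes Λ M Y

/-- `Y` admits a finite resolution `0 → L_t → ⋯ → L_0 → Y → 0` by lat-injective
modules. -/
def HasLatInjResOfLength (R : Type u) [CommRing R] [IsLocalRing R]
    (Λ : Type u) [Ring Λ] [Algebra R Λ]
    (ω : Type u) [AddCommGroup ω] [Module R ω] :
    ℕ → ∀ (Y : Type u) [AddCommGroup Y] [Module Λ Y] [Module R Y] [IsScalarTower R Λ Y], Prop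
  | 0, Y, _, _, _, _ => IsLatInjective R Λ ω Y
  | (t + 1), Y, _, _, _, _ =>
      ∃ (L : Type u) (_ : AddCommGroup L) (_ : Module Λ L) (_ : Module R L)
        (_ : IsScalarTower R Λ L) (π : L →ₗ[Λ] Y), IsLatInjective R Λ ω L ∧
          Function.Surjective π ∧ HasLatInjResOfLength R Λ ω t (LinearMap.ker π)

/-- `α : X → C` is a minimal lat-approximation of the `Λ`-module `C`: `X` is a
lattice, `α` is surjective and right minimal, and its kernel admits a finite
resolution by lat-injectives. -/
def IsMinimalLatApprox (R : Type u) [CommRing R] [IsLocalRing R]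
    (Λ : Type u) [Ring Λ] [Algebra R Λ] (ω : Type u) [AddCommGroup ω] [Module R ω]
    {X : Type u} [AddCommGroup X] [Module Λ X] [Module R X] [IsScalarTower R Λ X]
    {C : Type u} [AddCommGroup C] [Module Λ C] (α : X →ₗ[Λ] C) : Prop :=
  IsLattice R Λ ω X ∧ Function.Surjective α ∧
    (∃ t : ℕ, HasLatInjResOfLength R Λ ω t (LinearMap.ker α)) ∧ RightMinimal Λ α

/-- `Sfam` is a complete set of pairwise non-isomorphic simple `Λ`-modules, and
`α : G → S` is a minimal lat-approximation of their direct sum `S = ⨁ i, Sfam i`. -/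
def IsSimplesApprox (R : Type u) [CommRing R] [IsLocalRing R]
    (Λ : Type u) [Ring Λ] [Algebra R Λ] (ω : Type u) [AddCommGroup ω] [Module R ω]
    (ι : Type u) [Fintype ι] (Sfam : ι → Type u) [∀ i, AddCommGroup (Sfam i)]
    [∀ i, Module Λ (Sfam i)]
    (G : Type u) [AddCommGroup G] [Module Λ G] [Module R G] [IsScalarTower R Λ G]
    (α : G →ₗ[Λ] ∀ i, Sfam i) : Prop :=
  (∀ i, IsSimpleModule Λ (Sfam i)) ∧
  (∀ i j, i ≠ j → IsEmpty (Sfam i ≃ₗ[Λ] Sfam j)) ∧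
  (∀ (T : Type u) (_ : AddCommGroup T) (_ : Module Λ T),
      IsSimpleModule Λ T → ∃ i, Nonempty (T ≃ₗ[Λ] Sfam i)) ∧
  IsMinimalLatApprox R Λ ω α

/-- There are infinitely many pairwise non-isomorphic indecomposable
`Λ`-lattices of `h`-length `t`. -/
def InfManyIndecLatticesOfHLength (R : Type u) [CommRing R] [IsLocalRing R]
    (Λ : Type u) [Ring Λ] [Algebra R Λ] (ω : Type u) [AddCommGroup ω] [Module R ω]
    (G : Type u) [AddCommGroup G] [Module Λ G] [Module R G] [IsScalarTower R Λ G]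
    (t : ℕ) : Prop :=
  ∃ (F : ℕ → Type u) (_ : ∀ n, AddCommGroup (F n)) (_ : ∀ n, Module Λ (F n))
    (_ : ∀ n, Module R (F n)) (_ : ∀ n, IsScalarTower R Λ (F n)),
    (∀ n, IsLattice R Λ ω (F n) ∧ IsIndecomposable Λ (F n) ∧
      hLength R Λ (F n) G = (t : WithBot ℕ∞)) ∧
    ∀ m n : ℕ, m ≠ n → IsEmpty (F m ≃ₗ[Λ] F n)

/-- `Λ` has strongly unbounded lattice type: there is an infinite strictly
increasing sequence `b 0 < b 1 < ⋯` of integers such that for each `i` there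
are infinitely many pairwise non-isomorphic indecomposable `Λ`-lattices of
`h`-length `b i`. -/
def StronglyUnboundedLatType (R : Type u) [CommRing R] [IsLocalRing R]
    (Λ : Type u) [Ring Λ] [Algebra R Λ] (ω : Type u) [AddCommGroup ω] [Module R ω]
    (G : Type u) [AddCommGroup G] [Module Λ G] [Module R G] [IsScalarTower R Λ G] : Prop :=
  ∃ b : ℕ → ℕ, StrictMono b ∧ ∀ i, InfManyIndecLatticesOfHLength R Λ ω G (b i)

/-- `Λ` is of finite lattice type: there are only finitely many isomorphism
classes of indecomposable `Λ`-lattices. -/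
def FiniteLatType (R : Type u) [CommRing R] [IsLocalRing R]
    (Λ : Type u) [Ring Λ] [Algebra R Λ] (ω : Type u) [AddCommGroup ω] [Module R ω] : Prop :=
  ∃ (n : ℕ) (F : Fin n → Type u) (_ : ∀ i, AddCommGroup (F i)) (_ : ∀ i, Module Λ (F i)),
    ∀ (M : Type u) (_ : AddCommGroup M) (_ : Module Λ M) (_ : Module R M)
      (_ : IsScalarTower R Λ M), IsLattice R Λ ω M → IsIndecomposable Λ M →
        ∃ i, Nonempty (M ≃ₗ[Λ] F i)

set_option linter.unusedSectionVars false

section Depth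

open RingTheory.Sequence CategoryTheory Abelian Pointwise

variable {R : Type u} [CommRing R] [IsNoetherianRing R] [IsLocalRing R]

/-- `M` has depth at least `n`. -/
def DepthAtLeast (R : Type u) [CommRing R] [IsLocalRing R] (n : ℕ)
    (M : Type u) [AddCommGroup M] [Module R M] : Prop :=
  ∃ rs : List R, rs.length = n ∧ (∀ r ∈ rs, r ∈ maximalIdeal R) ∧ IsRegular M rs

theorem maximalIdeal_smul_top_lt {M : Type u} [AddCommGroup M] [Module R M] [Module.Finite R M]
    [Nontrivial M] : maximalIdeal R • (⊤ : Submodule R M) < ⊤ := by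
  refine lt_top_iff_ne_top.mpr fun h => ?_
  have := Submodule.eq_bot_of_le_smul_of_le_jacobson_bot (maximalIdeal R) (⊤ : Submodule R M)
    Module.Finite.fg_top h.ge (maximalIdeal_le_jacobson _)
  exact bot_ne_top this.symm

theorem nontrivial_quotSMulTop {M : Type u} [AddCommGroup M] [Module R M] [Module.Finite R M]
    [Nontrivial M] {x : R} (hx : x ∈ maximalIdeal R) : Nontrivial (QuotSMulTop x M) := by
  refine Submodule.Quotient.nontrivial_iff.mpr fun he => ?_
  have hle : x • (⊤ : Submodule R M) ≤ maximalIdeal R • ⊤ := by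
    intro m hm
    obtain ⟨m', -, rfl⟩ := (Submodule.mem_smul_pointwise_iff_exists _ _ _).mp hm
    exact Submodule.smul_mem_smul hx trivial
  rw [he] at hle
  exact (maximalIdeal_smul_top_lt (R := R) (M := M)).ne (top_le_iff.mp hle)

theorem DepthAtLeast.quotSMulTop {n : ℕ} {M : Type u} [AddCommGroup M] [Module R M]
    [Module.Finite R M] [Nontrivial M] (h : DepthAtLeast R (n + 1) M) {x : R}
    (hx : x ∈ maximalIdeal R) (hreg : IsSMulRegular M x) :
    DepthAtLeast R n (QuotSMulTop x M) := by
  obtain ⟨rs, hlen, hmem, hrs⟩ := h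
  have hsupp : Module.support R (ResidueField R) =
      PrimeSpectrum.zeroLocus (maximalIdeal R : Set R) := by
    change Module.support R (R ⧸ maximalIdeal R) = _
    rw [Module.support_eq_zeroLocus, Ideal.annihilator_quotient]
  have hfin : Module.Finite R (ResidueField R) :=
    inferInstanceAs (Module.Finite R (R ⧸ maximalIdeal R))
  have hM := ModuleCat.subsingleton_ext_of_exists_isRegular (maximalIdeal R)
    (ModuleCat.of R (ResidueField R)) hsupp.subset (ModuleCat.of R M)
    (maximalIdeal_smul_top_lt (M := M)) rs hmem hrs
  have hnt : Nontrivial (QuotSMulTop x M) := nontrivial_quotSMulTop hx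
  have hreg' : IsSMulRegular (ModuleCat.of R M) x := hreg
  have hext : ∀ i < n, Subsingleton (Ext (ModuleCat.of R (ResidueField R))
      (ModuleCat.of R (QuotSMulTop x M)) i) := by
    intro i hi
    have zero1 := AddCommGrpCat.isZero_of_iff_subsingleton.mpr (hM i (by omega))
    have zero2 := AddCommGrpCat.isZero_of_iff_subsingleton.mpr (hM (i + 1) (by omega))
    exact AddCommGrpCat.subsingleton_of_isZero <| ShortComplex.Exact.isZero_of_both_zeros
      ((Ext.covariant_sequence_exact₃' (ModuleCat.of R (ResidueField R))
        hreg'.smulShortComplex_shortExact) i (i + 1) rfl)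
      (zero1.eq_zero_of_src _) (zero2.eq_zero_of_tgt _)
  exact ModuleCat.exists_isRegular_of_exists_subsingleton_ext (maximalIdeal R) n
    (ModuleCat.of R (QuotSMulTop x M)) (maximalIdeal_smul_top_lt (M := QuotSMulTop x M))
    (ModuleCat.of R (ResidueField R)) hsupp hext

theorem le_ringKrullDim_quotient_of_isAssociatedPrime {n : ℕ} {M : Type u} [AddCommGroup M]
    [Module R M] [Module.Finite R M] (h : DepthAtLeast R n M) {p : Ideal R}
    (hp : IsAssociatedPrime p M) : (n : WithBot ℕ∞) ≤ ringKrullDim (R ⧸ p) := by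
  induction n generalizing M p with
  | zero =>
    have := hp.isPrime
    exact_mod_cast ringKrullDim_nonneg_of_nontrivial
  | succ n ih =>
    obtain ⟨rs, hlen, hmem, hrs⟩ := h
    obtain _ | ⟨y, ys⟩ := rs
    · simp at hlen
    rw [isRegular_cons_iff] at hrs
    have hpp := hp.isPrime
    have hym : y ∈ maximalIdeal R := hmem y (by simp)
    obtain ⟨-, m₀, hm₀⟩ := isAssociatedPrime_iff.mp hp
    have hm₀' : ∀ r, r ∈ p ↔ r • m₀ = 0 := by
      intro r; rw [hm₀, Submodule.mem_colon_singleton]; simp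
    have hyp : y ∉ p := by
      rw [hm₀']
      intro h0
      have h1 : m₀ = 0 := hrs.1 (by simpa using h0)
      exact hpp.ne_top ((Ideal.eq_top_iff_one _).mpr ((hm₀' 1).mpr (by simp [h1])))
    let N : Submodule R M := Submodule.torsionBySet R M p
    have hN : N ≠ ⊥ := by
      intro h0
      have : m₀ ∈ N := by
        rw [Submodule.mem_torsionBySet_iff]
        exact fun a => (hm₀' a).mp a.2
      rw [h0, Submodule.mem_bot] at this
      exact hpp.ne_top ((Ideal.eq_top_iff_one _).mpr ((hm₀' 1).mpr (by simp [this])))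
    let φ : N →ₗ[R] QuotSMulTop y M := (Submodule.mkQ _).comp N.subtype
    have hφ : LinearMap.range φ ≠ ⊥ := by
      intro h0
      refine hN (Submodule.eq_bot_of_le_smul_of_le_jacobson_bot (maximalIdeal R) N
        (IsNoetherian.noetherian N) (fun m hm => ?_) (maximalIdeal_le_jacobson _))
      have h1 : φ ⟨m, hm⟩ = 0 := by
        rw [LinearMap.range_eq_bot] at h0; simp [h0]
      have h2 : m ∈ y • (⊤ : Submodule R M) := by
        simpa [φ] using h1
      obtain ⟨m', -, rfl⟩ := Submodule.mem_smul_pointwise_iff_exists _ _ _ |>.mp h2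
      refine Submodule.smul_mem_smul hym ?_
      rw [Submodule.mem_torsionBySet_iff] at hm ⊢
      intro a
      exact hrs.1 (by simpa [smul_comm y] using hm a)
    have : Nontrivial (LinearMap.range φ) := Submodule.nontrivial_iff_ne_bot.mpr hφ
    obtain ⟨q, hq⟩ := associatedPrimes.nonempty R (LinearMap.range φ)
    have hq : IsAssociatedPrime q (LinearMap.range φ) := hq
    have hq' : IsAssociatedPrime q (QuotSMulTop y M) :=
      hq.map_of_injective (f := (LinearMap.range φ).subtype) (Submodule.subtype_injective _)
    have hih := ih ⟨ys, by simpa using hlen, fun r hr => hmem r (by simp [hr]), hrs.2⟩ hq'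
    have hpq : p ≤ q := by
      refine le_trans (fun r hr => ?_) hq.annihilator_le
      rw [Submodule.mem_annihilator]
      rintro ⟨-, n, rfl⟩ -
      ext
      have h3 : r • (n : M) = 0 := (Submodule.mem_torsionBySet_iff _ _).mp n.2 ⟨r, hr⟩
      change r • φ n = 0
      rw [← map_smul]
      have : r • n = 0 := by ext; simpa using h3
      rw [this, map_zero]
    have hyq : y ∈ q := by
      refine hq'.annihilator_le ?_
      rw [Submodule.mem_annihilator]
      intro z _
      obtain ⟨m, rfl⟩ := Submodule.mkQ_surjective _ z
      rw [← map_smul]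
      exact (Submodule.Quotient.mk_eq_zero _).mpr (Submodule.smul_mem_pointwise_smul _ _ _ trivial)
    have hreg : (Ideal.Quotient.mk p y) ∈ nonZeroDivisors (R ⧸ p) :=
      mem_nonZeroDivisors_of_ne_zero (by rwa [ne_eq, Ideal.Quotient.eq_zero_iff_mem])
    have h4 := ringKrullDim_quotient_succ_le_of_nonZeroDivisor hreg
    have h5 : ringKrullDim (R ⧸ q) ≤
        ringKrullDim ((R ⧸ p) ⧸ Ideal.span {Ideal.Quotient.mk p y}) := by
      have hle : Ideal.span {Ideal.Quotient.mk p y} ≤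
          RingHom.ker (Ideal.Quotient.factor hpq) := by
        rw [Ideal.span_singleton_le_iff_mem, RingHom.mem_ker, Ideal.Quotient.factor_mk,
          Ideal.Quotient.eq_zero_iff_mem]
        exact hyq
      exact ringKrullDim_le_of_surjective (Ideal.Quotient.lift _ _ hle)
        (Ideal.Quotient.lift_surjective_of_surjective _ hle
          (Ideal.Quotient.factor_surjective hpq))
    calc ((n + 1 : ℕ) : WithBot ℕ∞) = (n : WithBot ℕ∞) + 1 := by push_cast; rfl
      _ ≤ _ := by gcongr; exact hih.trans h5
      _ ≤ _ := h4

theorem isWeaklyRegular_of_depth (rest : List R) {M : Type u} [AddCommGroup M] [Module R M]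
    [Module.Finite R M] [Nontrivial M] (dn : List R)
    (hreg : IsRegular R (dn ++ rest)) (hmem : ∀ r ∈ dn ++ rest, r ∈ maximalIdeal R)
    (hlen : ((dn ++ rest).length : WithBot ℕ∞) = ringKrullDim R)
    (hkill : ∀ r ∈ dn, ∀ m : M, r • m = 0) (hM : DepthAtLeast R rest.length M) :
    IsWeaklyRegular M rest := by
  induction rest generalizing M dn with
  | nil => exact IsWeaklyRegular.nil R M
  | cons x xs ih =>
    have hxm : x ∈ maximalIdeal R := hmem x (by simp)
    have hassoc : dn ++ x :: xs = (dn ++ [x]) ++ xs := by simp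
    have hx : IsSMulRegular M x := by
      have h1 : x ∈ (⋃ p ∈ associatedPrimes R M, (p : Set R))ᶜ := by
        simp only [Set.mem_compl_iff, Set.mem_iUnion, not_exists]
        intro p hp hxp
        have hp' : IsAssociatedPrime p M := hp
        have h2 := le_ringKrullDim_quotient_of_isAssociatedPrime hM hp'
        have h3 : Ideal.ofList (dn ++ [x]) ≤ p := by
          refine Ideal.span_le.mpr fun r hr => ?_
          have hr : r ∈ dn ++ [x] := hr
          rcases List.mem_append.mp hr with hr | hr
          · refine hp'.annihilator_le ?_
            rw [Submodule.mem_annihilator]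
            exact fun m _ => hkill r hr m
          · rw [List.mem_singleton] at hr; rw [hr]; exact hxp
        have h4 : ringKrullDim (R ⧸ p) ≤ ringKrullDim (R ⧸ Ideal.ofList (dn ++ [x])) :=
          ringKrullDim_le_of_surjective _ (Ideal.Quotient.factor_surjective h3)
        have hreg1 : IsRegular R (dn ++ [x]) := by
          have : Nontrivial R := inferInstance
          rw [isRegular_iff_isWeaklyRegular_of_subset_maximalIdeal]
          · rw [hassoc] at hreg
            exact ((isWeaklyRegular_append_iff R _ _).mp hreg.toIsWeaklyRegular).1
          · intro r hr
            refine hmem r ?_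
            rw [hassoc]; exact List.mem_append_left _ hr
        have h5 := ringKrullDim_add_length_eq_ringKrullDim_of_isRegular _ hreg1
        rw [← hlen] at h5
        have h6 := h2.trans h4
        have h7 : ((x :: xs).length : WithBot ℕ∞) + ((dn ++ [x]).length : WithBot ℕ∞) ≤
            ((dn ++ x :: xs).length : WithBot ℕ∞) := by
          rw [← h5]; gcongr
        have h8 : (x :: xs).length + (dn ++ [x]).length ≤ (dn ++ x :: xs).length := by
          exact_mod_cast h7
        simp at h8
        omega
      rw [biUnion_associatedPrimes_eq_compl_regular] at h1
      simpa using h1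
    have hnt : Nontrivial (QuotSMulTop x M) := nontrivial_quotSMulTop hxm
    refine IsWeaklyRegular.cons hx (ih (dn ++ [x]) (hassoc ▸ hreg) (hassoc ▸ hmem)
      (hassoc ▸ hlen) ?_ (hM.quotSMulTop hxm hx))
    intro r hr z
    obtain ⟨m, rfl⟩ := Submodule.mkQ_surjective _ z
    rw [← map_smul]
    rcases List.mem_append.mp hr with hr | hr
    · rw [hkill r hr, map_zero]
    · rw [List.mem_singleton] at hr; subst hr
      exact (Submodule.Quotient.mk_eq_zero _).mpr (Submodule.smul_mem_pointwise_smul _ _ _ trivial)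

/-- An `R`-regular sequence of length `dim R` is weakly regular on every maximal
Cohen-Macaulay module. -/
theorem IsMCM.isWeaklyRegular {xs : List R} (hxs : IsRegular R xs)
    (hmem : ∀ r ∈ xs, r ∈ maximalIdeal R) (hlen : (xs.length : WithBot ℕ∞) = ringKrullDim R)
    {M : Type u} [AddCommGroup M] [Module R M] [Module.Finite R M] (hM : IsMCM R M) :
    IsWeaklyRegular M xs := by
  obtain ⟨rs, hrm, hrs, hrl⟩ := hM
  have : Nontrivial M := hrs.nontrivial
  refine isWeaklyRegular_of_depth xs [] (by simpa using hxs) (by simpa using hmem)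
    (by simpa using hlen) (by simp) ⟨rs, ?_, hrm, hrs⟩
  have : ((rs.length : ℕ) : WithBot ℕ∞) = (xs.length : ℕ) := hrl.trans hlen.symm
  exact_mod_cast this

end Depth

section WeaklyRegular

open RingTheory.Sequence Pointwise

variable {R : Type u} [CommRing R] {A B C : Type u} [AddCommGroup A] [Module R A]
  [AddCommGroup B] [Module R B] [AddCommGroup C] [Module R C]

theorem isWeaklyRegular_cons_iff_of_surjective {r : R} {rs : List R} {π : A →ₗ[R] B}
    (hπ : Function.Surjective π) (hker : LinearMap.ker π = r • ⊤) :
    IsWeaklyRegular A (r :: rs) ↔ IsSMulRegular A r ∧ IsWeaklyRegular B rs := by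
  rw [isWeaklyRegular_cons_iff]
  refine and_congr_right fun _ => LinearEquiv.isWeaklyRegular_congr ?_ rs
  exact (Submodule.quotEquivOfEq _ _ hker.symm).trans (π.quotKerEquivOfSurjective hπ)

theorem isWeaklyRegular_of_subsingleton [Subsingleton A] (rs : List R) :
    IsWeaklyRegular A rs := by
  induction rs generalizing A with
  | nil => exact IsWeaklyRegular.nil R A
  | cons r rs ih =>
    have : Subsingleton (QuotSMulTop r A) := (Submodule.mkQ_surjective _).subsingleton
    exact IsWeaklyRegular.cons (fun _ _ _ => Subsingleton.elim _ _) ih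

theorem quotSMulTop_map_injective {r : R} {f : A →ₗ[R] B} {g : B →ₗ[R] C}
    (hf : Function.Injective f) (hfg : Function.Exact f g) (hC : IsSMulRegular C r) :
    Function.Injective (QuotSMulTop.map r f) := by
  rw [← LinearMap.ker_eq_bot, LinearMap.ker_eq_bot']
  intro z hz
  obtain ⟨a, rfl⟩ := Submodule.mkQ_surjective _ z
  have h1 : f a ∈ r • (⊤ : Submodule R B) := (Submodule.Quotient.mk_eq_zero _).mp hz
  obtain ⟨b, -, hb⟩ := (Submodule.mem_smul_pointwise_iff_exists _ _ _).mp h1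
  have h2 : g b = 0 := hC (by
    change r • g b = r • 0
    rw [← map_smul, hb, hfg.apply_apply_eq_zero, smul_zero])
  obtain ⟨a', rfl⟩ := (hfg b).mp h2
  have h3 : a = r • a' := hf (by rw [map_smul, hb])
  rw [h3]
  exact (Submodule.Quotient.mk_eq_zero _).mpr (Submodule.smul_mem_pointwise_smul _ _ _ trivial)

theorem isWeaklyRegular_of_exact {rs : List R} {f : A →ₗ[R] B} {g : B →ₗ[R] C}
    (hf : Function.Injective f) (hfg : Function.Exact f g) (hg : Function.Surjective g)
    (hA : IsWeaklyRegular A rs) (hC : IsWeaklyRegular C rs) : IsWeaklyRegular B rs := by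
  induction rs generalizing A B C with
  | nil => exact IsWeaklyRegular.nil R B
  | cons r rs ih =>
    rw [isWeaklyRegular_cons_iff] at hA hC ⊢
    exact ⟨isSMulRegular_of_range_eq_ker hf hfg.linearMap_ker_eq.symm hA.1 hC.1,
      ih (quotSMulTop_map_injective hf hfg hC.1) (QuotSMulTop.map_exact r hfg hg)
        (QuotSMulTop.map_surjective r hg) hA.2 hC.2⟩

theorem isWeaklyRegular_left_of_exact {rs : List R} {f : A →ₗ[R] B} {g : B →ₗ[R] C}
    (hf : Function.Injective f) (hfg : Function.Exact f g) (hg : Function.Surjective g)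
    (hB : IsWeaklyRegular B rs) (hC : IsWeaklyRegular C rs) : IsWeaklyRegular A rs := by
  induction rs generalizing A B C with
  | nil => exact IsWeaklyRegular.nil R A
  | cons r rs ih =>
    rw [isWeaklyRegular_cons_iff] at hB hC ⊢
    exact ⟨hB.1.of_injective f hf,
      ih (quotSMulTop_map_injective hf hfg hC.1) (QuotSMulTop.map_exact r hfg hg)
        (QuotSMulTop.map_surjective r hg) hB.2 hC.2⟩

theorem isWeaklyRegular_of_retract {rs : List R} {i : A →ₗ[R] B} {p : B →ₗ[R] A}
    (h : p ∘ₗ i = LinearMap.id) (hB : IsWeaklyRegular B rs) : IsWeaklyRegular A rs := by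
  induction rs generalizing A B with
  | nil => exact IsWeaklyRegular.nil R A
  | cons r rs ih =>
    rw [isWeaklyRegular_cons_iff] at hB ⊢
    refine ⟨hB.1.of_injective i (Function.LeftInverse.injective (g := p)
      fun x => LinearMap.congr_fun h x), ih (i := QuotSMulTop.map r i) (p := QuotSMulTop.map r p)
        ?_ hB.2⟩
    rw [← QuotSMulTop.map_comp, h, QuotSMulTop.map_id]

theorem IsWeaklyRegular.map_pow {rs : List R} (m : ℕ) (h : IsWeaklyRegular A rs) :
    IsWeaklyRegular A (rs.map (· ^ m)) := by
  induction rs generalizing A with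
  | nil => exact IsWeaklyRegular.nil R A
  | cons y ys ih =>
    rw [isWeaklyRegular_cons_iff] at h
    rw [List.map_cons, isWeaklyRegular_cons_iff]
    refine ⟨h.1.pow m, ih ?_⟩
    clear ih
    induction m with
    | zero =>
      have : Subsingleton (QuotSMulTop (y ^ 0) A) := by
        rw [Submodule.Quotient.subsingleton_iff, pow_zero, one_smul]
      exact isWeaklyRegular_of_subsingleton ys
    | succ j ihj =>
      let f : QuotSMulTop y A →ₗ[R] QuotSMulTop (y ^ (j + 1)) A :=
        Submodule.mapQ _ _ (LinearMap.lsmul R A (y ^ j)) (by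
          intro a ha
          obtain ⟨b, -, rfl⟩ := (Submodule.mem_smul_pointwise_iff_exists _ _ _).mp ha
          refine (Submodule.mem_smul_pointwise_iff_exists _ _ _).mpr ⟨b, trivial, ?_⟩
          simp only [LinearMap.lsmul_apply, pow_succ, mul_smul])
      let g : QuotSMulTop (y ^ (j + 1)) A →ₗ[R] QuotSMulTop (y ^ j) A :=
        Submodule.mapQ _ _ LinearMap.id (by
          intro a ha
          obtain ⟨b, -, rfl⟩ := (Submodule.mem_smul_pointwise_iff_exists _ _ _).mp ha
          refine (Submodule.mem_smul_pointwise_iff_exists _ _ _).mpr ⟨y • b, trivial, ?_⟩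
          simp [pow_succ, mul_smul])
      have hg : Function.Surjective g := fun z => by
        obtain ⟨a, rfl⟩ := Submodule.mkQ_surjective _ z
        exact ⟨Submodule.Quotient.mk a, rfl⟩
      have hf : Function.Injective f := by
        rw [← LinearMap.ker_eq_bot, LinearMap.ker_eq_bot']
        intro z hz
        obtain ⟨a, rfl⟩ := Submodule.mkQ_surjective _ z
        have h1 : y ^ j • a ∈ y ^ (j + 1) • (⊤ : Submodule R A) :=
          (Submodule.Quotient.mk_eq_zero _).mp hz
        obtain ⟨b, -, hb⟩ := (Submodule.mem_smul_pointwise_iff_exists _ _ _).mp h1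
        have h2 : y • b = a := (h.1.pow j) (by simpa [pow_succ, mul_smul] using hb)
        rw [← h2]
        exact (Submodule.Quotient.mk_eq_zero _).mpr
          (Submodule.smul_mem_pointwise_smul _ _ _ trivial)
      have hfg : Function.Exact f g := by
        intro z
        obtain ⟨a, rfl⟩ := Submodule.mkQ_surjective _ z
        constructor
        · intro hz
          have h1 : a ∈ y ^ j • (⊤ : Submodule R A) := (Submodule.Quotient.mk_eq_zero _).mp hz
          obtain ⟨b, -, rfl⟩ := (Submodule.mem_smul_pointwise_iff_exists _ _ _).mp h1
          exact ⟨Submodule.Quotient.mk b, rfl⟩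
        · rintro ⟨w, hw⟩
          rw [← hw]
          obtain ⟨b, rfl⟩ := Submodule.mkQ_surjective _ w
          exact (Submodule.Quotient.mk_eq_zero _).mpr
            (Submodule.smul_mem_pointwise_smul _ _ _ trivial)
      exact isWeaklyRegular_of_exact hf hfg hg h.2 ihj

end WeaklyRegular

section StableAnnihilator

/-- The elements of `R` whose multiplication on `M` factors through a projective module. -/
def stableAnn (R : Type u) [CommRing R] (Λ : Type u) [Ring Λ] [Algebra R Λ]
    (M : Type u) [AddCommGroup M] [Module Λ M] [Module R M] [IsScalarTower R Λ M] : Ideal R :=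
  (projTrivial R Λ M M).comap (LinearMap.toSpanSingleton R (M →ₗ[Λ] M) LinearMap.id)

variable {Λ : Type u} [Ring Λ] {K M N : Type u} [AddCommGroup M] [Module Λ M]
  [AddCommGroup N] [Module Λ N] [AddCommGroup K] [Module Λ K]

theorem FactorsThroughProjective.comp_left {f : M →ₗ[Λ] N}
    (hf : FactorsThroughProjective Λ f) (g : N →ₗ[Λ] K) :
    FactorsThroughProjective Λ (g ∘ₗ f) := by
  obtain ⟨P, _, _, hP, a, b, rfl⟩ := hf
  exact ⟨P, _, _, hP, a, g ∘ₗ b, rfl⟩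

theorem FactorsThroughProjective.comp_right {f : M →ₗ[Λ] N}
    (hf : FactorsThroughProjective Λ f) (g : K →ₗ[Λ] M) :
    FactorsThroughProjective Λ (f ∘ₗ g) := by
  obtain ⟨P, _, _, hP, a, b, rfl⟩ := hf
  exact ⟨P, _, _, hP, a ∘ₗ g, b, rfl⟩

theorem FactorsThroughProjective.lift {f : M →ₗ[Λ] N} (hf : FactorsThroughProjective Λ f)
    {g : K →ₗ[Λ] N} (hg : Function.Surjective g) :
    ∃ h : M →ₗ[Λ] K, FactorsThroughProjective Λ h ∧ g ∘ₗ h = f := by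
  obtain ⟨P, _, _, hP, a, b, rfl⟩ := hf
  obtain ⟨c, hc⟩ := Module.projective_lifting_property g b hg
  exact ⟨c ∘ₗ a, ⟨P, _, _, hP, a, c, rfl⟩, by rw [← LinearMap.comp_assoc, hc]⟩

variable {R : Type u} [CommRing R] [Algebra R Λ] [Module R K] [IsScalarTower R Λ K]
  [Module R M] [IsScalarTower R Λ M] [Module R N] [IsScalarTower R Λ N]

theorem FactorsThroughProjective.add {f g : M →ₗ[Λ] N} (hf : FactorsThroughProjective Λ f)
    (hg : FactorsThroughProjective Λ g) : FactorsThroughProjective Λ (f + g) := by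
  obtain ⟨P₁, _, _, hP₁, g₁, h₁, rfl⟩ := hf
  obtain ⟨P₂, _, _, hP₂, g₂, h₂, rfl⟩ := hg
  exact ⟨P₁ × P₂, inferInstance, inferInstance, inferInstance,
      g₁.prod g₂, h₁.comp (LinearMap.fst Λ P₁ P₂) + h₂.comp (LinearMap.snd Λ P₁ P₂),
      by ext m; simp⟩

theorem mem_stableAnn {r : R} :
    r ∈ stableAnn R Λ M ↔ FactorsThroughProjective Λ (r • LinearMap.id : M →ₗ[Λ] M) :=
  Iff.rfl

theorem stableAnn_smul_left {r : R} (hr : r ∈ stableAnn R Λ N) (f : M →ₗ[Λ] N) :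
    FactorsThroughProjective Λ (r • f) := by
  have := (mem_stableAnn.mp hr).comp_right f
  rwa [LinearMap.smul_comp, LinearMap.id_comp] at this

theorem stableAnn_smul_right {r : R} (hr : r ∈ stableAnn R Λ M) (f : M →ₗ[Λ] N) :
    FactorsThroughProjective Λ (r • f) := by
  have := (mem_stableAnn.mp hr).comp_left f
  have h2 : f ∘ₗ (r • LinearMap.id : M →ₗ[Λ] M) = r • f := by
    ext x
    simp only [LinearMap.comp_apply, LinearMap.smul_apply, LinearMap.id_apply]
    exact LinearMap.map_smul_of_tower f r x
  rwa [h2] at this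

theorem stableAnn_of_retract {i : M →ₗ[Λ] N} {p : N →ₗ[Λ] M}
    (h : p ∘ₗ i = LinearMap.id) : stableAnn R Λ N ≤ stableAnn R Λ M := by
  intro r hr
  have h1 := (stableAnn_smul_left hr i).comp_left p
  have h2 : p ∘ₗ (r • i) = r • LinearMap.id := by
    ext x
    have := LinearMap.congr_fun h x
    simp only [LinearMap.comp_apply, LinearMap.smul_apply, LinearMap.id_apply] at this ⊢
    rw [LinearMap.map_smul_of_tower, this]
  rw [mem_stableAnn, ← h2]
  exact h1

/-- If `c` acts on `M` as `f₁ ∘ g₁ + f₂ ∘ g₂` with `gⱼ : M → Nⱼ`, then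
`c` times both stable annihilators is contained in that of `M`. -/
theorem stableAnn_mul_of_eq_add {c : R} {f₁ : K →ₗ[Λ] M} {g₁ : M →ₗ[Λ] K} {f₂ : N →ₗ[Λ] M}
    {g₂ : M →ₗ[Λ] N} (h : (c • LinearMap.id : M →ₗ[Λ] M) = f₁ ∘ₗ g₁ + f₂ ∘ₗ g₂) {s t : R}
    (hs : s ∈ stableAnn R Λ K) (ht : t ∈ stableAnn R Λ N) : s * t * c ∈ stableAnn R Λ M := by
  rw [mem_stableAnn, mul_smul, h]
  have h1 : (s * t) • (f₁ ∘ₗ g₁ + f₂ ∘ₗ g₂)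
      = f₁ ∘ₗ ((t * s) • g₁) + f₂ ∘ₗ ((s * t) • g₂) := by
    ext x
    simp only [LinearMap.comp_apply, LinearMap.smul_apply, LinearMap.add_apply]
    rw [LinearMap.map_smul_of_tower, LinearMap.map_smul_of_tower, smul_add, mul_comm s t]
  rw [h1]
  exact ((stableAnn_smul_left (Ideal.mul_mem_left _ _ hs) g₁).comp_left f₁).add
    ((stableAnn_smul_left (Ideal.mul_mem_left _ _ ht) g₂).comp_left f₂)

/-- Homotopy data on a short exact sequence coming from an element that kills the third term
stably. -/
theorem exists_homotopy {A B C : Type u} [AddCommGroup A] [Module Λ A]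
    [AddCommGroup B] [Module Λ B] [AddCommGroup C] [Module Λ C]
    [Module R B] [IsScalarTower R Λ B] [Module R A] [IsScalarTower R Λ A]
    [Module R C] [IsScalarTower R Λ C] {i : A →ₗ[Λ] B} {g : B →ₗ[Λ] C}
    (hi : Function.Injective i) (hig : Function.Exact i g) (hg : Function.Surjective g)
    {r : R} (hr : r ∈ stableAnn R Λ C) :
    ∃ (h : C →ₗ[Λ] B) (ρ : B →ₗ[Λ] A), FactorsThroughProjective Λ h ∧
      (g ∘ₗ h = r • LinearMap.id) ∧
      (r • LinearMap.id : B →ₗ[Λ] B) = i ∘ₗ ρ + h ∘ₗ g ∧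
      (ρ ∘ₗ i = (r • LinearMap.id : A →ₗ[Λ] A)) := by
  obtain ⟨h, hh, hgh⟩ := (mem_stableAnn.mp hr).lift hg
  have hmem : ∀ b, (r • LinearMap.id - h ∘ₗ g : B →ₗ[Λ] B) b ∈ LinearMap.range i := by
    intro b
    rw [← hig.linearMap_ker_eq, LinearMap.mem_ker]
    have := LinearMap.congr_fun hgh (g b)
    simp only [LinearMap.comp_apply, LinearMap.smul_apply, LinearMap.id_apply] at this
    simp [this, LinearMap.map_smul_of_tower]
  let e := LinearEquiv.ofInjective i hi
  let ρ : B →ₗ[Λ] A := e.symm.toLinearMap ∘ₗ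
    (LinearMap.codRestrict (LinearMap.range i) (r • LinearMap.id - h ∘ₗ g) hmem)
  have hiρ : ∀ b, i (ρ b) = r • b - h (g b) := by
    intro b
    have : ((e (ρ b) : LinearMap.range i) : B) = r • b - h (g b) := by
      simp [ρ]
    simpa [e] using this
  refine ⟨h, ρ, hh, hgh, ?_, ?_⟩
  · ext b
    simp [hiρ]
  · ext a
    apply hi
    simp only [LinearMap.comp_apply, LinearMap.smul_apply, LinearMap.id_apply]
    rw [hiρ, hig.apply_apply_eq_zero, map_zero, sub_zero, LinearMap.map_smul_of_tower]

end StableAnnihilator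

section Dual

variable {R : Type u} [CommRing R] {Λ : Type u} [Ring Λ] [Algebra R Λ]
  (ω : Type u) [AddCommGroup ω] [Module R ω]
  {M N K : Type u} [AddCommGroup M] [Module Λ M] [Module R M] [IsScalarTower R Λ M]
  [AddCommGroup N] [Module Λ N] [Module R N] [IsScalarTower R Λ N]
  [AddCommGroup K] [Module Λ K] [Module R K] [IsScalarTower R Λ K]

instance : IsScalarTower R Λᵐᵒᵖ (M →ₗ[R] ω) where
  smul_assoc r a f := LinearMap.ext fun m => by
    change f ((r • a.unop) • m) = r • f (a.unop • m)
    rw [smul_assoc, map_smul]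

/-- Precomposition with a `Λ`-linear map, as a map of right `Λ`-modules. -/
def omegaDualMap (f : M →ₗ[Λ] N) : (N →ₗ[R] ω) →ₗ[Λᵐᵒᵖ] (M →ₗ[R] ω) where
  toFun φ := φ ∘ₗ f.restrictScalars R
  map_add' _ _ := rfl
  map_smul' a φ := LinearMap.ext fun m => by
    exact congrArg φ (map_smul f a.unop m).symm

theorem omegaDualMap_comp (f : M →ₗ[Λ] N) (g : N →ₗ[Λ] K) :
    omegaDualMap (R := R) ω (g ∘ₗ f) = omegaDualMap ω f ∘ₗ omegaDualMap ω g := rfl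

theorem omegaDualMap_add (f g : M →ₗ[Λ] N) :
    omegaDualMap (R := R) ω (f + g) = omegaDualMap ω f + omegaDualMap ω g := by
  ext φ m
  simp [omegaDualMap]

theorem omegaDualMap_smul_id (r : R) :
    omegaDualMap ω (r • LinearMap.id : M →ₗ[Λ] M) =
      r • (LinearMap.id : (M →ₗ[R] ω) →ₗ[Λᵐᵒᵖ] (M →ₗ[R] ω)) := by
  ext φ m
  simp [omegaDualMap]

theorem omegaDualMap_id :
    omegaDualMap (R := R) ω (LinearMap.id : M →ₗ[Λ] M) =
      (LinearMap.id : (M →ₗ[R] ω) →ₗ[Λᵐᵒᵖ] (M →ₗ[R] ω)) := rfl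

end Dual

section Lat

open RingTheory.Sequence

/-- A bundled `Λ`-module, with its compatible `R`-module structure. -/
structure LMod (R : Type u) [CommRing R] (Λ : Type u) [Ring Λ] [Algebra R Λ] where
  /-- The underlying type. -/
  carrier : Type u
  [addCommGroup : AddCommGroup carrier]
  [module : Module Λ carrier]
  [moduleR : Module R carrier]
  [tower : IsScalarTower R Λ carrier]

attribute [instance] LMod.addCommGroup LMod.module LMod.moduleR LMod.tower

instance (R : Type u) [CommRing R] (Λ : Type u) [Ring Λ] [Algebra R Λ] :
    CoeSort (LMod R Λ) (Type u) := ⟨LMod.carrier⟩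

/-- A possibly zero lattice, with the depth condition tested on a fixed sequence. -/
structure IsLat0 (R : Type u) [CommRing R] [IsLocalRing R] (Λ : Type u) [Ring Λ] [Algebra R Λ]
    (ω : Type u) [AddCommGroup ω] [Module R ω] (xs : List R)
    (M : Type u) [AddCommGroup M] [Module Λ M] [Module R M] [IsScalarTower R Λ M] : Prop where
  finite : Module.Finite Λ M
  regular : IsWeaklyRegular M xs
  ann : ∃ n, maximalIdeal R ^ n ≤ stableAnn R Λ M
  annDual : ∃ n, maximalIdeal R ^ n ≤ stableAnn R Λᵐᵒᵖ (M →ₗ[R] ω)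

variable {R : Type u} [CommRing R] [IsLocalRing R] {Λ : Type u} [Ring Λ] [Algebra R Λ]
  {ω : Type u} [AddCommGroup ω] [Module R ω] {xs : List R}
  {A B C : Type u} [AddCommGroup A] [Module Λ A] [Module R A] [IsScalarTower R Λ A]
  [AddCommGroup B] [Module Λ B] [Module R B] [IsScalarTower R Λ B]
  [AddCommGroup C] [Module Λ C] [Module R C] [IsScalarTower R Λ C]

theorem locallyProjectiveAt_iff [IsNoetherianRing R] :
    (∀ p : Ideal R, p.IsPrime → p ≠ maximalIdeal R → LocallyProjectiveAt R Λ p A) ↔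
      ∃ n, maximalIdeal R ^ n ≤ stableAnn R Λ A := by
  constructor
  · intro h
    have h1 : ∀ p : Ideal R, p.IsPrime → p ≠ maximalIdeal R → ∃ s ∉ p, s ∈ stableAnn R Λ A := by
      intro p hp hpm
      obtain ⟨s, hs, l, hl⟩ := h p hp hpm (A →₀ Λ) _ _ (Finsupp.linearCombination Λ id)
        (Finsupp.linearCombination_id_surjective Λ A)
      refine ⟨s, hs, A →₀ Λ, _, _, inferInstance, l, Finsupp.linearCombination Λ id, ?_⟩
      ext a
      simp [hl]
    have h2 : maximalIdeal R ≤ (stableAnn R Λ A).radical := by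
      rw [Ideal.radical_eq_sInf]
      refine le_sInf ?_
      rintro p ⟨hle, hp⟩
      by_contra hnle
      obtain ⟨s, hs, hs'⟩ := h1 p hp (fun h => hnle h.ge)
      exact hs (hle hs')
    exact Ideal.exists_pow_le_of_le_radical_of_fg h2 (IsNoetherian.noetherian _)
  · rintro ⟨n, hn⟩ p hp hpm E _ _ g hg
    have : ¬ maximalIdeal R ^ n ≤ p := fun hle =>
      hpm ((maximalIdeal.isMaximal R).eq_of_le hp.ne_top (hp.le_of_pow_le hle)).symm
    obtain ⟨s, hs, hsp⟩ := SetLike.not_le_iff_exists.mp this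
    obtain ⟨h, -, hgh⟩ := (mem_stableAnn.mp (hn hs)).lift hg
    refine ⟨s, hsp, h, fun m => ?_⟩
    simpa using LinearMap.congr_fun hgh m

theorem pow_le_stableAnn_mid {i : A →ₗ[Λ] B} {g : B →ₗ[Λ] C}
    (hi : Function.Injective i) (hig : Function.Exact i g) (hg : Function.Surjective g) {n m : ℕ}
    (hA : maximalIdeal R ^ n ≤ stableAnn R Λ A) (hC : maximalIdeal R ^ m ≤ stableAnn R Λ C) :
    maximalIdeal R ^ (n + m) ≤ stableAnn R Λ B := by
  rw [pow_add]
  refine Ideal.mul_le.mpr fun s hs r hr => ?_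
  obtain ⟨h, ρ, hh, -, h1, -⟩ := exists_homotopy hi hig hg (hC hr)
  have h2 : ((s * r) • LinearMap.id : B →ₗ[Λ] B) = i ∘ₗ (s • ρ) + (s • h) ∘ₗ g := by
    rw [mul_smul, h1]
    ext b
    simp [LinearMap.map_smul_of_tower]
  rw [mem_stableAnn, h2]
  refine ((stableAnn_smul_left (hA hs) ρ).comp_left i).add (FactorsThroughProjective.comp_right ?_ g)
  exact (projTrivial R Λ C B).smul_mem s hh

theorem pow_le_stableAnn_left {i : A →ₗ[Λ] B} {g : B →ₗ[Λ] C}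
    (hi : Function.Injective i) (hig : Function.Exact i g) (hg : Function.Surjective g) {n m : ℕ}
    (hB : maximalIdeal R ^ n ≤ stableAnn R Λ B) (hC : maximalIdeal R ^ m ≤ stableAnn R Λ C) :
    maximalIdeal R ^ (n + m) ≤ stableAnn R Λ A := by
  rw [pow_add]
  refine Ideal.mul_le.mpr fun s hs r hr => ?_
  obtain ⟨h, ρ, -, -, -, h1⟩ := exists_homotopy hi hig hg (hC hr)
  have h2 : ((s * r) • LinearMap.id : A →ₗ[Λ] A) = ρ ∘ₗ (s • i) := by
    rw [mul_smul, ← h1]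
    ext b
    simp [LinearMap.map_smul_of_tower]
  rw [mem_stableAnn, h2]
  exact (stableAnn_smul_left (hB hs) i).comp_left ρ

theorem exists_pow_le_stableAnn_dual_mid {i : A →ₗ[Λ] B} {g : B →ₗ[Λ] C}
    (hi : Function.Injective i) (hig : Function.Exact i g) (hg : Function.Surjective g)
    {n m k : ℕ} (hC : maximalIdeal R ^ k ≤ stableAnn R Λ C)
    (hA' : maximalIdeal R ^ n ≤ stableAnn R Λᵐᵒᵖ (A →ₗ[R] ω))
    (hC' : maximalIdeal R ^ m ≤ stableAnn R Λᵐᵒᵖ (C →ₗ[R] ω)) :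
    maximalIdeal R ^ (n + m + k) ≤ stableAnn R Λᵐᵒᵖ (B →ₗ[R] ω) := by
  rw [pow_add, pow_add]
  refine Ideal.mul_le.mpr fun st hst r hr => ?_
  obtain ⟨h, ρ, -, -, h1, -⟩ := exists_homotopy hi hig hg (hC hr)
  have h2 := congrArg (omegaDualMap (R := R) ω) h1
  rw [omegaDualMap_smul_id, omegaDualMap_add, omegaDualMap_comp, omegaDualMap_comp] at h2
  refine Submodule.mul_induction_on (C := fun st => st * r ∈ stableAnn R Λᵐᵒᵖ (B →ₗ[R] ω)) hst
    (fun s hs t ht => stableAnn_mul_of_eq_add h2 (hA' hs) (hC' ht)) fun x y hx hy => ?_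
  rw [add_mul]
  exact add_mem hx hy

theorem exists_pow_le_stableAnn_dual_left {i : A →ₗ[Λ] B} {g : B →ₗ[Λ] C}
    (hi : Function.Injective i) (hig : Function.Exact i g) (hg : Function.Surjective g)
    {n k : ℕ} (hC : maximalIdeal R ^ k ≤ stableAnn R Λ C)
    (hB' : maximalIdeal R ^ n ≤ stableAnn R Λᵐᵒᵖ (B →ₗ[R] ω)) :
    maximalIdeal R ^ (n + k) ≤ stableAnn R Λᵐᵒᵖ (A →ₗ[R] ω) := by
  rw [pow_add]
  refine Ideal.mul_le.mpr fun s hs r hr => ?_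
  obtain ⟨h, ρ, -, -, -, h1⟩ := exists_homotopy hi hig hg (hC hr)
  have h2 := congrArg (omegaDualMap (R := R) ω) h1
  rw [omegaDualMap_smul_id, omegaDualMap_comp] at h2
  have h3 : ((s * r) • LinearMap.id : (A →ₗ[R] ω) →ₗ[Λᵐᵒᵖ] (A →ₗ[R] ω)) =
      omegaDualMap ω i ∘ₗ (s • omegaDualMap ω ρ) := by
    rw [mul_smul, ← h2]
    ext b
    simp [LinearMap.map_smul_of_tower]
  rw [mem_stableAnn, h3]
  exact (stableAnn_smul_left (hB' hs) _).comp_left _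

theorem IsLat0.of_exact_mid {i : A →ₗ[Λ] B} {g : B →ₗ[Λ] C}
    (hi : Function.Injective i) (hig : Function.Exact i g) (hg : Function.Surjective g)
    (hA : IsLat0 R Λ ω xs A) (hC : IsLat0 R Λ ω xs C) : IsLat0 R Λ ω xs B := by
  obtain ⟨hA1, hA2, ⟨n, hA3⟩, n', hA4⟩ := hA
  obtain ⟨hC1, hC2, ⟨m, hC3⟩, m', hC4⟩ := hC
  exact ⟨Module.Finite.of_exact hig hg,
    isWeaklyRegular_of_exact (f := i.restrictScalars R) (g := g.restrictScalars R) hi hig hg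
      hA2 hC2, ⟨_, pow_le_stableAnn_mid hi hig hg hA3 hC3⟩,
    ⟨_, exists_pow_le_stableAnn_dual_mid hi hig hg hC3 hA4 hC4⟩⟩

theorem IsLat0.of_exact_left [IsNoetherianRing Λ] {i : A →ₗ[Λ] B} {g : B →ₗ[Λ] C}
    (hi : Function.Injective i) (hig : Function.Exact i g) (hg : Function.Surjective g)
    (hB : IsLat0 R Λ ω xs B) (hC : IsLat0 R Λ ω xs C) : IsLat0 R Λ ω xs A := by
  obtain ⟨hB1, hB2, ⟨n, hB3⟩, n', hB4⟩ := hB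
  obtain ⟨hC1, hC2, ⟨m, hC3⟩, m', hC4⟩ := hC
  exact ⟨Module.Finite.of_injective i hi,
    isWeaklyRegular_left_of_exact (f := i.restrictScalars R) (g := g.restrictScalars R) hi hig hg
      hB2 hC2, ⟨_, pow_le_stableAnn_left hi hig hg hB3 hC3⟩,
    ⟨_, exists_pow_le_stableAnn_dual_left hi hig hg hC3 hB4⟩⟩

theorem IsLat0.of_retract {i : A →ₗ[Λ] B} {p : B →ₗ[Λ] A}
    (h : p ∘ₗ i = LinearMap.id) (hB : IsLat0 R Λ ω xs B) : IsLat0 R Λ ω xs A := by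
  obtain ⟨hB1, hB2, ⟨n, hB3⟩, n', hB4⟩ := hB
  refine ⟨Module.Finite.of_surjective p fun x => ⟨i x, LinearMap.congr_fun h x⟩,
    isWeaklyRegular_of_retract (i := i.restrictScalars R) (p := p.restrictScalars R)
      (LinearMap.ext fun x => LinearMap.congr_fun h x) hB2,
    ⟨n, hB3.trans (stableAnn_of_retract h)⟩, ⟨n', hB4.trans ?_⟩⟩
  refine stableAnn_of_retract (i := omegaDualMap ω p) (p := omegaDualMap ω i) ?_
  rw [← omegaDualMap_comp, h, omegaDualMap_id]

theorem IsLat0.congr (e : A ≃ₗ[Λ] B) (hB : IsLat0 R Λ ω xs B) : IsLat0 R Λ ω xs A :=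
  hB.of_retract (i := e.toLinearMap) (p := e.symm.toLinearMap) (by ext; simp)

theorem IsLat0.prod (hA : IsLat0 R Λ ω xs A) (hB : IsLat0 R Λ ω xs B) :
    IsLat0 R Λ ω xs (A × B) :=
  .of_exact_mid (LinearMap.inl_injective) (Function.Exact.inl_snd (R := Λ))
    LinearMap.snd_surjective hA hB

theorem IsLat0.of_subsingleton [Subsingleton A] : IsLat0 R Λ ω xs A := by
  refine ⟨inferInstance, isWeaklyRegular_of_subsingleton _, ⟨0, fun r _ => ?_⟩, 0, fun r _ => ?_⟩
  · exact ⟨A, _, _, inferInstance, LinearMap.id, r • LinearMap.id, rfl⟩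
  · refine ⟨A →ₗ[R] ω, _, _, ?_, LinearMap.id, r • LinearMap.id, rfl⟩
    have : Subsingleton (A →ₗ[R] ω) := ⟨fun f g => by ext a; simp [Subsingleton.elim a 0]⟩
    infer_instance

theorem IsLat0.ker [IsNoetherianRing Λ] {g : B →ₗ[Λ] C} (hg : Function.Surjective g)
    (hB : IsLat0 R Λ ω xs B) (hC : IsLat0 R Λ ω xs C) : IsLat0 R Λ ω xs (LinearMap.ker g) :=
  .of_exact_left (Submodule.subtype_injective _) (LinearMap.exact_subtype_ker_map g) hg hB hC

theorem IsLat0.pi (hA : IsLat0 R Λ ω xs A) (n : ℕ) : IsLat0 R Λ ω xs (Fin n → A) := by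
  induction n with
  | zero => exact .of_subsingleton
  | succ n ih => exact (hA.prod ih).congr (Fin.consLinearEquiv Λ (fun _ : Fin (n + 1) => A)).symm

end Lat

section Lifting

open RingTheory.Sequence Pointwise

/-- The `Λ`-submodule `I Y` of a `Λ`-module `Y`, for an ideal `I` of `R`. -/
def redSub {R : Type u} [CommRing R] (Λ : Type u) [Ring Λ] [Algebra R Λ] (I : Ideal R)
    (Y : Type u) [AddCommGroup Y] [Module Λ Y] [Module R Y] [IsScalarTower R Λ Y] :
    Submodule Λ Y where
  carrier := (I • (⊤ : Submodule R Y) : Submodule R Y)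
  add_mem' := add_mem
  zero_mem' := zero_mem _
  smul_mem' c y hy := by
    refine Submodule.smul_induction_on (p := fun y => c • y ∈ I • (⊤ : Submodule R Y)) hy
      (fun r hr n _ => ?_) fun x y hx hy => ?_
    · rw [smul_comm]
      exact Submodule.smul_mem_smul hr trivial
    · rw [smul_add]
      exact add_mem hx hy

variable {R : Type u} [CommRing R] {Λ : Type u} [Ring Λ] [Algebra R Λ]
  {X : Type u} [AddCommGroup X] [Module Λ X] [Module R X] [IsScalarTower R Λ X]
  {Y : Type u} [AddCommGroup Y] [Module Λ Y] [Module R Y] [IsScalarTower R Λ Y]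
  {Q : Type u} [AddCommGroup Q] [Module Λ Q]

theorem mem_redSub {I : Ideal R} {y : Y} :
    y ∈ redSub Λ I Y ↔ y ∈ I • (⊤ : Submodule R Y) := Iff.rfl

theorem smul_mem_redSub {I : Ideal R} {r : R} (hr : r ∈ I) (y : Y) : r • y ∈ redSub Λ I Y :=
  mem_redSub.mpr (Submodule.smul_mem_smul hr Submodule.mem_top)

theorem mem_redSub_span_singleton {r : R} {y : Y} :
    y ∈ redSub Λ (Ideal.span {r}) Y ↔ ∃ z, r • z = y := by
  rw [mem_redSub, Submodule.ideal_span_singleton_smul, Submodule.mem_smul_pointwise_iff_exists]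
  simp

theorem redSub_mono {I J : Ideal R} (h : I ≤ J) : redSub Λ I Y ≤ redSub Λ J Y :=
  fun _ hy => mem_redSub.mpr (Submodule.smul_mono_left h (mem_redSub.mp hy))

theorem redSub_sup (I J : Ideal R) : redSub Λ (I ⊔ J) Y = redSub Λ I Y ⊔ redSub Λ J Y := by
  refine le_antisymm (fun y hy => ?_) (sup_le (redSub_mono le_sup_left) (redSub_mono le_sup_right))
  rw [mem_redSub, Submodule.sup_smul] at hy
  obtain ⟨a, ha, b, hb, rfl⟩ := Submodule.mem_sup.mp hy
  exact Submodule.add_mem_sup (mem_redSub.mpr ha) (mem_redSub.mpr hb)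

theorem map_mem_redSub {I : Ideal R} (f : X →ₗ[Λ] Y) {x : X} (hx : x ∈ redSub Λ I X) :
    f x ∈ redSub Λ I Y := by
  refine Submodule.smul_induction_on (p := fun x => f x ∈ redSub Λ I Y) (mem_redSub.mp hx)
    (fun r hr n _ => ?_) fun x y hx hy => ?_
  · rw [LinearMap.map_smul_of_tower]
    exact smul_mem_redSub hr _
  · rw [map_add]
    exact add_mem hx hy

theorem exists_mem_redSub_of_surjective {I : Ideal R} {f : X →ₗ[Λ] Y} (hf : Function.Surjective f)
    {y : Y} (hy : y ∈ redSub Λ I Y) : ∃ x ∈ redSub Λ I X, f x = y := by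
  refine Submodule.smul_induction_on (p := fun y => ∃ x ∈ redSub Λ I X, f x = y) (mem_redSub.mp hy)
    (fun r hr n _ => ?_) ?_
  · obtain ⟨x, rfl⟩ := hf n
    exact ⟨r • x, smul_mem_redSub hr x, LinearMap.map_smul_of_tower f r x⟩
  · rintro _ _ ⟨x, hx, rfl⟩ ⟨x', hx', rfl⟩
    exact ⟨x + x', add_mem hx hx', map_add f x x'⟩

theorem exists_lift_of_smul_regular {y : R} {a : ℕ} (hreg : IsSMulRegular Y (y ^ (a + 1)))
    (hX : y ^ a ∈ stableAnn R Λ X) {π : Y →ₗ[Λ] Q} (hπ : Function.Surjective π)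
    (hker : ∀ z, π z = 0 ↔ ∃ w : Y, y ^ (a + 1) • w = z) (φ : X →ₗ[Λ] Q) :
    ∃ ψ : X →ₗ[Λ] Y, ∀ x z, π z = φ x → ∃ w, y • w = ψ x - z := by
  let P := X →₀ Λ
  let p : P →ₗ[Λ] X := Finsupp.linearCombination Λ id
  have hp : Function.Surjective p := Finsupp.linearCombination_id_surjective Λ X
  let K := LinearMap.ker p
  have hKp : Function.Exact K.subtype p := LinearMap.exact_subtype_ker_map p
  obtain ⟨-, ρ, -, -, -, hρ⟩ := exists_homotopy (A := K) (B := P) (i := K.subtype)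
    K.subtype_injective hKp hp hX
  obtain ⟨Φ, hΦ⟩ := Module.projective_lifting_property π (φ ∘ₗ p) hπ
  have hΦ' : ∀ z, π (Φ z) = φ (p z) := fun z => LinearMap.congr_fun hΦ z
  let m : Y →ₗ[Λ] Y := y ^ (a + 1) • LinearMap.id
  have hm : Function.Injective m := hreg
  have hK : ∀ k : K, (Φ ∘ₗ K.subtype) k ∈ LinearMap.range m := by
    intro k
    obtain ⟨w, hw⟩ := (hker (Φ k)).mp (by
      rw [hΦ', LinearMap.mem_ker.mp k.2, map_zero])
    exact ⟨w, hw⟩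
  let ψ' : K →ₗ[Λ] Y := (LinearEquiv.ofInjective m hm).symm.toLinearMap ∘ₗ
    LinearMap.codRestrict (LinearMap.range m) (Φ ∘ₗ K.subtype) hK
  have hψ' : ∀ k : K, y ^ (a + 1) • ψ' k = Φ k := by
    intro k
    have : ((LinearEquiv.ofInjective m hm (ψ' k) : LinearMap.range m) : Y) = Φ k := by
      simp [ψ']
    simpa [m] using this
  let Φ' : P →ₗ[Λ] Y := Φ - y • (ψ' ∘ₗ ρ)
  have hΦK : K ≤ LinearMap.ker Φ' := by
    intro k hk
    have h1 := LinearMap.congr_fun hρ ⟨k, hk⟩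
    have h2 := hψ' ⟨k, hk⟩
    simp only [LinearMap.comp_apply, LinearMap.smul_apply, LinearMap.id_apply,
      Submodule.subtype_apply] at h1 h2
    rw [LinearMap.mem_ker]
    simp only [Φ', LinearMap.sub_apply, LinearMap.smul_apply, LinearMap.comp_apply]
    rw [h1, LinearMap.map_smul_of_tower, ← mul_smul, ← pow_succ', h2, sub_self]
  let e := p.quotKerEquivOfSurjective hp
  refine ⟨K.liftQ Φ' hΦK ∘ₗ e.symm.toLinearMap, fun x z hz => ?_⟩
  obtain ⟨q, rfl⟩ := hp x
  have h3 : e.symm (p q) = K.mkQ q := by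
    rw [LinearEquiv.symm_apply_eq]
    rfl
  have h4 : (K.liftQ Φ' hΦK ∘ₗ e.symm.toLinearMap) (p q) = Φ q - y • ψ' (ρ q) := by
    simp only [LinearMap.comp_apply, LinearEquiv.coe_coe, h3]
    rfl
  obtain ⟨w, hw⟩ := (hker (Φ q - z)).mp (by rw [map_sub, hΦ', hz, sub_self])
  refine ⟨y ^ a • w - ψ' (ρ q), ?_⟩
  rw [h4, smul_sub, ← mul_smul, ← pow_succ', hw]
  abel

theorem exists_lift_of_isWeaklyRegular {ys : List R} {a : ℕ}
    (hreg : IsWeaklyRegular Y (ys.map (· ^ (a + 1))))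
    (hX : ∀ y ∈ ys, y ^ a ∈ stableAnn R Λ X) {π : Y →ₗ[Λ] Q} (hπ : Function.Surjective π)
    (hker : LinearMap.ker π = redSub Λ (Ideal.ofList (ys.map (· ^ (a + 1)))) Y) (φ : X →ₗ[Λ] Q) :
    ∃ ψ : X →ₗ[Λ] Y, ∀ x z, π z = φ x → ψ x - z ∈ redSub Λ (Ideal.ofList ys) Y := by
  induction ys generalizing Y with
  | nil =>
    have hinj : Function.Injective π := by
      rw [← LinearMap.ker_eq_bot, hker, eq_bot_iff]
      intro z hz
      rw [mem_redSub] at hz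
      simpa using hz
    let e := LinearEquiv.ofBijective π ⟨hinj, hπ⟩
    refine ⟨e.symm.toLinearMap ∘ₗ φ, fun x z hz => ?_⟩
    have : (e.symm.toLinearMap ∘ₗ φ) x = z := by
      simp only [LinearMap.comp_apply, LinearEquiv.coe_coe]
      rw [LinearEquiv.symm_apply_eq]
      exact hz.symm
    rw [this, sub_self]
    exact zero_mem _
  | cons y ys ih =>
    rw [List.map_cons, Ideal.ofList_cons, redSub_sup] at hker
    let Y₁ := Y ⧸ redSub Λ (Ideal.span {y ^ (a + 1)}) Y
    let π₀ : Y →ₗ[Λ] Y₁ := Submodule.mkQ _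
    have hπ₀ : Function.Surjective π₀ := Submodule.mkQ_surjective _
    have hker₀ : ∀ z, π₀ z = 0 ↔ ∃ w : Y, y ^ (a + 1) • w = z := fun z => by
      rw [← mem_redSub_span_singleton (Λ := Λ)]
      exact Submodule.Quotient.mk_eq_zero _
    rw [List.map_cons, isWeaklyRegular_cons_iff_of_surjective (π := π₀.restrictScalars R) hπ₀
      (by
        ext z
        rw [LinearMap.mem_ker, Submodule.mem_smul_pointwise_iff_exists]
        simpa using hker₀ z)] at hreg
    let π₁ : Y₁ →ₗ[Λ] Q := Submodule.liftQ _ π (by rw [hker]; exact le_sup_left)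
    have hπ₁₀ : ∀ z, π₁ (π₀ z) = π z := fun z => rfl
    have hπ₁ : Function.Surjective π₁ := fun q => by
      obtain ⟨z, rfl⟩ := hπ q
      exact ⟨π₀ z, rfl⟩
    have hker₁ : LinearMap.ker π₁ = redSub Λ (Ideal.ofList (ys.map (· ^ (a + 1)))) Y₁ := by
      ext z
      obtain ⟨z, rfl⟩ := hπ₀ z
      rw [LinearMap.mem_ker, hπ₁₀, ← LinearMap.mem_ker, hker]
      constructor
      · intro hz
        obtain ⟨u, hu, v, hv, rfl⟩ := Submodule.mem_sup.mp hz
        have hu' : π₀ u = 0 := (Submodule.Quotient.mk_eq_zero _).mpr hu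
        rw [map_add, hu', zero_add]
        exact map_mem_redSub π₀ hv
      · intro hz
        obtain ⟨v, hv, hvz⟩ := exists_mem_redSub_of_surjective hπ₀ hz
        have : z - v ∈ redSub Λ (Ideal.span {y ^ (a + 1)}) Y := by
          rw [← Submodule.Quotient.mk_eq_zero]
          change π₀ (z - v) = 0
          rw [map_sub, hvz, sub_self]
        rw [← sub_add_cancel z v]
        exact Submodule.add_mem_sup this hv
    obtain ⟨φ₁, hφ₁⟩ := ih hreg.2 (fun z hz => hX z (List.mem_cons_of_mem _ hz)) hπ₁ hker₁
    obtain ⟨ψ, hψ⟩ := exists_lift_of_smul_regular hreg.1 (hX y List.mem_cons_self) hπ₀ hker₀ φ₁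
    refine ⟨ψ, fun x z hz => ?_⟩
    obtain ⟨z₁, hz₁⟩ := hπ₀ (φ₁ x)
    obtain ⟨w, hw⟩ := hψ x z₁ hz₁
    obtain ⟨v, hv, hvz⟩ := exists_mem_redSub_of_surjective hπ₀ (hφ₁ x (π₀ z) hz)
    obtain ⟨w', hw'⟩ := (hker₀ (z₁ - z - v)).mp (by rw [map_sub, map_sub, hvz, hz₁, sub_self])
    have h1 : ψ x - z = y • w + (y ^ (a + 1) • w' + v) := by rw [hw, hw']; abel
    rw [h1, Ideal.ofList_cons]
    refine add_mem (smul_mem_redSub ?_ _) (add_mem (smul_mem_redSub ?_ _)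
      (redSub_mono le_sup_right hv))
    · exact Ideal.mem_sup_left (Ideal.mem_span_singleton_self y)
    · exact Ideal.mem_sup_left (Ideal.pow_mem_of_mem _ (Ideal.mem_span_singleton_self y) _ (by simp))

end Lifting

section Parameters

open RingTheory.Sequence Pointwise

/-- A maximal regular sequence in the maximal ideal of `R`. -/
structure IsParam (R : Type u) [CommRing R] [IsLocalRing R] (xs : List R) : Prop where
  isRegular : IsRegular R xs
  mem : ∀ r ∈ xs, r ∈ maximalIdeal R
  length_eq : (xs.length : WithBot ℕ∞) = ringKrullDim R

variable {R : Type u} [CommRing R] [IsLocalRing R] [IsNoetherianRing R] {xs : List R}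

theorem IsParam.exists_pow_le (h : IsParam R xs) (m : ℕ) :
    ∃ k, maximalIdeal R ^ k ≤ Ideal.ofList (xs.map (· ^ m)) := by
  have h1 := ringKrullDim_add_length_eq_ringKrullDim_of_isRegular xs h.isRegular
  have : ringKrullDim (R ⧸ Ideal.ofList xs) = 0 := by
    rw [← h.length_eq] at h1
    generalize ringKrullDim (R ⧸ Ideal.ofList xs) = D at h1
    cases D with
    | bot => rw [WithBot.bot_add] at h1; cases h1
    | coe x =>
      norm_cast at h1
      have h2 : x + (xs.length : ℕ∞) = 0 + xs.length := by
        rw [zero_add]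
        exact_mod_cast h1
      rw [WithTop.add_right_cancel (ENat.natCast_ne_top _) h2]
      rfl
  have : IsArtinianRing (R ⧸ Ideal.ofList xs) := by
    rw [isArtinianRing_iff_krullDimLE_zero, Ring.KrullDimLE, Order.krullDimLE_iff]
    exact this.le
  obtain ⟨k, hk⟩ := exists_maximalIdeal_pow_le_of_isArtinianRing_quotient (Ideal.ofList xs)
  have h2 : maximalIdeal R ≤ (Ideal.ofList (xs.map (· ^ m))).radical := by
    intro r hr
    have h3 : Ideal.ofList xs ≤ (Ideal.ofList (xs.map (· ^ m))).radical := by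
      refine Ideal.span_le.mpr fun x hx => ⟨m, Ideal.subset_span ?_⟩
      exact List.mem_map_of_mem hx
    exact (Ideal.radical_isRadical _) ⟨k, h3 (hk (Ideal.pow_mem_pow hr k))⟩
  exact Ideal.exists_pow_le_of_le_radical_of_fg h2 (IsNoetherian.noetherian _)

theorem IsParam.ofList_le (h : IsParam R xs) : Ideal.ofList xs ≤ maximalIdeal R :=
  Ideal.span_le.mpr h.mem

theorem length_ne_top_of_pow_smul_eq_zero {M : Type u} [AddCommGroup M] [Module R M]
    [Module.Finite R M] {k : ℕ} (h : ∀ r ∈ maximalIdeal R ^ k, ∀ m : M, r • m = 0) :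
    Module.length R M ≠ ⊤ := by
  have : IsArtinianRing (R ⧸ maximalIdeal R ^ k) := by
    by_cases hI : maximalIdeal R ^ k = ⊤
    · have : Subsingleton (R ⧸ maximalIdeal R ^ k) := Ideal.Quotient.subsingleton_iff.mpr hI
      rw [isArtinianRing_iff]
      infer_instance
    · have : Nontrivial (R ⧸ maximalIdeal R ^ k) := Ideal.Quotient.nontrivial_iff.mpr hI
      have := IsLocalRing.of_surjective' (Ideal.Quotient.mk (maximalIdeal R ^ k))
        Ideal.Quotient.mk_surjective
      rw [isArtinianRing_iff_isNilpotent_maximalIdeal]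
      refine ⟨k, ?_⟩
      rw [Ideal.zero_eq_bot, ← IsLocalRing.map_maximalIdeal_of_surjective
        (Ideal.Quotient.mk (maximalIdeal R ^ k)) Ideal.Quotient.mk_surjective, ← Ideal.map_pow,
        Ideal.map_quotient_self]
  obtain ⟨n, p, hp⟩ := Module.Finite.exists_fin' R M
  let q (i : Fin n) : (R ⧸ maximalIdeal R ^ k) →ₗ[R] M :=
    Submodule.liftQ _ (LinearMap.toSpanSingleton R M (p (Pi.single i 1)))
      fun r hr => by simpa using h r hr _
  let e : (Fin n → R ⧸ maximalIdeal R ^ k) →ₗ[R] M := ∑ i, q i ∘ₗ LinearMap.proj i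
  have he : Function.Surjective e := by
    intro z
    obtain ⟨v, rfl⟩ := hp z
    refine ⟨fun i => Submodule.Quotient.mk (v i), ?_⟩
    have h1 : v = ∑ i, v i • Pi.single i (1 : R) := by
      ext j
      simp [Pi.single_apply]
    conv_rhs => rw [h1, map_sum]
    simp only [e, LinearMap.sum_apply, LinearMap.comp_apply, LinearMap.proj_apply, map_smul]
    rfl
  have h1 := Module.length_le_of_surjective _ he
  have h2 : Module.length R (R ⧸ maximalIdeal R ^ k) ≠ ⊤ := by
    rw [Module.length_eq_of_surjective (R := R ⧸ maximalIdeal R ^ k) Ideal.Quotient.mk_surjective]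
    exact Module.length_ne_top
  refine ne_top_of_le_ne_top ?_ h1
  obtain ⟨t, ht⟩ := ENat.ne_top_iff_exists.mp h2
  rw [Module.length_pi_of_fintype, Finset.sum_const, Finset.card_univ, Fintype.card_fin, ← ht,
    nsmul_eq_mul, ← Nat.cast_mul]
  exact ENat.natCast_ne_top _

variable {Λ : Type u} [Ring Λ] [Algebra R Λ]
  {X : Type u} [AddCommGroup X] [Module Λ X] [Module R X] [IsScalarTower R Λ X]
  {Y : Type u} [AddCommGroup Y] [Module Λ Y] [Module R Y] [IsScalarTower R Λ Y]
  {ω : Type u} [AddCommGroup ω] [Module R ω]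

theorem isLattice_iff [Module.Finite R Λ] (h : IsParam R xs) :
    IsLattice R Λ ω X ↔ IsLat0 R Λ ω xs X ∧ Nontrivial X := by
  constructor
  · rintro ⟨h1, h2, h3, h4⟩
    have : Module.Finite R X := Module.Finite.trans Λ X
    refine ⟨⟨h1, h2.isWeaklyRegular h.isRegular h.mem h.length_eq, locallyProjectiveAt_iff.mp h3,
      locallyProjectiveAt_iff.mp h4⟩, ?_⟩
    obtain ⟨rs, -, hrs, -⟩ := h2
    exact hrs.nontrivial
  · rintro ⟨⟨h1, h2, h3, h4⟩, h5⟩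
    have : Module.Finite R X := Module.Finite.trans Λ X
    exact ⟨h1, ⟨xs, h.mem,
      (IsLocalRing.isRegular_iff_isWeaklyRegular_of_subset_maximalIdeal h.mem).mpr h2,
      h.length_eq⟩, locallyProjectiveAt_iff.mpr h3, locallyProjectiveAt_iff.mpr h4⟩

/-- A map into `(ys) Y` factors through a projective module if the `ys` annihilate
the stable endomorphisms of the source. -/
theorem factorsThroughProjective_of_mem_redSub {ys : List R}
    (hX : ∀ y ∈ ys, y ∈ stableAnn R Λ X) (hreg : IsWeaklyRegular Y ys) (f : X →ₗ[Λ] Y)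
    (hf : ∀ x, f x ∈ redSub Λ (Ideal.ofList ys) Y) : FactorsThroughProjective Λ f := by
  induction ys generalizing Y with
  | nil =>
    have : f = 0 := by
      ext x
      have := hf x
      rw [mem_redSub] at this
      simpa using this
    rw [this]
    exact (projTrivial R Λ X Y).zero_mem
  | cons y ys ih =>
    let Y₁ := Y ⧸ redSub Λ (Ideal.span {y}) Y
    let π₀ : Y →ₗ[Λ] Y₁ := Submodule.mkQ _
    have hπ₀ : Function.Surjective π₀ := Submodule.mkQ_surjective _
    have hker₀ : ∀ z, π₀ z = 0 ↔ ∃ w : Y, y • w = z := fun z => by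
      rw [← mem_redSub_span_singleton (Λ := Λ)]
      exact Submodule.Quotient.mk_eq_zero _
    rw [isWeaklyRegular_cons_iff_of_surjective (π := π₀.restrictScalars R) hπ₀
      (by
        ext z
        rw [LinearMap.mem_ker, Submodule.mem_smul_pointwise_iff_exists]
        simpa using hker₀ z)] at hreg
    have h1 : FactorsThroughProjective Λ (π₀ ∘ₗ f) := by
      refine ih (fun z hz => hX z (List.mem_cons_of_mem _ hz)) hreg.2 _ fun x => ?_
      have h2 := hf x
      rw [Ideal.ofList_cons, redSub_sup] at h2
      obtain ⟨u, hu, v, hv, huv⟩ := Submodule.mem_sup.mp h2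
      have hu' : π₀ u = 0 := (Submodule.Quotient.mk_eq_zero _).mpr hu
      rw [LinearMap.comp_apply, ← huv, map_add, hu', zero_add]
      exact map_mem_redSub π₀ hv
    obtain ⟨g, hg, hgf⟩ := h1.lift hπ₀
    let m : Y →ₗ[Λ] Y := y • LinearMap.id
    have hm : Function.Injective m := hreg.1
    have hK : ∀ x, (f - g) x ∈ LinearMap.range m := by
      intro x
      obtain ⟨w, hw⟩ := (hker₀ ((f - g) x)).mp (by
        have := LinearMap.congr_fun hgf x
        simp only [LinearMap.comp_apply] at this
        rw [LinearMap.sub_apply, map_sub, this, sub_self])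
      exact ⟨w, hw⟩
    let u : X →ₗ[Λ] Y := (LinearEquiv.ofInjective m hm).symm.toLinearMap ∘ₗ
      LinearMap.codRestrict (LinearMap.range m) (f - g) hK
    have hu : f = g + y • u := by
      ext x
      have : ((LinearEquiv.ofInjective m hm (u x) : LinearMap.range m) : Y) = (f - g) x := by
        simp [u]
      have h3 : y • u x = f x - g x := by simpa [m] using this
      simp [h3]
    rw [hu]
    exact hg.add (stableAnn_smul_right (hX y List.mem_cons_self) u)

theorem length_hom_le {n : ℕ} {p : (Fin n → Λ) →ₗ[Λ] X} (hp : Function.Surjective p) :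
    Module.length R (X →ₗ[Λ] Y) ≤ n * Module.length R Y := by
  let e : (X →ₗ[Λ] Y) →ₗ[R] (Fin n → Y) :=
    { toFun := fun f i => f (p (Pi.single i 1))
      map_add' := fun _ _ => rfl
      map_smul' := fun _ _ => rfl }
  have he : Function.Injective e := by
    intro f g hfg
    have h1 : f ∘ₗ p = g ∘ₗ p := by
      ext i
      exact congrFun hfg i
    exact (LinearMap.cancel_right hp).mp h1
  have := Module.length_le_of_injective e he
  simpa using this

theorem length_quotient_redSub_le {n : ℕ} {p : (Fin n → Λ) →ₗ[Λ] X} (hp : Function.Surjective p)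
    (I : Ideal R) :
    Module.length R (X ⧸ redSub Λ I X) ≤ n * Module.length R (Λ ⧸ redSub Λ I Λ) := by
  let q (i : Fin n) : (Λ ⧸ redSub Λ I Λ) →ₗ[Λ] (X ⧸ redSub Λ I X) :=
    Submodule.mapQ _ _ (p ∘ₗ LinearMap.single Λ (fun _ => Λ) i) fun a ha => map_mem_redSub _ ha
  let e : (Fin n → Λ ⧸ redSub Λ I Λ) →ₗ[Λ] (X ⧸ redSub Λ I X) :=
    ∑ i, q i ∘ₗ LinearMap.proj i
  have he : Function.Surjective (e.restrictScalars R) := by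
    intro z
    obtain ⟨x, rfl⟩ := Submodule.mkQ_surjective _ z
    obtain ⟨v, rfl⟩ := hp x
    refine ⟨fun i => Submodule.Quotient.mk (v i), ?_⟩
    have h1 : v = ∑ i, Pi.single i (v i) := (Finset.univ_sum_single v).symm
    conv_rhs => rw [h1, map_sum, map_sum]
    simp [e, q]
  have := Module.length_le_of_surjective _ he
  simpa using this

theorem length_stableHom_le {ys : List R}
    (hX : ∀ y ∈ ys, y ∈ stableAnn R Λ X) (hreg : IsWeaklyRegular Y ys) :
    Module.length R (stableHom R Λ X Y) ≤
      Module.length R (X →ₗ[Λ] (Y ⧸ redSub Λ (Ideal.ofList ys) Y)) := by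
  let c : (X →ₗ[Λ] Y) →ₗ[R] (X →ₗ[Λ] (Y ⧸ redSub Λ (Ideal.ofList ys) Y)) :=
    { toFun := fun f => Submodule.mkQ _ ∘ₗ f
      map_add' := fun f g => by ext; simp
      map_smul' := fun r f => by ext; simp }
  have hc : LinearMap.ker c ≤ projTrivial R Λ X Y := by
    intro f hf
    refine factorsThroughProjective_of_mem_redSub hX hreg f fun x => ?_
    exact (Submodule.Quotient.mk_eq_zero _).mp (LinearMap.congr_fun (LinearMap.mem_ker.mp hf) x)
  have h1 : Module.length R ((X →ₗ[Λ] Y) ⧸ projTrivial R Λ X Y) ≤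
      Module.length R ((X →ₗ[Λ] Y) ⧸ LinearMap.ker c) :=
    Module.length_le_of_surjective (Submodule.factor hc) (Submodule.factor_surjective hc)
  refine h1.trans ?_
  exact Module.length_le_of_injective ((LinearMap.ker c).liftQ c le_rfl)
    (LinearMap.ker_eq_bot.mp (Submodule.ker_liftQ_eq_bot _ _ _ le_rfl))

end Parameters

section ResolutionLifting

variable {R : Type u} [CommRing R] {Λ : Type u} [Ring Λ] [Algebra R Λ]
  {A B C K Y Z : Type u} [AddCommGroup A] [Module Λ A] [AddCommGroup B] [Module Λ B]
  [AddCommGroup C] [Module Λ C] [AddCommGroup K] [Module Λ K]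
  [AddCommGroup Y] [Module Λ Y] [AddCommGroup Z] [Module Λ Z]

theorem exists_comp_eq_of_injective {j : A →ₗ[Λ] B} (hj : Function.Injective j) {f : C →ₗ[Λ] B}
    (h : ∀ c, f c ∈ LinearMap.range j) : ∃ k : C →ₗ[Λ] A, j ∘ₗ k = f := by
  refine ⟨(LinearEquiv.ofInjective j hj).symm.toLinearMap ∘ₗ LinearMap.codRestrict _ f h, ?_⟩
  ext c
  have : ((LinearEquiv.ofInjective j hj ((LinearEquiv.ofInjective j hj).symm
    (LinearMap.codRestrict _ f h c)) : LinearMap.range j) : B) = f c := by simp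
  exact this

theorem exists_comp_eq_of_surjective {p : A →ₗ[Λ] B} (hp : Function.Surjective p) {f : A →ₗ[Λ] C}
    (h : ∀ a, p a = 0 → f a = 0) : ∃ k : B →ₗ[Λ] C, k ∘ₗ p = f := by
  refine ⟨(LinearMap.ker p).liftQ f (fun a ha => h a ha) ∘ₗ
    (p.quotKerEquivOfSurjective hp).symm.toLinearMap, ?_⟩
  ext a
  have : (p.quotKerEquivOfSurjective hp).symm (p a) = (LinearMap.ker p).mkQ a := by
    rw [LinearEquiv.symm_apply_eq]
    rfl
  simp only [LinearMap.comp_apply, LinearEquiv.coe_coe, this]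
  rfl

theorem exists_retraction {j : Y →ₗ[Λ] B} {q : B →ₗ[Λ] Z} (hj : Function.Injective j)
    (hjq : Function.Exact j q) {s : Z →ₗ[Λ] B} (hs : q ∘ₗ s = LinearMap.id) :
    ∃ r : B →ₗ[Λ] Y, r ∘ₗ j = LinearMap.id := by
  obtain ⟨r, hr⟩ := exists_comp_eq_of_injective hj (f := LinearMap.id - s ∘ₗ q) fun b => by
    refine (hjq _).mp ?_
    have := LinearMap.congr_fun hs (q b)
    simp only [LinearMap.comp_apply, LinearMap.id_apply] at this
    simp [this]
  refine ⟨r, ?_⟩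
  ext y
  apply hj
  have := LinearMap.congr_fun hr (j y)
  simp only [LinearMap.comp_apply, LinearMap.id_apply, LinearMap.sub_apply,
    hjq.apply_apply_eq_zero, map_zero, sub_zero] at this
  exact this

theorem exists_pushout [Module R B] [IsScalarTower R Λ B] [Module R Y] [IsScalarTower R Λ Y]
    {i : K →ₗ[Λ] B} {g : B →ₗ[Λ] Z} (hi : Function.Injective i)
    (hig : Function.Exact i g) (hg : Function.Surjective g) (β : K →ₗ[Λ] Y) :
    ∃ (E : LMod R Λ) (j : Y →ₗ[Λ] E) (l : B →ₗ[Λ] E) (q : E →ₗ[Λ] Z),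
      j ∘ₗ β = l ∘ₗ i ∧ q ∘ₗ l = g ∧ Function.Injective j ∧ Function.Exact j q ∧
        Function.Surjective q := by
  let D : Submodule Λ (Y × B) := LinearMap.range (β.prod (-i))
  let q : (Y × B) ⧸ D →ₗ[Λ] Z := D.liftQ (g ∘ₗ LinearMap.snd Λ Y B) (by
    rintro _ ⟨k, rfl⟩
    simp [hig.apply_apply_eq_zero])
  refine ⟨⟨(Y × B) ⧸ D⟩, D.mkQ ∘ₗ LinearMap.inl Λ Y B, D.mkQ ∘ₗ LinearMap.inr Λ Y B, q,
    ?_, ?_, ?_, ?_, ?_⟩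
  · ext k
    refine (Submodule.Quotient.eq D).mpr ⟨k, ?_⟩
    simp
  · ext b
    rfl
  · rw [← LinearMap.ker_eq_bot, LinearMap.ker_eq_bot']
    intro y hy
    obtain ⟨k, hk⟩ := (Submodule.Quotient.mk_eq_zero D).mp hy
    have h1 : β k = y := congrArg Prod.fst hk
    have h2 : -i k = 0 := congrArg Prod.snd hk
    have h3 : k = 0 := hi (by rw [map_zero, ← neg_eq_zero, h2])
    rw [← h1, h3, map_zero]
  · intro z
    obtain ⟨⟨y, b⟩, rfl⟩ := D.mkQ_surjective z
    constructor
    · intro hz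
      have hz' : g b = 0 := hz
      obtain ⟨k, rfl⟩ := (hig b).mp hz'
      refine ⟨y + β k, (Submodule.Quotient.eq D).mpr ⟨k, ?_⟩⟩
      simp
    · rintro ⟨y', hy'⟩
      rw [← hy']
      change g 0 = 0
      exact map_zero g
  · intro z
    obtain ⟨b, rfl⟩ := hg z
    exact ⟨D.mkQ (0, b), rfl⟩

variable [IsLocalRing R] [IsNoetherianRing R] [Module.Finite R Λ] {xs : List R}
  {ω : Type u} [AddCommGroup ω] [Module R ω]
  [Module R Y] [IsScalarTower R Λ Y] [Module R Z] [IsScalarTower R Λ Z]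
  [Module R B] [IsScalarTower R Λ B]

theorem IsLatInjective.exists_extend (h : IsParam R xs) (hY : IsLatInjective R Λ ω Y)
    (hZ : IsLat0 R Λ ω xs Z) {i : K →ₗ[Λ] B} {g : B →ₗ[Λ] Z} (hi : Function.Injective i)
    (hig : Function.Exact i g) (hg : Function.Surjective g) (β : K →ₗ[Λ] Y) :
    ∃ γ : B →ₗ[Λ] Y, γ ∘ₗ i = β := by
  obtain ⟨E, j, l, q, hjl, hql, hj, hjq, hq⟩ := exists_pushout (R := R) hi hig hg β
  have hs : ∃ s : Z →ₗ[Λ] E, q ∘ₗ s = LinearMap.id := by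
    cases subsingleton_or_nontrivial Z with
    | inl hs => exact ⟨0, LinearMap.ext fun z => Subsingleton.elim _ _⟩
    | inr hn =>
      refine hY.2 Z _ _ _ inferInstance ((isLattice_iff h).mpr ⟨hZ, hn⟩) E _ _ q hq ⟨?_⟩
      exact ((LinearEquiv.ofInjective j hj).trans (LinearEquiv.ofEq _ _
        hjq.linearMap_ker_eq.symm)).symm
  obtain ⟨s, hs⟩ := hs
  obtain ⟨r, hr⟩ := exists_retraction hj hjq hs
  exact ⟨r ∘ₗ l, by rw [LinearMap.comp_assoc, ← hjl, ← LinearMap.comp_assoc, hr,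
    LinearMap.id_comp]⟩

/-- Maps from first syzygies of lattices to `Y` extend to the free modules they sit in. -/
def SyzygyExtends (R : Type u) [CommRing R] [IsLocalRing R] (Λ : Type u) [Ring Λ] [Algebra R Λ]
    (ω : Type u) [AddCommGroup ω] [Module R ω] (xs : List R)
    (Y : Type u) [AddCommGroup Y] [Module Λ Y] : Prop :=
  ∀ (Z : LMod R Λ), IsLat0 R Λ ω xs Z → ∀ (n : ℕ) (p : (Fin n → Λ) →ₗ[Λ] Z),
    Function.Surjective p → ∀ β : LinearMap.ker p →ₗ[Λ] Y,
      ∃ γ : (Fin n → Λ) →ₗ[Λ] Y, γ ∘ₗ (LinearMap.ker p).subtype = β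

theorem SyzygyExtends.exists_lift (hY : SyzygyExtends R Λ ω xs Y) (hZ : IsLat0 R Λ ω xs Z)
    {i : Y →ₗ[Λ] A} {g : A →ₗ[Λ] C} (hi : Function.Injective i) (hig : Function.Exact i g)
    (hg : Function.Surjective g) (f : Z →ₗ[Λ] C) : ∃ k : Z →ₗ[Λ] A, g ∘ₗ k = f := by
  have := hZ.finite
  obtain ⟨n, p, hp⟩ := Module.Finite.exists_fin' Λ Z
  obtain ⟨F, hF⟩ := Module.projective_lifting_property g (f ∘ₗ p) hg
  have hF' : ∀ x, g (F x) = f (p x) := fun x => LinearMap.congr_fun hF x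
  obtain ⟨β, hβ⟩ := exists_comp_eq_of_injective hi (f := F ∘ₗ (LinearMap.ker p).subtype)
    fun x => (hig _).mp (by
      rw [LinearMap.comp_apply, hF', Submodule.subtype_apply, LinearMap.mem_ker.mp x.2, map_zero])
  obtain ⟨γ, hγ⟩ := hY ⟨Z⟩ hZ n p hp β
  obtain ⟨k, hk⟩ := exists_comp_eq_of_surjective hp (f := F - i ∘ₗ γ) fun x hx => by
    have h1 := LinearMap.congr_fun hγ ⟨x, hx⟩
    have h2 := LinearMap.congr_fun hβ ⟨x, hx⟩
    simp only [LinearMap.comp_apply, Submodule.subtype_apply] at h1 h2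
    simp [h1, h2]
  refine ⟨k, LinearMap.ext fun z => ?_⟩
  obtain ⟨x, rfl⟩ := hp z
  have h1 := LinearMap.congr_fun hk x
  simp only [LinearMap.comp_apply, LinearMap.sub_apply] at h1 ⊢
  rw [h1, map_sub, hF', hig.apply_apply_eq_zero, sub_zero]

theorem HasLatInjResOfLength.syzygyExtends (h : IsParam R xs) (hΛ : IsLat0 R Λ ω xs Λ) {t : ℕ}
    (hY : HasLatInjResOfLength R Λ ω t Y) : SyzygyExtends R Λ ω xs Y := by
  induction t generalizing Y with
  | zero =>
    intro Z hZ n p hp β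
    have hex : Function.Exact (LinearMap.ker p).subtype p := LinearMap.exact_subtype_ker_map p
    exact IsLatInjective.exists_extend h hY hZ (Submodule.subtype_injective _) hex hp β
  | succ t ih =>
    obtain ⟨L, _, _, _, _, π, hL, hπ, hker⟩ := hY
    intro Z hZ n p hp β
    have : IsNoetherianRing Λ := IsNoetherianRing.of_finite R Λ
    have hex : Function.Exact (LinearMap.ker π).subtype π := LinearMap.exact_subtype_ker_map π
    have hex' : Function.Exact (LinearMap.ker p).subtype p := LinearMap.exact_subtype_ker_map p
    obtain ⟨β', hβ'⟩ := (ih hker).exists_lift ((hΛ.pi n).ker hp hZ)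
      (Submodule.subtype_injective _) hex hπ β
    obtain ⟨γ, hγ⟩ := IsLatInjective.exists_extend h hL hZ (Submodule.subtype_injective _)
      hex' hp β'
    exact ⟨π ∘ₗ γ, by rw [LinearMap.comp_assoc, hγ, hβ']⟩

theorem HasLatInjResOfLength.exists_precover (h : IsParam R xs) (hΛ : IsLat0 R Λ ω xs Λ) {t : ℕ}
    (hY : HasLatInjResOfLength R Λ ω t Y) :
    ∃ (I : LMod R Λ) (π : I →ₗ[Λ] Y), IsLat0 R Λ ω xs I ∧ Function.Surjective π ∧
      ∀ (Z : LMod R Λ), IsLat0 R Λ ω xs Z → ∀ f : Z →ₗ[Λ] Y, ∃ k : Z →ₗ[Λ] I, π ∘ₗ k = f := by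
  cases t with
  | zero =>
    exact ⟨⟨Y⟩, LinearMap.id, ((isLattice_iff h).mp (And.left hY)).1, Function.surjective_id,
      fun Z hZ f => ⟨f, rfl⟩⟩
  | succ t =>
    obtain ⟨L, _, _, _, _, π, hL, hπ, hker⟩ := hY
    have hex : Function.Exact (LinearMap.ker π).subtype π := LinearMap.exact_subtype_ker_map π
    exact ⟨⟨L⟩, π, ((isLattice_iff h).mp hL.1).1, hπ, fun Z hZ f =>
      (hker.syzygyExtends h hΛ).exists_lift hZ (Submodule.subtype_injective _) hex hπ f⟩

end ResolutionLifting

section Endomorphisms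

open TensorProduct in
theorem isPrecomplete_of_finite {R : Type u} [CommRing R] (I : Ideal R) [IsPrecomplete I R]
    (M : Type u) [AddCommGroup M] [Module R M] [Module.Finite R M] : IsPrecomplete I M := by
  rw [← AdicCompletion.of_surjective_iff]
  intro z
  obtain ⟨t, rfl⟩ := AdicCompletion.ofTensorProduct_surjective_of_finite I M z
  induction t with
  | zero => exact ⟨0, by simp⟩
  | add t s ht hs =>
    obtain ⟨m, hm⟩ := ht
    obtain ⟨m', hm'⟩ := hs
    exact ⟨m + m', by rw [map_add, map_add, hm, hm']⟩
  | tmul r m =>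
    obtain ⟨a, rfl⟩ := AdicCompletion.of_surjective I R r
    refine ⟨a • m, ?_⟩
    rw [AdicCompletion.ofTensorProduct_tmul, map_smul]
    ext n
    rfl

theorem henselianRing_of_finite (R : Type u) [CommRing R] [IsNoetherianRing R] [IsLocalRing R]
    [IsAdicComplete (maximalIdeal R) R] (B : Type u) [CommRing B] [Algebra R B]
    [Module.Finite R B] : HenselianRing B ((maximalIdeal R).map (algebraMap R B)) := by
  have h1 : IsPrecomplete (maximalIdeal R) B := isPrecomplete_of_finite _ _
  have h2 : IsPrecomplete ((maximalIdeal R).map (algebraMap R B)) B :=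
    IsPrecomplete.map_algebraMap_iff.mpr h1
  have h3 : IsHausdorff ((maximalIdeal R).map (algebraMap R B)) B :=
    IsHausdorff.map_algebraMap_iff.mpr inferInstance
  have h4 : IsAdicComplete ((maximalIdeal R).map (algebraMap R B)) B := { h2, h3 with }
  infer_instance

theorem exists_idempotent_commRing (R : Type u) [CommRing R] [IsNoetherianRing R] [IsLocalRing R]
    [IsAdicComplete (maximalIdeal R) R] {B : Type u} [CommRing B] [Algebra R B]
    [Module.Finite R B] (φ : B) : ∃ (e ψ : B) (n : ℕ), e * e = e ∧ ψ * φ = e ∧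
      φ ^ n * (1 - e) ∈ (maximalIdeal R).map (algebraMap R B) := by
  set J := (maximalIdeal R).map (algebraMap R B) with hJ
  have hH : HenselianRing B J := henselianRing_of_finite R B
  have hart : IsArtinian R (B ⧸ J) := by
    have : Module.length R (B ⧸ J) ≠ ⊤ :=
      length_ne_top_of_pow_smul_eq_zero (k := 1) fun r hr m => by
        rw [pow_one] at hr
        obtain ⟨m, rfl⟩ := Ideal.Quotient.mk_surjective m
        rw [Algebra.smul_def, IsScalarTower.algebraMap_apply R B (B ⧸ J)]
        have : algebraMap B (B ⧸ J) (algebraMap R B r) = 0 :=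
          Ideal.Quotient.eq_zero_iff_mem.mpr (Ideal.mem_map_of_mem _ hr)
        rw [this, zero_mul]
    have := (Module.length_ne_top_iff.mp this)
    exact (isFiniteLength_iff_isNoetherian_isArtinian.mp this).2
  have hart' : IsArtinianRing (B ⧸ J) := isArtinian_of_tower R hart
  obtain ⟨n, y, hy⟩ := IsArtinian.exists_pow_succ_smul_dvd (Ideal.Quotient.mk J φ) (1 : B ⧸ J)
  obtain ⟨b, rfl⟩ := Ideal.Quotient.mk_surjective y
  simp only [smul_eq_mul, mul_one] at hy
  set q := Ideal.Quotient.mk J with hq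
  have hy2 : ∀ k, q φ ^ n = q φ ^ (n + k) * q b ^ k := by
    intro k
    induction k with
    | zero => simp
    | succ k ih =>
      calc q φ ^ n = q φ ^ (n + k) * q b ^ k := ih
        _ = (q φ ^ (n + 1) * q b) * q φ ^ k * q b ^ k := by rw [hy]; ring
        _ = _ := by ring
  have hE : q φ ^ (n + 1) * q b ^ (n + 1) * (q φ ^ (n + 1) * q b ^ (n + 1)) =
      q φ ^ (n + 1) * q b ^ (n + 1) := by
    have := hy2 (n + 1)
    calc _ = (q φ ^ (n + (n + 1)) * q b ^ (n + 1)) * (q φ * q b ^ (n + 1)) := by ring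
      _ = _ := by rw [← this]; ring
  obtain ⟨e, he, hee⟩ := hH.is_henselian (Polynomial.X ^ 2 - Polynomial.X) (by monicity!)
    (φ ^ (n + 1) * b ^ (n + 1)) (by
      rw [← Ideal.Quotient.eq_zero_iff_mem]
      simp only [Polynomial.eval_sub, Polynomial.eval_pow, Polynomial.eval_X, map_sub, map_mul,
        map_pow]
      rw [sq, hE, sub_self]) (by
      refine IsUnit.of_mul_eq_one (q (2 * (φ ^ (n + 1) * b ^ (n + 1)) - 1)) ?_
      have h2 : q 2 = 2 := map_ofNat q 2
      have h3 : (Polynomial.eval (φ ^ (n + 1) * b ^ (n + 1)) 2 : B) = 2 := Polynomial.eval_ofNat 2 _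
      simp only [Polynomial.derivative_X_pow, Polynomial.derivative_X,
        Polynomial.eval_sub, Polynomial.eval_mul, Polynomial.eval_X, map_sub,
        map_mul, map_pow, Polynomial.eval_one, map_one, ← hq, h2, h3, map_ofNat, Nat.cast_ofNat,
        Nat.add_one_sub_one, pow_one]
      linear_combination 4 * hE)
  have he' : e * e = e := by
    have : e ^ 2 - e = 0 := by simpa [Polynomial.IsRoot] using he
    linear_combination this
  have hqe : q e = q φ ^ (n + 1) * q b ^ (n + 1) := by
    have := (Ideal.Quotient.mk_eq_mk_iff_sub_mem (I := J) _ _).mpr hee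
    simpa using this
  have hu : IsUnit (φ * (φ ^ n * b ^ (n + 1)) * e + (1 - e)) := by
    have h1 : φ * (φ ^ n * b ^ (n + 1)) * e + (1 - e) - 1 ∈ J := by
      rw [← Ideal.Quotient.eq_zero_iff_mem]
      simp only [map_sub, map_add, map_mul, map_pow, map_one, ← hq, hqe]
      linear_combination hE
    have h2 := hH.jac h1
    rw [Ideal.mem_jacobson_bot] at h2
    simpa using h2 1
  obtain ⟨v, hv⟩ := hu.exists_left_inv
  refine ⟨e, v * (φ ^ n * b ^ (n + 1)) * e, n, he', ?_, ?_⟩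
  · linear_combination e * hv + v * (1 - φ * (φ ^ n * b ^ (n + 1))) * he'
  · rw [← Ideal.Quotient.eq_zero_iff_mem]
    simp only [map_sub, map_mul, map_pow, map_one, ← hq, hqe]
    have := hy2 (n + 1)
    linear_combination this

theorem finite_hom {R : Type u} [CommRing R] [IsNoetherianRing R] {Λ : Type u} [Ring Λ]
    [Algebra R Λ] (L M : Type u) [AddCommGroup L] [Module Λ L] [Module R L] [IsScalarTower R Λ L]
    [AddCommGroup M] [Module Λ M] [Module R M] [IsScalarTower R Λ M] [Module.Finite R L]
    [Module.Finite R M] : Module.Finite R (L →ₗ[Λ] M) :=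
  Module.Finite.of_injective (LinearMap.restrictScalarsₗ R Λ L M R)
    (LinearMap.restrictScalars_injective R)

section

variable {R : Type u} [CommRing R] [IsNoetherianRing R] [IsLocalRing R]
  [IsAdicComplete (maximalIdeal R) R] {Λ : Type u} [Ring Λ] [Algebra R Λ] [Module.Finite R Λ]
  {L M N : Type u} [AddCommGroup L] [Module Λ L] [Module R L] [IsScalarTower R Λ L]
  [AddCommGroup M] [Module Λ M] [Module R M] [IsScalarTower R Λ M]
  [AddCommGroup N] [Module Λ N] [Module R N] [IsScalarTower R Λ N]

theorem exists_idempotent_end [Module.Finite R L] (φ : Module.End Λ L) :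
    ∃ (e ψ : Module.End Λ L) (n : ℕ), e * e = e ∧ Commute φ e ∧ ψ * φ = e ∧ φ * ψ = e ∧
      ∀ z, (φ ^ n * (1 - e)) z ∈ (maximalIdeal R • ⊤ : Submodule R L) := by
  have h0 : Module.Finite R (Module.End Λ L) := finite_hom L L
  let f : Polynomial R →ₐ[R] Module.End Λ L := Polynomial.aeval φ
  let g := Ideal.kerLiftAlg f
  have hg : Function.Injective g := Ideal.kerLiftAlg_injective f
  have h1 : Module.Finite R (Polynomial R ⧸ RingHom.ker f) :=
    Module.Finite.of_injective g.toLinearMap hg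
  let x : Polynomial R ⧸ RingHom.ker f := Ideal.Quotient.mk _ Polynomial.X
  have hx : g x = φ := by simp [g, x, f, Ideal.kerLiftAlg_mk]
  obtain ⟨e, ψ, n, h1, h2, h3⟩ := exists_idempotent_commRing R x
  have h4 : ∀ y ∈ (maximalIdeal R).map (algebraMap R (Polynomial R ⧸ RingHom.ker f)),
      ∀ z, g y z ∈ (maximalIdeal R • ⊤ : Submodule R L) := by
    intro y hy z
    induction hy using Submodule.span_induction with
    | mem y hy =>
      obtain ⟨r, hr, rfl⟩ := hy
      rw [AlgHom.commutes]
      exact Submodule.smul_mem_smul hr Submodule.mem_top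
    | zero => simp
    | add y y' _ _ h h' =>
      rw [map_add]
      exact add_mem h h'
    | smul a y _ h =>
      rw [smul_eq_mul, map_mul]
      have : (maximalIdeal R • ⊤ : Submodule R L) ≤
          Submodule.comap ((g a).restrictScalars R) (maximalIdeal R • ⊤) := by
        rw [← Submodule.map_le_iff_le_comap, Submodule.map_smul'']
        exact Submodule.smul_mono le_rfl le_top
      exact this h
  refine ⟨g e, g ψ, n, by rw [← map_mul, h1], ?_, ?_, ?_, fun z => ?_⟩
  · rw [← hx]
    exact (Commute.all x e).map g
  · rw [← hx, ← map_mul, h2]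
  · rw [← hx, ← map_mul, mul_comm, h2]
  · have := h4 _ h3 z
    rwa [map_mul, map_pow, map_sub, map_one, hx] at this

end

end Endomorphisms

section Indecomposables

theorem length_lt_of_surjective {R : Type u} [CommRing R] {M N : Type u} [AddCommGroup M]
    [Module R M] [AddCommGroup N] [Module R N] (f : M →ₗ[R] N) (hf : Function.Surjective f)
    (hf' : ¬ Function.Injective f) (h : Module.length R N ≠ ⊤) :
    Module.length R N < Module.length R M := by
  have h1 := Module.length_eq_add_of_exact (LinearMap.ker f).subtype f
    (Submodule.subtype_injective _) hf (LinearMap.exact_subtype_ker_map f)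
  have h2 : Module.length R (LinearMap.ker f) ≠ 0 := by
    rw [Ne, Module.length_eq_zero_iff]
    intro hs
    apply hf'
    rw [← LinearMap.ker_eq_bot]
    exact Submodule.eq_bot_of_subsingleton
  rw [h1, add_comm]
  generalize Module.length R (LinearMap.ker f) = a at h2
  lift Module.length R N to ℕ using h with n
  cases a with
  | top => simp
  | coe a =>
    norm_cast at h2 ⊢
    lia

theorem IsIndecomposable.eq_zero_or_one {Λ : Type u} [Ring Λ] {L : Type u} [AddCommGroup L]
    [Module Λ L] (h : IsIndecomposable Λ L) {e : Module.End Λ L} (he : e * e = e) :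
    e = 0 ∨ e = 1 := by
  have h1 := (LinearMap.IsIdempotentElem.isProj_range e he).isCompl
  rcases h.2 _ _ h1 with h2 | h2
  · exact .inl (LinearMap.range_eq_bot.mp h2)
  · right
    have h3 := LinearMap.ker_eq_bot.mp h2
    ext z
    exact h3 (LinearMap.congr_fun he z)

theorem bijective_of_retract {Λ : Type u} [Ring Λ] {L A : Type u} [AddCommGroup L]
    [Module Λ L] [AddCommGroup A] [Module Λ A] [Nontrivial A] (h : IsIndecomposable Λ L)
    {i : A →ₗ[Λ] L} {p : L →ₗ[Λ] A} (hpi : p ∘ₗ i = LinearMap.id) : Function.Bijective i := by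
  have h1 : ∀ a, p (i a) = a := fun a => LinearMap.congr_fun hpi a
  refine ⟨Function.LeftInverse.injective h1, ?_⟩
  have he : (i ∘ₗ p : Module.End Λ L) * (i ∘ₗ p) = i ∘ₗ p := by
    ext z
    simp [h1]
  rcases h.eq_zero_or_one he with h2 | h2
  · obtain ⟨a, ha⟩ := exists_ne (0 : A)
    have := LinearMap.congr_fun h2 (i a)
    simp only [LinearMap.comp_apply, h1, LinearMap.zero_apply] at this
    have h3 := congrArg p this
    rw [h1, map_zero] at h3
    exact absurd h3 ha
  · intro z
    exact ⟨p z, LinearMap.congr_fun h2 z⟩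

section

variable {R : Type u} [CommRing R] [IsNoetherianRing R] [IsLocalRing R]
  {Λ : Type u} [Ring Λ] [Algebra R Λ]
  {L M N : Type u} [AddCommGroup L] [Module Λ L] [Module R L] [IsScalarTower R Λ L]
  [AddCommGroup M] [Module Λ M] [Module R M] [IsScalarTower R Λ M]
  [AddCommGroup N] [Module Λ N] [Module R N] [IsScalarTower R Λ N]

theorem map_mem_smul_top (I : Ideal R) (f : L →ₗ[Λ] M) {z : L}
    (hz : z ∈ (I • ⊤ : Submodule R L)) : f z ∈ (I • ⊤ : Submodule R M) := by
  have : (I • ⊤ : Submodule R L) ≤ Submodule.comap (f.restrictScalars R) (I • ⊤) := by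
    rw [← Submodule.map_le_iff_le_comap, Submodule.map_smul'']
    exact Submodule.smul_mono le_rfl le_top
  exact this hz

variable (R) in
/-- The length of `L / 𝔪 L`. -/
noncomputable def topLength (L : Type u) [AddCommGroup L] [Module R L] : ℕ :=
  (Module.length R (L ⧸ (maximalIdeal R • ⊤ : Submodule R L))).toNat

theorem length_top_ne_top (L : Type u) [AddCommGroup L] [Module R L] [Module.Finite R L] :
    Module.length R (L ⧸ (maximalIdeal R • ⊤ : Submodule R L)) ≠ ⊤ :=
  length_ne_top_of_pow_smul_eq_zero (k := 1) fun r hr m => by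
    rw [pow_one] at hr
    obtain ⟨m, rfl⟩ := Submodule.mkQ_surjective _ m
    rw [← map_smul, Submodule.mkQ_apply, Submodule.Quotient.mk_eq_zero]
    exact Submodule.smul_mem_smul hr Submodule.mem_top

theorem topLength_lt [Module.Finite R L] {i : M →ₗ[Λ] L} {p : L →ₗ[Λ] M}
    (hpi : p ∘ₗ i = LinearMap.id) (hi : ¬ Function.Surjective i) :
    topLength R M < topLength R L := by
  have h1 : ∀ a, p (i a) = a := fun a => LinearMap.congr_fun hpi a
  have hp : Function.Surjective p := fun a => ⟨i a, h1 a⟩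
  have hM : Module.Finite R M := Module.Finite.of_surjective (p.restrictScalars R) hp
  let q : (L ⧸ (maximalIdeal R • ⊤ : Submodule R L)) →ₗ[R]
      (M ⧸ (maximalIdeal R • ⊤ : Submodule R M)) :=
    Submodule.mapQ _ _ (p.restrictScalars R) fun z hz => map_mem_smul_top _ p hz
  have hlt : Module.length R (M ⧸ (maximalIdeal R • ⊤ : Submodule R M)) <
      Module.length R (L ⧸ (maximalIdeal R • ⊤ : Submodule R L)) := by
    refine length_lt_of_surjective q ?_ ?_ (length_top_ne_top M)
    · intro z
      obtain ⟨z, rfl⟩ := Submodule.mkQ_surjective _ z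
      obtain ⟨y, rfl⟩ := hp z
      exact ⟨Submodule.mkQ _ y, rfl⟩
    · intro hq
      apply hi
      have h2 : LinearMap.ker (p.restrictScalars R) ≤ ⊥ := by
        refine Submodule.le_of_le_smul_of_le_jacobson_bot (I := maximalIdeal R)
          (IsNoetherian.noetherian _) (maximalIdeal_le_jacobson _) ?_
        rw [bot_sup_eq]
        intro x hx
        have hx' : p x = 0 := hx
        have h3 : x ∈ (maximalIdeal R • ⊤ : Submodule R L) := by
          rw [← Submodule.Quotient.mk_eq_zero]
          apply hq
          rw [map_zero]
          change Submodule.Quotient.mk (p x) = 0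
          rw [hx', Submodule.Quotient.mk_zero]
        have h4 : x = ((LinearMap.id - i ∘ₗ p).restrictScalars R) x := by simp [hx']
        rw [h4]
        have h5 := Submodule.mem_map_of_mem (f := (LinearMap.id - i ∘ₗ p).restrictScalars R) h3
        rw [Submodule.map_smul''] at h5
        refine Submodule.smul_mono le_rfl ?_ h5
        rintro _ ⟨y, -, rfl⟩
        simp [h1]
      intro x
      refine ⟨p x, ?_⟩
      have : i (p x) - x ∈ LinearMap.ker (p.restrictScalars R) := by simp [h1]
      exact sub_eq_zero.mp (h2 this)
  have h6 := length_top_ne_top (R := R) L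
  have h7 := length_top_ne_top (R := R) M
  rw [topLength, topLength]
  generalize Module.length R (L ⧸ (maximalIdeal R • ⊤ : Submodule R L)) = a at *
  generalize Module.length R (M ⧸ (maximalIdeal R • ⊤ : Submodule R M)) = c at *
  lift a to ℕ using h6
  lift c to ℕ using h7
  exact_mod_cast hlt

theorem exists_decomposition (L : LMod R Λ) [Module.Finite R L] :
    ∃ (κ : Type) (_ : Fintype κ) (Q : κ → LMod R Λ) (i : ∀ j, Q j →ₗ[Λ] L)
      (p : ∀ j, L →ₗ[Λ] Q j), (∀ j, IsIndecomposable Λ (Q j)) ∧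
      (∀ j, p j ∘ₗ i j = LinearMap.id) ∧ ∑ j, i j ∘ₗ p j = LinearMap.id := by
  induction hn : topLength R L using Nat.strong_induction_on generalizing L with
  | _ n ih =>
  subst hn
  by_cases hL : IsIndecomposable Λ L
  · exact ⟨Unit, inferInstance, fun _ => L, fun _ => LinearMap.id, fun _ => LinearMap.id,
      fun _ => hL, fun _ => rfl, by simp⟩
  rcases subsingleton_or_nontrivial L with hs | hs
  · exact ⟨PEmpty, inferInstance, fun j => j.elim, fun j => j.elim, fun j => j.elim,
      fun j => j.elim, fun j => j.elim, LinearMap.ext fun x => Subsingleton.elim _ _⟩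
  have : ∃ A B : Submodule Λ L, IsCompl A B ∧ A ≠ ⊥ ∧ B ≠ ⊥ := by
    by_contra hcon
    push Not at hcon
    exact hL ⟨hs, fun A B hAB => or_iff_not_imp_left.mpr (hcon A B hAB)⟩
  obtain ⟨A, B, hAB, hA, hB⟩ := this
  have key : ∀ A B : Submodule Λ L, IsCompl A B → B ≠ ⊥ → ∃ (κ : Type) (_ : Fintype κ)
      (Q : κ → LMod R Λ) (i : ∀ j, Q j →ₗ[Λ] A)
      (p : ∀ j, A →ₗ[Λ] Q j), (∀ j, IsIndecomposable Λ (Q j)) ∧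
      (∀ j, p j ∘ₗ i j = LinearMap.id) ∧ ∑ j, i j ∘ₗ p j = LinearMap.id := by
    intro A B hAB hB
    have hpi : A.projectionOnto B hAB ∘ₗ A.subtype = LinearMap.id :=
      Submodule.projectionOnto_comp_subtype hAB
    have hf : Module.Finite R A := Module.Finite.of_surjective
      ((A.projectionOnto B hAB).restrictScalars R) (Submodule.projectionOnto_surjective hAB)
    refine ih (topLength R A) (topLength_lt hpi ?_) (⟨A⟩ : LMod R Λ) rfl
    intro hsur
    apply hB
    have hA : A = ⊤ := by
      rw [← LinearMap.range_eq_top, Submodule.range_subtype] at hsur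
      exact hsur
    have := hAB.inf_eq_bot
    rwa [hA, top_inf_eq] at this
  obtain ⟨κ, _, Q, i, p, h1, h2, h3⟩ := key A B hAB hB
  obtain ⟨κ', _, Q', i', p', h1', h2', h3'⟩ := key B A hAB.symm hA
  refine ⟨κ ⊕ κ', inferInstance, Sum.elim Q Q',
    fun j => match j with
      | .inl j => A.subtype ∘ₗ i j
      | .inr j => B.subtype ∘ₗ i' j,
    fun j => match j with
      | .inl j => p j ∘ₗ A.projectionOnto B hAB
      | .inr j => p' j ∘ₗ B.projectionOnto A hAB.symm, ?_, ?_, ?_⟩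
  · rintro (j | j)
    · exact h1 j
    · exact h1' j
  · rintro (j | j)
    · ext z
      change p j (A.projectionOnto B hAB (A.subtype (i j z))) = z
      rw [Submodule.subtype_apply, Submodule.projectionOnto_apply_left]
      exact LinearMap.congr_fun (h2 j) z
    · ext z
      change p' j (B.projectionOnto A hAB.symm (B.subtype (i' j z))) = z
      rw [Submodule.subtype_apply, Submodule.projectionOnto_apply_left]
      exact LinearMap.congr_fun (h2' j) z
  · ext z
    rw [Fintype.sum_sum_type]
    have e1 := congrArg A.subtype (LinearMap.congr_fun h3 (A.projectionOnto B hAB z))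
    have e2 := congrArg B.subtype (LinearMap.congr_fun h3' (B.projectionOnto A hAB.symm z))
    rw [LinearMap.sum_apply, map_sum] at e1 e2
    rw [LinearMap.add_apply, LinearMap.sum_apply, LinearMap.sum_apply]
    exact (congrArg₂ (· + ·) e1 e2).trans
      (Submodule.projection_add_projection_eq_self hAB z)

end

end Indecomposables

section LocalEndomorphismRings

variable {R : Type u} [CommRing R] [IsNoetherianRing R] [IsLocalRing R]
  [IsAdicComplete (maximalIdeal R) R] {Λ : Type u} [Ring Λ] [Algebra R Λ] [Module.Finite R Λ]
  {L M T : Type u} [AddCommGroup L] [Module Λ L] [Module R L] [IsScalarTower R Λ L]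
  [AddCommGroup M] [Module Λ M] [Module R M] [IsScalarTower R Λ M]
  [AddCommGroup T] [Module Λ T]

theorem bijective_of_mul_eq_one {a b : Module.End Λ L} (h : a * b = 1) (h' : b * a = 1) :
    Function.Bijective b :=
  Function.bijective_iff_has_inverse.mpr
    ⟨a, fun z => LinearMap.congr_fun h z, fun z => LinearMap.congr_fun h' z⟩

theorem IsIndecomposable.bijective_or_pow_mem [Module.Finite R L] (h : IsIndecomposable Λ L)
    (φ : Module.End Λ L) :
    Function.Bijective φ ∨ ∃ n, ∀ z, (φ ^ n) z ∈ (maximalIdeal R • ⊤ : Submodule R L) := by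
  obtain ⟨e, ψ, n, he, -, h1, h2, h3⟩ := exists_idempotent_end (R := R) φ
  rcases h.eq_zero_or_one he with rfl | rfl
  · right
    refine ⟨n, fun z => ?_⟩
    have := h3 z
    rwa [sub_zero, mul_one] at this
  · exact .inl (bijective_of_mul_eq_one h1 h2)

variable (R) in
theorem IsIndecomposable.bijective_or_of_add [Module.Finite R L] (h : IsIndecomposable Λ L)
    {φ ψ : Module.End Λ L} (hb : Function.Bijective (φ + ψ)) :
    Function.Bijective φ ∨ Function.Bijective ψ := by
  let χ : Module.End Λ L := (LinearEquiv.ofBijective (φ + ψ) hb).symm.toLinearMap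
  have hχb : Function.Bijective χ := (LinearEquiv.ofBijective (φ + ψ) hb).symm.bijective
  have hχ : χ * φ + χ * ψ = 1 := by
    rw [← mul_add]
    ext z
    exact (LinearEquiv.ofBijective (φ + ψ) hb).symm_apply_apply z
  have hcancel : ∀ θ : Module.End Λ L, Function.Bijective (χ * θ) → Function.Bijective θ :=
    fun θ hθ => (Function.Bijective.of_comp_iff' hχb θ).mp hθ
  rcases h.bijective_or_pow_mem (R := R) (χ * φ) with h1 | ⟨n, hn⟩
  · exact .inl (hcancel _ h1)
  · refine .inr (hcancel _ ?_)
    have : IsNoetherian Λ L := isNoetherian_of_tower R inferInstance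
    refine IsNoetherian.bijective_of_surjective_endomorphism _ ?_
    have h2 : (⊤ : Submodule R L) ≤ LinearMap.range ((χ * ψ).restrictScalars R) := by
      refine Submodule.le_of_le_smul_of_le_jacobson_bot (I := maximalIdeal R)
        (IsNoetherian.noetherian _) (maximalIdeal_le_jacobson _) fun z _ => ?_
      have h3 : χ * ψ * ∑ i ∈ Finset.range n, (χ * φ) ^ i = 1 - (χ * φ) ^ n := by
        rw [eq_sub_of_add_eq' hχ, mul_neg_geom_sum]
      have h4 : z = (χ * ψ) ((∑ i ∈ Finset.range n, (χ * φ) ^ i : Module.End Λ L) z) +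
          ((χ * φ) ^ n) z := by
        have := LinearMap.congr_fun h3 z
        rw [Module.End.mul_apply (χ * ψ), LinearMap.sub_apply, Module.End.one_apply] at this
        rw [this, sub_add_cancel]
      rw [h4]
      exact Submodule.add_mem_sup ⟨_, rfl⟩ (hn z)
    intro z
    exact h2 (x := z) trivial

variable (R) in
theorem IsIndecomposable.exists_bijective_of_sum [Module.Finite R L] (h : IsIndecomposable Λ L)
    {κ : Type*} (s : Finset κ) (φ : κ → Module.End Λ L)
    (hb : Function.Bijective (∑ j ∈ s, φ j : Module.End Λ L)) :
    ∃ j ∈ s, Function.Bijective (φ j) := by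
  classical
  induction s using Finset.induction_on with
  | empty =>
    obtain ⟨z, hz⟩ := @exists_ne L h.1 0
    exact absurd (hb.1 (a₁ := z) (a₂ := 0) (by simp)) hz
  | insert a s ha ih =>
    rw [Finset.sum_insert ha] at hb
    rcases h.bijective_or_of_add R hb with h1 | h1
    · exact ⟨a, Finset.mem_insert_self _ _, h1⟩
    · obtain ⟨j, hj, h2⟩ := ih h1
      exact ⟨j, Finset.mem_insert_of_mem hj, h2⟩

variable (R) in
theorem IsIndecomposable.exists_equiv_of_sum_eq_id [Module.Finite R L]
    (hL : IsIndecomposable Λ L) {κ : Type*} [Fintype κ] {Q : κ → LMod R Λ}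
    {i : ∀ j, Q j →ₗ[Λ] T} {p : ∀ j, T →ₗ[Λ] Q j} (hQ : ∀ j, IsIndecomposable Λ (Q j))
    (hip : ∑ j, i j ∘ₗ p j = LinearMap.id) {a : L →ₗ[Λ] T} {b : T →ₗ[Λ] L}
    (hba : b ∘ₗ a = LinearMap.id) : ∃ j, Nonempty (L ≃ₗ[Λ] Q j) := by
  have h1 : ∑ j, (b ∘ₗ i j ∘ₗ p j ∘ₗ a : Module.End Λ L) = 1 := by
    ext z
    have h2 := congrArg b (LinearMap.congr_fun hip (a z))
    have h3 : b (a z) = z := LinearMap.congr_fun hba z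
    rw [LinearMap.sum_apply, map_sum, LinearMap.id_apply, h3] at h2
    rw [LinearMap.sum_apply]
    exact h2
  obtain ⟨j, -, hj⟩ := hL.exists_bijective_of_sum R Finset.univ _
    (by rw [h1]; exact Function.bijective_id)
  have := hL.1
  let ε := LinearEquiv.ofBijective _ hj
  refine ⟨j, ⟨LinearEquiv.ofBijective (p j ∘ₗ a) (bijective_of_retract (hQ j)
    (p := ε.symm.toLinearMap ∘ₗ b ∘ₗ i j) ?_)⟩⟩
  ext z
  exact ε.symm_apply_apply z

theorem exists_proper_retract [Module.Finite R L] [Module.Finite R M] {r : L →ₗ[Λ] M}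
    {φ : Module.End Λ L} (hφ : r ∘ₗ φ = r) (hn : ¬ Function.Bijective φ) :
    ∃ (A : LMod R Λ) (i : A →ₗ[Λ] L) (p : L →ₗ[Λ] A), p ∘ₗ i = LinearMap.id ∧
      ¬ Function.Surjective i ∧ (r ∘ₗ i) ∘ₗ p = r := by
  obtain ⟨e, ψ, n, he, hc, h1, h2, h3⟩ := exists_idempotent_end (R := R) φ
  have hee : ∀ z, e (e z) = e z := fun z => LinearMap.congr_fun he z
  refine ⟨⟨LinearMap.range e⟩, (LinearMap.range e).subtype, e.rangeRestrict, ?_, ?_, ?_⟩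
  · ext ⟨_, z, rfl⟩
    exact hee z
  · intro hs
    rw [← LinearMap.range_eq_top, Submodule.range_subtype] at hs
    apply hn
    have he1 : e = 1 := by
      ext z
      obtain ⟨y, rfl⟩ : z ∈ LinearMap.range e := by rw [hs]; trivial
      exact hee y
    rw [he1] at h1 h2
    exact bijective_of_mul_eq_one h1 h2
  · ext z
    have hpow : ∀ k, r ∘ₗ (φ ^ k : Module.End Λ L) = r := by
      intro k
      induction k with
      | zero => rfl
      | succ k ih =>
        rw [pow_succ]
        ext z
        have h4 := LinearMap.congr_fun ih (φ z)
        have h5 := LinearMap.congr_fun hφ z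
        exact h4.trans h5
    have hc' : Commute (φ ^ n) (1 - e) := (Commute.one_right _).sub_right (hc.pow_left n)
    have hidem : ∀ k, (1 - e) ^ (k + 1) = 1 - e :=
      fun k => (show IsIdempotentElem e from he).one_sub.pow_succ_eq k
    have hmem : ∀ k z, ((φ ^ n * (1 - e)) ^ k) z ∈
        (maximalIdeal R ^ k • ⊤ : Submodule R L) := by
      intro k
      induction k with
      | zero => intro z; simp
      | succ k ih =>
        intro z
        have h8 : ((φ ^ n * (1 - e)) ^ (k + 1)) z =
            (φ ^ n * (1 - e)) (((φ ^ n * (1 - e)) ^ k) z) := by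
          rw [pow_succ' (φ ^ n * (1 - e)), Module.End.mul_apply]
        rw [h8]
        have h6 : (maximalIdeal R ^ k • ⊤ : Submodule R L) ≤ Submodule.comap
            ((φ ^ n * (1 - e)).restrictScalars R) (maximalIdeal R ^ (k + 1) • ⊤) := by
          rw [← Submodule.map_le_iff_le_comap, Submodule.map_smul'', pow_succ, mul_smul]
          refine Submodule.smul_mono le_rfl ?_
          rintro _ ⟨y, -, rfl⟩
          exact h3 y
        exact h6 (ih z)
    have hzero : r ((1 - e) z) = 0 := by
      have : r ((1 - e) z) ∈ (⨅ k : ℕ, maximalIdeal R ^ k • ⊤ : Submodule R M) := by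
        rw [Submodule.mem_iInf]
        intro k
        have h7 : r ((1 - e) z) = r (((φ ^ n * (1 - e)) ^ (k + 1)) z) := by
          rw [hc'.mul_pow, hidem, Module.End.mul_apply, ← pow_mul]
          exact (LinearMap.congr_fun (hpow _) _).symm
        rw [h7]
        refine Submodule.smul_mono_left (Ideal.pow_le_pow_right (Nat.le_succ k)) ?_
        exact map_mem_smul_top _ r (hmem (k + 1) z)
      rwa [Ideal.iInf_pow_smul_eq_bot_of_isLocalRing _ (Ideal.IsPrime.ne_top inferInstance),
        Submodule.mem_bot] at this
    rw [LinearMap.sub_apply, Module.End.one_apply, map_sub, sub_eq_zero] at hzero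
    exact hzero.symm

variable (R) in
theorem eq_top_or_eq_top_of_sup_eq_top [Module.Finite R L] [Module.Projective Λ L]
    (h : IsIndecomposable Λ L) {A B : Submodule Λ L} (hAB : A ⊔ B = ⊤) : A = ⊤ ∨ B = ⊤ := by
  have hs : Function.Surjective (A.subtype.coprod B.subtype) := by
    rw [← LinearMap.range_eq_top, LinearMap.range_coprod, Submodule.range_subtype,
      Submodule.range_subtype, hAB]
  obtain ⟨f, hf⟩ := Module.projective_lifting_property _ LinearMap.id hs
  have h1 : (A.subtype ∘ₗ LinearMap.fst Λ A B ∘ₗ f : Module.End Λ L) +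
      B.subtype ∘ₗ LinearMap.snd Λ A B ∘ₗ f = 1 := by
    ext z
    exact LinearMap.congr_fun hf z
  rcases h.bijective_or_of_add R (by rw [h1]; exact Function.bijective_id) with h2 | h2
  · left
    rw [eq_top_iff]
    intro z _
    obtain ⟨y, rfl⟩ := h2.2 z
    exact (Subtype.prop _)
  · right
    rw [eq_top_iff]
    intro z _
    obtain ⟨y, rfl⟩ := h2.2 z
    exact (Subtype.prop _)

end LocalEndomorphismRings

section BoundedClass
open RingTheory.Sequence

theorem pow_smul_eq_zero_of_length_le {R : Type u} [CommRing R] [IsLocalRing R] {n : ℕ}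
    {W : Type u} [AddCommGroup W] [Module R W] (h : Module.length R W ≤ n) :
    ∀ r ∈ maximalIdeal R ^ n, ∀ w : W, r • w = 0 := by
  induction n generalizing W with
  | zero =>
    intro r _ w
    have : Subsingleton W := Module.length_eq_zero_iff.mp (by simpa using h)
    exact Subsingleton.elim _ _
  | succ n ih =>
    have hne : Module.length R W ≠ ⊤ := ne_top_of_le_ne_top (ENat.natCast_ne_top _) h
    obtain ⟨_, _⟩ := isFiniteLength_iff_isNoetherian_isArtinian.mp (Module.length_ne_top_iff.mp hne)
    by_cases ht : (maximalIdeal R • ⊤ : Submodule R W) = ⊤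
    · have h1 : (⊤ : Submodule R W) ≤ ⊥ :=
        Submodule.le_of_le_smul_of_le_jacobson_bot (I := maximalIdeal R) (IsNoetherian.noetherian _)
          (maximalIdeal_le_jacobson _) (by rw [ht]; exact le_sup_right)
      intro r _ w
      have h2 : w ∈ (⊥ : Submodule R W) := h1 trivial
      rw [(Submodule.mem_bot R).mp h2, smul_zero]
    · have h1 := Submodule.length_lt ht
      have h2 : Module.length R (maximalIdeal R • ⊤ : Submodule R W) ≤ n := by
        have h3 := h1.trans_le h
        generalize Module.length R (maximalIdeal R • ⊤ : Submodule R W) = a at h3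
        cases a with
        | top => simp at h3
        | coe a => norm_cast at h3 ⊢; lia
      intro r hr w
      rw [pow_succ] at hr
      refine Submodule.mul_induction_on hr (fun s hs t ht => ?_) fun s t hs ht => ?_
      · have := ih h2 s hs ⟨t • w, Submodule.smul_mem_smul ht Submodule.mem_top⟩
        rw [mul_smul]
        exact congrArg Subtype.val this
      · rw [add_smul, hs, ht, add_zero]

/-- Lattices with at most `n` generators whose stable endomorphism ring is killed by `𝔪 ^ n`. -/
structure IsBdd (R : Type u) [CommRing R] [IsLocalRing R] (Λ : Type u) [Ring Λ] [Algebra R Λ]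
    (ω : Type u) [AddCommGroup ω] [Module R ω] (xs : List R) (n : ℕ)
    (M : Type u) [AddCommGroup M] [Module Λ M] [Module R M] [IsScalarTower R Λ M] : Prop where
  isLat0 : IsLat0 R Λ ω xs M
  ann : maximalIdeal R ^ n ≤ stableAnn R Λ M
  gen : ∃ p : (Fin n → Λ) →ₗ[Λ] M, Function.Surjective p

variable {R : Type u} [CommRing R] [IsLocalRing R]
  {Λ : Type u} [Ring Λ] [Algebra R Λ]
  {ω : Type u} [AddCommGroup ω] [Module R ω] {xs : List R}
  {M A C : Type u} [AddCommGroup M] [Module Λ M] [Module R M] [IsScalarTower R Λ M]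
  [AddCommGroup A] [Module Λ A] [Module R A] [IsScalarTower R Λ A]
  [AddCommGroup C] [Module Λ C] [Module R C] [IsScalarTower R Λ C] {n m : ℕ}

theorem exists_surjective_of_le (h : n ≤ m) {p : (Fin n → Λ) →ₗ[Λ] M}
    (hp : Function.Surjective p) : ∃ q : (Fin m → Λ) →ₗ[Λ] M, Function.Surjective q :=
  ⟨p ∘ₗ LinearMap.funLeft Λ Λ (Fin.castLE h), hp.comp
    (LinearMap.funLeft_surjective_of_injective Λ Λ _ (Fin.castLE_injective h))⟩

theorem IsBdd.mono (h : IsBdd R Λ ω xs n M) (hnm : n ≤ m) : IsBdd R Λ ω xs m M :=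
  ⟨h.isLat0, (Ideal.pow_le_pow_right hnm).trans h.ann,
    let ⟨_, hp⟩ := h.gen; exists_surjective_of_le hnm hp⟩

theorem IsLat0.exists_isBdd (h : IsLat0 R Λ ω xs M) : ∃ n, IsBdd R Λ ω xs n M := by
  obtain ⟨n, hn⟩ := h.ann
  have := h.finite
  obtain ⟨m, p, hp⟩ := Module.Finite.exists_fin' Λ M
  exact ⟨max n m, h, (Ideal.pow_le_pow_right (le_max_left n m)).trans hn,
    exists_surjective_of_le (le_max_right n m) hp⟩

theorem IsBdd.of_retract {i : A →ₗ[Λ] M} {p : M →ₗ[Λ] A} (h : p ∘ₗ i = LinearMap.id)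
    (hM : IsBdd R Λ ω xs n M) : IsBdd R Λ ω xs n A :=
  ⟨hM.isLat0.of_retract h, hM.ann.trans (stableAnn_of_retract h),
    let ⟨q, hq⟩ := hM.gen
    ⟨p ∘ₗ q, Function.Surjective.comp (g := p) (fun x => ⟨i x, LinearMap.congr_fun h x⟩) hq⟩⟩

theorem exists_surjective_of_exact {i : A →ₗ[Λ] M} {g : M →ₗ[Λ] C} (hig : Function.Exact i g)
    {p : (Fin n → Λ) →ₗ[Λ] A} (hp : Function.Surjective p) {q : (Fin m → Λ) →ₗ[Λ] C}
    (hq : Function.Surjective q) (hg : Function.Surjective g) :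
    ∃ s : (Fin (n + m) → Λ) →ₗ[Λ] M, Function.Surjective s := by
  obtain ⟨q', hq'⟩ := Module.projective_lifting_property g q hg
  let e : (Fin (n + m) → Λ) ≃ₗ[Λ] (Fin n → Λ) × (Fin m → Λ) :=
    LinearEquiv.funCongrLeft Λ Λ finSumFinEquiv ≪≫ₗ LinearEquiv.sumArrowLequivProdArrow _ _ Λ Λ
  refine ⟨((i ∘ₗ p).coprod q') ∘ₗ e.toLinearMap, Function.Surjective.comp (g := (i ∘ₗ p).coprod q') ?_ e.surjective⟩
  intro x
  obtain ⟨b, hb⟩ := hq (g x)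
  obtain ⟨a, ha⟩ := (hig (x - q' b)).mp (by
    have := LinearMap.congr_fun hq' b
    rw [LinearMap.comp_apply] at this
    rw [map_sub, this, hb, sub_self])
  obtain ⟨a, rfl⟩ := hp a
  exact ⟨(a, b), by simp [ha]⟩

theorem IsBdd.of_exact {i : A →ₗ[Λ] M} {g : M →ₗ[Λ] C} (hi : Function.Injective i)
    (hig : Function.Exact i g) (hg : Function.Surjective g) (hA : IsBdd R Λ ω xs n A)
    (hC : IsBdd R Λ ω xs m C) : IsBdd R Λ ω xs (n + m) M :=
  ⟨.of_exact_mid hi hig hg hA.isLat0 hC.isLat0, pow_le_stableAnn_mid hi hig hg hA.ann hC.ann,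
    let ⟨_, hp⟩ := hA.gen
    let ⟨_, hq⟩ := hC.gen
    exists_surjective_of_exact hig hp hq hg⟩

theorem IsBdd.prod (hA : IsBdd R Λ ω xs n A) (hC : IsBdd R Λ ω xs m C) :
    IsBdd R Λ ω xs (n + m) (A × C) :=
  .of_exact LinearMap.inl_injective (Function.Exact.inl_snd (R := Λ)) LinearMap.snd_surjective hA hC

variable [IsNoetherianRing R] [Module.Finite R Λ]

theorem length_quotient_redSub_ne_top {I : Ideal R} {j : ℕ} (hj : maximalIdeal R ^ j ≤ I)
    [Module.Finite R M] : Module.length R (M ⧸ redSub Λ I M) ≠ ⊤ := by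
  have h0 : Module.Finite R (M ⧸ redSub Λ I M) :=
    Module.Finite.of_surjective ((redSub Λ I M).mkQ.restrictScalars R)
      (redSub Λ I M).mkQ_surjective
  refine length_ne_top_of_pow_smul_eq_zero (k := j) fun r hr z => ?_
  obtain ⟨w, rfl⟩ := (redSub Λ I M).mkQ_surjective z
  have h1 : (redSub Λ I M).mkQ (r • w) = 0 := by
    rw [Submodule.mkQ_apply, Submodule.Quotient.mk_eq_zero]
    exact smul_mem_redSub (hj hr) w
  exact h1

/-- The length of `M / (x₁ᵏ, …) M` is bounded on the class of `n`-bounded lattices. -/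
theorem exists_length_quotient_le (h : IsParam R xs) (n k : ℕ) :
    ∃ c : ℕ, ∀ M : LMod R Λ, IsBdd R Λ ω xs n M →
      Module.length R (M ⧸ redSub Λ (Ideal.ofList (xs.map (· ^ k))) M) ≤ c := by
  obtain ⟨j, hj⟩ := h.exists_pow_le k
  have h1 := length_quotient_redSub_ne_top (Λ := Λ) (M := Λ) hj
  refine ⟨n * (Module.length R (Λ ⧸ redSub Λ (Ideal.ofList (xs.map (· ^ k))) Λ)).toNat, ?_⟩
  intro M hM
  obtain ⟨p, hp⟩ := hM.gen
  refine (length_quotient_redSub_le hp _).trans ?_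
  rw [Nat.cast_mul, ENat.natCast_toNat h1]

theorem IsBdd.mem_stableAnn (h : IsParam R xs) (hM : IsBdd R Λ ω xs n M) :
    ∀ y ∈ xs, y ^ n ∈ stableAnn R Λ M :=
  fun _ hy => hM.ann (Ideal.pow_mem_pow (h.mem _ hy) n)

theorem exists_hLength_le (h : IsParam R xs) {G : Type u} [AddCommGroup G] [Module Λ G]
    [Module R G] [IsScalarTower R Λ G] (hG : IsLat0 R Λ ω xs G) (n : ℕ) :
    ∃ c : ℕ, ∀ M : LMod R Λ, IsBdd R Λ ω xs n M → Module.length R (stableHom R Λ M (M × G)) ≤ c := by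
  obtain ⟨g, hg⟩ := hG.exists_isBdd
  obtain ⟨c, hc⟩ := exists_length_quotient_le (Λ := Λ) (ω := ω) h (n + g) n
  refine ⟨n * c, fun M hM => ?_⟩
  obtain ⟨p, hp⟩ := hM.gen
  refine (length_stableHom_le (ys := xs.map (· ^ n)) ?_ ?_).trans ((length_hom_le hp).trans ?_)
  · intro z hz
    obtain ⟨y, hy, rfl⟩ := List.mem_map.mp hz
    exact hM.mem_stableAnn h y hy
  · exact IsWeaklyRegular.map_pow n (hM.prod hg).isLat0.regular
  · rw [Nat.cast_mul]
    exact mul_le_mul_right (hc ⟨M × G⟩ (hM.prod hg)) _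

end BoundedClass

section Approximation
open RingTheory.Sequence

/-- The consequences of the existence of a lat-approximation `α : G → ⨁ i, Sfam i` of the sum of
all simple modules which are used below. -/
structure ApproxData (R : Type u) [CommRing R] [IsLocalRing R] (Λ : Type u) [Ring Λ] [Algebra R Λ]
    (ω : Type u) [AddCommGroup ω] [Module R ω] (xs : List R) {ι : Type u} (Sfam : ι → Type u)
    [∀ i, AddCommGroup (Sfam i)] [∀ i, Module Λ (Sfam i)]
    {G : Type u} [AddCommGroup G] [Module Λ G] [Module R G] [IsScalarTower R Λ G]
    (α : G →ₗ[Λ] ∀ i, Sfam i) : Prop where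
  isParam : IsParam R xs
  isLat0_ring : IsLat0 R Λ ω xs Λ
  isLat0 : IsLat0 R Λ ω xs G
  isSimpleModule : ∀ i, IsSimpleModule Λ (Sfam i)
  exists_equiv : ∀ (T : Type u) [AddCommGroup T] [Module Λ T], IsSimpleModule Λ T →
    ∃ i, Nonempty (T ≃ₗ[Λ] Sfam i)
  surjective : Function.Surjective α
  syzygyExtends : SyzygyExtends R Λ ω xs (LinearMap.ker α)
  exists_precover : ∃ (I : LMod R Λ) (π : I →ₗ[Λ] LinearMap.ker α), IsLat0 R Λ ω xs I ∧
    Function.Surjective π ∧ ∀ (Z : LMod R Λ), IsLat0 R Λ ω xs Z →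
      ∀ f : Z →ₗ[Λ] LinearMap.ker α, ∃ k : Z →ₗ[Λ] I, π ∘ₗ k = f

variable {R : Type u} [CommRing R] [IsLocalRing R] {Λ : Type u} [Ring Λ] [Algebra R Λ]
  {ω : Type u} [AddCommGroup ω] [Module R ω] {xs : List R} {ι : Type u} {Sfam : ι → Type u}
  [∀ i, AddCommGroup (Sfam i)] [∀ i, Module Λ (Sfam i)]
  {G : Type u} [AddCommGroup G] [Module Λ G] [Module R G] [IsScalarTower R Λ G]
  {α : G →ₗ[Λ] ∀ i, Sfam i}

variable [IsNoetherianRing R] [Module.Finite R Λ]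

theorem ApproxData.exists_lift (h : ApproxData R Λ ω xs Sfam α) (Z : Type u) [AddCommGroup Z]
    [Module Λ Z] [Module R Z] [IsScalarTower R Λ Z] (hZ : IsLat0 R Λ ω xs Z)
    (f : Z →ₗ[Λ] ∀ i, Sfam i) : ∃ k : Z →ₗ[Λ] G, α ∘ₗ k = f :=
  h.syzygyExtends.exists_lift hZ (Submodule.subtype_injective _)
    (LinearMap.exact_subtype_ker_map α) h.surjective f

theorem IsSimplesApprox.approxData [Fintype ι] (h : IsParam R xs) (hord : IsLattice R Λ ω Λ)
    (happrox : IsSimplesApprox R Λ ω ι Sfam G α) : ApproxData R Λ ω xs Sfam α := by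
  obtain ⟨h1, -, h3, h4, h5, ⟨t, h6⟩, -⟩ := happrox
  have hΛ := ((isLattice_iff h).mp hord).1
  exact ⟨h, hΛ, ((isLattice_iff h).mp h4).1, h1, fun T _ _ hT => h3 T _ _ hT, h5,
    h6.syzygyExtends h hΛ, h6.exists_precover h hΛ⟩

variable {M : Type u} [AddCommGroup M] [Module Λ M] [Module R M] [IsScalarTower R Λ M]

variable (R α) in
/-- The homomorphisms `f : M → G` such that `α ∘ f` vanishes on `D`. -/
def vanishingHoms (D : Submodule Λ M) : Submodule R (M →ₗ[Λ] G) where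
  carrier := {f | ∀ d ∈ D, α (f d) = 0}
  add_mem' hf hg d hd := by rw [LinearMap.add_apply, map_add, hf d hd, hg d hd, add_zero]
  zero_mem' d _ := by simp
  smul_mem' r f hf d hd := by
    rw [LinearMap.smul_apply, ← algebraMap_smul Λ r, map_smul, hf d hd, smul_zero]

theorem ApproxData.exists_not_mem_vanishingHoms (h : ApproxData R Λ ω xs Sfam α)
    (hM : IsLat0 R Λ ω xs M) {D : Submodule Λ M} (hD : D ≠ ⊤) :
    ∃ f ∈ vanishingHoms R α D, ∃ m, α (f m) ≠ 0 := by
  classical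
  have := hM.finite
  obtain ⟨P, hP, hDP⟩ := (eq_top_or_exists_le_coatom D).resolve_left hD
  have hs : IsSimpleModule Λ (M ⧸ P) := isSimpleModule_iff_isCoatom.mpr hP
  obtain ⟨i, ⟨e⟩⟩ := h.exists_equiv (M ⧸ P) hs
  obtain ⟨f, hf⟩ := h.exists_lift M hM (LinearMap.single Λ Sfam i ∘ₗ e.toLinearMap ∘ₗ P.mkQ)
  have hf' : ∀ m, α (f m) = Pi.single i (e (P.mkQ m)) := fun m => LinearMap.congr_fun hf m
  refine ⟨f, fun d hd => ?_, ?_⟩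
  · have h1 : P.mkQ d = 0 := (Submodule.Quotient.mk_eq_zero P).mpr (hDP hd)
    rw [hf', h1, map_zero, Pi.single_zero]
  · have := hs.nontrivial
    obtain ⟨z, hz⟩ := exists_ne (0 : M ⧸ P)
    obtain ⟨m, rfl⟩ := P.mkQ_surjective z
    refine ⟨m, fun h0 => hz ?_⟩
    rw [hf', Pi.single_eq_zero_iff] at h0
    exact e.map_eq_zero_iff.mp h0

theorem ApproxData.exists_sup_span_eq_top (h : ApproxData R Λ ω xs Sfam α)
    (hM : IsLat0 R Λ ω xs M)
    (h0 : ∀ f : M →ₗ[Λ] G, FactorsThroughProjective Λ f → α ∘ₗ f = 0)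
    (hfin : Module.length R (stableHom R Λ M G) ≠ ⊤) (n : ℕ) (D : Submodule Λ M)
    (hn : Module.length R ((vanishingHoms R α D).map (projTrivial R Λ M G).mkQ) ≤ n) :
    ∃ m : Fin n → M, D ⊔ Submodule.span Λ (Set.range m) = ⊤ := by
  have hker : ∀ D', projTrivial R Λ M G ≤ vanishingHoms R α D' :=
    fun D' f hf d _ => LinearMap.congr_fun (h0 f hf) d
  obtain ⟨_, _⟩ := isFiniteLength_iff_isNoetherian_isArtinian.mp (Module.length_ne_top_iff.mp hfin)
  have : IsNoetherian R ((M →ₗ[Λ] G) ⧸ projTrivial R Λ M G) :=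
    inferInstanceAs (IsNoetherian R (stableHom R Λ M G))
  have : IsArtinian R ((M →ₗ[Λ] G) ⧸ projTrivial R Λ M G) :=
    inferInstanceAs (IsArtinian R (stableHom R Λ M G))
  induction n generalizing D with
  | zero =>
    refine ⟨Fin.elim0, ?_⟩
    by_contra hD
    obtain ⟨f, hf, m, hm⟩ := h.exists_not_mem_vanishingHoms hM (D := D) fun h1 => hD (by rw [h1, top_sup_eq])
    have h1 : Subsingleton ((vanishingHoms R α D).map (projTrivial R Λ M G).mkQ) :=
      Module.length_eq_zero_iff.mp (by simpa using hn)
    have h2 : (projTrivial R Λ M G).mkQ f ∈ (⊥ : Submodule R _) :=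
      (Submodule.subsingleton_iff_eq_bot.mp h1) ▸ Submodule.mem_map_of_mem hf
    rw [Submodule.mem_bot, Submodule.mkQ_apply, Submodule.Quotient.mk_eq_zero] at h2
    exact hm (LinearMap.congr_fun (h0 f h2) m)
  | succ n ih =>
    by_cases hD : D = ⊤
    · exact ⟨0, by rw [hD, top_sup_eq]⟩
    obtain ⟨f, hf, m, hm⟩ := h.exists_not_mem_vanishingHoms hM hD
    have hle : vanishingHoms R α (D ⊔ Submodule.span Λ {m}) ≤ vanishingHoms R α D :=
      fun f hf d hd => hf d (Submodule.mem_sup_left hd)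
    have hlt : (vanishingHoms R α (D ⊔ Submodule.span Λ {m})).map (projTrivial R Λ M G).mkQ <
        (vanishingHoms R α D).map (projTrivial R Λ M G).mkQ := by
      refine lt_of_le_of_ne (Submodule.map_mono hle) fun heq => ?_
      obtain ⟨f', hf', heq'⟩ := heq.symm ▸ Submodule.mem_map_of_mem (f := (projTrivial R Λ M G).mkQ) hf
      have h1 : f' - f ∈ projTrivial R Λ M G := (Submodule.Quotient.eq _).mp heq'
      have h2 := LinearMap.congr_fun (h0 _ h1) m
      have h3 := hf' m (Submodule.mem_sup_right (Submodule.mem_span_singleton_self m))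
      rw [LinearMap.comp_apply, LinearMap.sub_apply, map_sub, h3, zero_sub, LinearMap.zero_apply,
        neg_eq_zero] at h2
      exact hm h2
    have hlen := Submodule.height_strictMono hlt
    rw [← Module.length_submodule, ← Module.length_submodule] at hlen
    obtain ⟨g, hg⟩ := ih (D ⊔ Submodule.span Λ {m}) (by
      have h3 := hlen.trans_le hn
      generalize Module.length R ((vanishingHoms R α (D ⊔ Submodule.span Λ {m})).map
        (projTrivial R Λ M G).mkQ) = a at h3
      cases a with
      | top => simp at h3
      | coe a => norm_cast at h3 ⊢; lia)
    refine ⟨Fin.cons m g, ?_⟩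
    rw [← hg, Fin.range_cons, Set.insert_eq, Submodule.span_union, sup_assoc]

variable [IsAdicComplete (maximalIdeal R) R]

/-- A map from a non-projective indecomposable to a simple module which factors through a
projective module vanishes. -/
theorem IsIndecomposable.comp_eq_zero (R : Type u) [CommRing R] [IsLocalRing R]
    [IsNoetherianRing R] [IsAdicComplete (maximalIdeal R) R] {Λ : Type u} [Ring Λ] [Algebra R Λ]
    [Module.Finite R Λ] {M : Type u} [AddCommGroup M] [Module Λ M] (hM : IsIndecomposable Λ M) (hp : ¬ Module.Projective Λ M)
    {T : Type u} [AddCommGroup T] [Module Λ T] [IsSimpleModule Λ T] {f : M →ₗ[Λ] T}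
    (hf : FactorsThroughProjective Λ f) : f = 0 := by
  by_contra hne
  have := IsSimpleModule.nontrivial Λ T
  obtain ⟨t, ht⟩ := exists_ne (0 : T)
  have ht' : Function.Surjective (LinearMap.toSpanSingleton Λ T t) :=
    IsSimpleModule.toSpanSingleton_surjective Λ ht
  obtain ⟨g, -, rfl⟩ := hf.lift ht'
  obtain ⟨κ, _, Q, i, p, hQ, hpi, hsum⟩ := exists_decomposition (R := R) (⟨Λ⟩ : LMod R Λ)
  apply hne
  have h1 : ∀ j, LinearMap.toSpanSingleton Λ T t ∘ₗ i j ∘ₗ p j ∘ₗ g = 0 := by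
    intro j
    by_contra hj
    have : Module.Finite R (Q j) := Module.Finite.of_surjective ((p j).restrictScalars R)
      fun x => ⟨i j x, LinearMap.congr_fun (hpi j) x⟩
    have : Module.Projective Λ (⟨Λ⟩ : LMod R Λ) := inferInstanceAs (Module.Projective Λ Λ)
    have hproj : Module.Projective Λ (Q j) := .of_split _ _ (hpi j)
    have hj' : (LinearMap.toSpanSingleton Λ T t ∘ₗ i j) ∘ₗ (p j ∘ₗ g) ≠ 0 := hj
    generalize p j ∘ₗ g = a at hj'
    generalize LinearMap.toSpanSingleton Λ T t ∘ₗ i j = b at hj'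
    have hs : LinearMap.range a ⊔ LinearMap.ker b = ⊤ := by
      have hsurj := LinearMap.surjective_of_ne_zero hj'
      rw [eq_top_iff]
      intro x _
      obtain ⟨m, hm⟩ := hsurj (b x)
      rw [← add_sub_cancel (a m) x]
      refine Submodule.add_mem_sup ⟨m, rfl⟩ ?_
      rw [LinearMap.mem_ker, map_sub, ← hm, LinearMap.comp_apply, sub_self]
    rcases eq_top_or_eq_top_of_sup_eq_top R (hQ j) hs with h2 | h2
    · obtain ⟨s, hs⟩ := Module.projective_lifting_property a LinearMap.id
        (LinearMap.range_eq_top.mp h2)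
      have := (hQ j).1
      have hb := bijective_of_retract hM hs
      exact hp (.of_equiv (LinearEquiv.ofBijective s hb))
    · exact hj' (by rw [LinearMap.ker_eq_top.mp h2, LinearMap.zero_comp])
  have h2 : LinearMap.toSpanSingleton Λ T t ∘ₗ g =
      ∑ j, LinearMap.toSpanSingleton Λ T t ∘ₗ i j ∘ₗ p j ∘ₗ g := by
    ext m
    have := congrArg (LinearMap.toSpanSingleton Λ T t) (LinearMap.congr_fun hsum (g m)).symm
    simpa [LinearMap.sum_apply, Finset.sum_smul] using this
  rw [h2]
  exact Finset.sum_eq_zero fun j _ => h1 j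

theorem ApproxData.isBdd_of_length_le (h : ApproxData R Λ ω xs Sfam α) (hM : IsLat0 R Λ ω xs M)
    (hi : IsIndecomposable Λ M) (hp : ¬ Module.Projective Λ M) {n : ℕ}
    (hn : Module.length R (stableHom R Λ M (M × G)) ≤ n) : IsBdd R Λ ω xs n M := by
  refine ⟨hM, fun r hr => ?_, ?_⟩
  · have h1 := pow_smul_eq_zero_of_length_le hn r hr
      ((projTrivial R Λ M (M × G)).mkQ (LinearMap.inl Λ M G))
    have h2 : r • LinearMap.inl Λ M G ∈ projTrivial R Λ M (M × G) :=
      (Submodule.Quotient.mk_eq_zero _).mp h1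
    have h3 := FactorsThroughProjective.comp_left (show FactorsThroughProjective Λ _ from h2)
      (LinearMap.fst Λ M G)
    exact h3
  · have h0 : ∀ f : M →ₗ[Λ] G, FactorsThroughProjective Λ f → α ∘ₗ f = 0 := by
      intro f hf
      ext m i
      have := h.isSimpleModule i
      exact LinearMap.congr_fun (hi.comp_eq_zero R hp ((hf.comp_left α).comp_left
        (LinearMap.proj i))) m
    let c : (M →ₗ[Λ] M × G) →ₗ[R] (M →ₗ[Λ] G) :=
      { toFun := fun f => LinearMap.snd Λ M G ∘ₗ f
        map_add' := fun _ _ => rfl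
        map_smul' := fun _ _ => rfl }
    have hle : Module.length R (stableHom R Λ M G) ≤ n := by
      refine le_trans (Module.length_le_of_surjective (R := R) (M := stableHom R Λ M (M × G))
        (Submodule.mapQ (projTrivial R Λ M (M × G)) (projTrivial R Λ M G) c
        fun f hf => FactorsThroughProjective.comp_left hf _) ?_) hn
      intro z
      obtain ⟨f, rfl⟩ := (projTrivial R Λ M G).mkQ_surjective z
      exact ⟨(projTrivial R Λ M (M × G)).mkQ (LinearMap.inr Λ M G ∘ₗ f), rfl⟩
    have hfin := ne_top_of_le_ne_top (ENat.natCast_ne_top n) hle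
    obtain ⟨m, hm⟩ := h.exists_sup_span_eq_top hM h0 hfin n ⊥ ((Module.length_le_of_injective
      (Submodule.subtype _) (Submodule.subtype_injective _)).trans hle)
    refine ⟨Fintype.linearCombination Λ m, ?_⟩
    rw [← LinearMap.range_eq_top, Fintype.range_linearCombination, ← hm, bot_sup_eq]

end Approximation

section Precovers

/-- Every homomorphism from a lattice to the target of `q` factors through `q`. -/
def IsLatPrecover (R : Type u) [CommRing R] [IsLocalRing R] (Λ : Type u) [Ring Λ] [Algebra R Λ]
    (ω : Type u) [AddCommGroup ω] [Module R ω] (xs : List R) {L V : Type u} [AddCommGroup L]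
    [Module Λ L] [AddCommGroup V] [Module Λ V] (q : L →ₗ[Λ] V) : Prop :=
  ∀ Z : LMod R Λ, IsLat0 R Λ ω xs Z → ∀ f : Z →ₗ[Λ] V, ∃ k : Z →ₗ[Λ] L, q ∘ₗ k = f

variable {R : Type u} [CommRing R] [IsLocalRing R] [IsNoetherianRing R]
  {Λ : Type u} [Ring Λ] [Algebra R Λ] [Module.Finite R Λ]
  {ω : Type u} [AddCommGroup ω] [Module R ω] {xs : List R} {ι : Type u} {Sfam : ι → Type u}
  [∀ i, AddCommGroup (Sfam i)] [∀ i, Module Λ (Sfam i)]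
  {G : Type u} [AddCommGroup G] [Module Λ G] [Module R G] [IsScalarTower R Λ G]
  {α : G →ₗ[Λ] ∀ i, Sfam i}
  {W L T : Type u} [AddCommGroup W] [Module Λ W]
  [AddCommGroup L] [Module Λ L] [Module R L] [IsScalarTower R Λ L]
  [AddCommGroup T] [Module Λ T]

theorem ApproxData.exists_precover_of_simple [IsSimpleModule Λ T]
    (h : ApproxData R Λ ω xs Sfam α) {c m : ℕ} (hG : IsBdd R Λ ω xs c G)
    (hL : IsBdd R Λ ω xs m L) {t : T →ₗ[Λ] W} {g : W →ₗ[Λ] L} (ht : Function.Injective t)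
    (htg : Function.Exact t g) (hg : Function.Surjective g) :
    ∃ (E : LMod R Λ) (q : E →ₗ[Λ] W), IsBdd R Λ ω xs (c + m) E ∧ IsLatPrecover R Λ ω xs q := by
  classical
  have : IsNoetherianRing Λ := IsNoetherianRing.of_finite R Λ
  obtain ⟨i, ⟨e⟩⟩ := h.exists_equiv T inferInstance
  obtain ⟨n, p, hp⟩ : ∃ (n : ℕ) (p : (Fin n → Λ) →ₗ[Λ] L), Function.Surjective p := ⟨m, hL.gen⟩
  obtain ⟨p', hp'⟩ := Module.projective_lifting_property g p hg
  replace hp' : ∀ x, g (p' x) = p x := fun x => LinearMap.congr_fun hp' x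
  obtain ⟨β₀, hβ₀⟩ := exists_comp_eq_of_injective ht (f := p' ∘ₗ (LinearMap.ker p).subtype)
    fun k => (htg _).mp (by
      rw [LinearMap.comp_apply, hp', Submodule.subtype_apply, LinearMap.mem_ker.mp k.2])
  replace hβ₀ : ∀ k : LinearMap.ker p, t (β₀ k) = p' k := fun k => LinearMap.congr_fun hβ₀ k
  have hK : IsLat0 R Λ ω xs (LinearMap.ker p) := (h.isLat0_ring.pi n).ker hp hL.isLat0
  obtain ⟨β, hβ⟩ := h.exists_lift _ hK (LinearMap.single Λ Sfam i ∘ₗ e.toLinearMap ∘ₗ β₀)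
  replace hβ : ∀ k, α (β k) = Pi.single i (e (β₀ k)) := fun k => LinearMap.congr_fun hβ k
  have hex : Function.Exact (LinearMap.ker p).subtype p := LinearMap.exact_subtype_ker_map p
  obtain ⟨E, j, l, q, hjl, hql, hj, hjq, hq⟩ :=
    exists_pushout (R := R) (Submodule.subtype_injective _) hex hp β
  replace hjl : ∀ k : LinearMap.ker p, j (β k) = l k := fun k => LinearMap.congr_fun hjl k
  replace hql : ∀ x, q (l x) = p x := fun x => LinearMap.congr_fun hql x
  have hcop : Function.Surjective (j.coprod l) := by
    intro z
    obtain ⟨x, hx⟩ := hp (q z)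
    obtain ⟨y, hy⟩ := (hjq (z - l x)).mp (by rw [map_sub, hql, hx, sub_self])
    exact ⟨(y, x), by simp [hy]⟩
  let S' : Submodule Λ (∀ i, Sfam i) := LinearMap.ker (LinearMap.proj i)
  let a : G →ₗ[Λ] W := t ∘ₗ e.symm.toLinearMap ∘ₗ LinearMap.proj i ∘ₗ α
  let b : G →ₗ[Λ] S' := LinearMap.codRestrict S'
    (α - LinearMap.single Λ Sfam i ∘ₗ LinearMap.proj i ∘ₗ α) fun x => by
      simp [S']
  have ha : ∀ x, a x = t (e.symm (α x i)) := fun _ => rfl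
  have hb : ∀ x, (b x : ∀ i, Sfam i) = α x - Pi.single i (α x i) := fun _ => rfl
  have haβ : ∀ k, a (β k) = p' k := by
    intro k
    rw [ha, hβ, Pi.single_eq_same, e.symm_apply_apply, hβ₀]
  have hbβ : ∀ k, b (β k) = 0 := by
    intro k
    apply Subtype.ext
    rw [hb, hβ, Pi.single_eq_same, sub_self]
    rfl
  obtain ⟨w, hw⟩ := exists_comp_eq_of_surjective hcop
    (f := (a.prod b).coprod (p'.prod 0)) (by
      rintro ⟨y, x⟩ hyx
      simp only [LinearMap.coprod_apply] at hyx
      have hx : p x = 0 := by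
        have := congrArg q hyx
        rwa [map_add, hjq.apply_apply_eq_zero, zero_add, hql, map_zero] at this
      have hy : y = -β ⟨x, hx⟩ := by
        apply hj
        rw [map_neg, hjl]
        exact eq_neg_of_add_eq_zero_left hyx
      simp [hy, haβ, hbβ])
  have hwj : ∀ y, w (j y) = (a y, b y) := fun y => by
    simpa using LinearMap.congr_fun hw (y, 0)
  have hwl : ∀ x, w (l x) = (p' x, 0) := fun x => by
    simpa using LinearMap.congr_fun hw (0, x)
  have hsurj : Function.Surjective w := by
    rintro ⟨z, s⟩
    obtain ⟨x, hx⟩ := hp (g z)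
    obtain ⟨τ, hτ⟩ := (htg (z - p' x)).mp (by rw [map_sub, hp', hx, sub_self])
    obtain ⟨y, hy⟩ := h.surjective (Pi.single i (e τ) + s)
    have hsi : (s : ∀ i, Sfam i) i = 0 := s.2
    refine ⟨j y + l x, ?_⟩
    rw [map_add, hwj, hwl]
    ext1
    · simp [ha, hy, hsi, hτ]
    · apply Subtype.ext
      simp [hb, hy, hsi]
  have hexact : Function.Exact (j ∘ₗ (LinearMap.ker α).subtype) w := by
    intro z
    constructor
    · intro hz
      obtain ⟨⟨y, x⟩, rfl⟩ := hcop z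
      rw [LinearMap.coprod_apply, map_add, hwj, hwl, Prod.mk_add_mk, Prod.mk_eq_zero,
        add_zero] at hz
      have hx : p x = 0 := by
        have := congrArg g hz.1
        rwa [map_add, ha, htg.apply_apply_eq_zero, zero_add, hp', map_zero] at this
      have h1 : α (y + β ⟨x, hx⟩) i = 0 := by
        have h2 : a (y + β ⟨x, hx⟩) = 0 := by rw [map_add, haβ]; exact hz.1
        rw [ha, map_eq_zero_iff t ht, LinearEquiv.map_eq_zero_iff] at h2
        exact h2
      have h3 : α (y + β ⟨x, hx⟩) = 0 := by
        have h2 : b (y + β ⟨x, hx⟩) = 0 := by rw [map_add, hbβ, add_zero]; exact hz.2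
        have h4 := congrArg Subtype.val h2
        rw [hb, h1, Pi.single_zero, sub_zero] at h4
        exact h4
      refine ⟨⟨_, h3⟩, ?_⟩
      simp [hjl]
    · rintro ⟨y, rfl⟩
      have hy : α y = 0 := y.2
      have h1 : b y = 0 := Subtype.ext (by rw [hb, hy]; simp)
      rw [LinearMap.comp_apply, Submodule.subtype_apply, hwj, ha, hy, h1]
      simp
  refine ⟨E, LinearMap.fst Λ W S' ∘ₗ w, hG.of_exact hj hjq hq hL, fun Z hZ f => ?_⟩
  obtain ⟨k, hk⟩ := h.syzygyExtends.exists_lift hZ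
    (hj.comp (Submodule.subtype_injective _)) hexact hsurj (f.prod 0)
  refine ⟨k, ?_⟩
  rw [LinearMap.comp_assoc, hk]
  rfl

theorem ApproxData.exists_precover_of_length_le (h : ApproxData R Λ ω xs Sfam α) {c m : ℕ}
    (hG : IsBdd R Λ ω xs c G) (hL : IsBdd R Λ ω xs m L) (ℓ : ℕ) (V : LMod R Λ)
    {g : V →ₗ[Λ] L} (hg : Function.Surjective g)
    (hℓ : Module.length R (LinearMap.ker g) ≤ ℓ) :
    ∃ (E : LMod R Λ) (q : E →ₗ[Λ] V), IsBdd R Λ ω xs (ℓ * c + m) E ∧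
      IsLatPrecover R Λ ω xs q := by
  induction ℓ generalizing V with
  | zero =>
    have hs : Subsingleton (LinearMap.ker g) := Module.length_eq_zero_iff.mp (by simpa using hℓ)
    have hinj : Function.Injective g := by
      rw [← LinearMap.ker_eq_bot]
      exact Submodule.eq_bot_of_subsingleton
    let e := LinearEquiv.ofBijective g ⟨hinj, hg⟩
    refine ⟨⟨L⟩, e.symm.toLinearMap, by simpa using hL, fun Z hZ f => ⟨e.toLinearMap ∘ₗ f, ?_⟩⟩
    ext z
    simp
  | succ ℓ ih =>
    by_cases hs : Subsingleton (LinearMap.ker g)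
    · obtain ⟨E, q, hE, hq⟩ := ih V hg (by
        rw [Module.length_eq_zero_iff.mpr hs]; exact zero_le)
      exact ⟨E, q, hE.mono (by rw [add_mul]; lia), hq⟩
    rw [not_subsingleton_iff_nontrivial] at hs
    have hne : Module.length R (LinearMap.ker g) ≠ ⊤ :=
      ne_top_of_le_ne_top (ENat.natCast_ne_top _) hℓ
    obtain ⟨_, _⟩ := isFiniteLength_iff_isNoetherian_isArtinian.mp
      (Module.length_ne_top_iff.mp hne)
    have : IsArtinian Λ (LinearMap.ker g) := isArtinian_of_tower R inferInstance
    obtain ⟨T, hT⟩ := IsAtomic.exists_atom (Submodule Λ (LinearMap.ker g))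
    have hTs : IsSimpleModule Λ T := isSimpleModule_iff_isAtom.mpr hT
    let t : T →ₗ[Λ] V := (LinearMap.ker g).subtype ∘ₗ T.subtype
    have ht : Function.Injective t :=
      (Submodule.subtype_injective _).comp (Submodule.subtype_injective _)
    let V' := V ⧸ LinearMap.range t
    let π : V →ₗ[Λ] V' := (LinearMap.range t).mkQ
    have hπ : ∀ v, π v = 0 ↔ v ∈ LinearMap.range t := fun v => Submodule.Quotient.mk_eq_zero _
    have hπs : Function.Surjective π := (LinearMap.range t).mkQ_surjective
    have hgt : ∀ x, g (t x) = 0 := fun x => (x : LinearMap.ker g).2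
    obtain ⟨g', hg'⟩ := exists_comp_eq_of_surjective hπs (f := g) (by
      intro v hv
      obtain ⟨x, rfl⟩ := (hπ v).mp hv
      exact hgt x)
    replace hg' : ∀ v, g' (π v) = g v := fun v => LinearMap.congr_fun hg' v
    have hg's : Function.Surjective g' := fun z => by
      obtain ⟨v, rfl⟩ := hg z
      exact ⟨π v, hg' v⟩
    let r : LinearMap.ker g →ₗ[Λ] LinearMap.ker g' :=
      LinearMap.restrict π fun v hv => by
        rw [LinearMap.mem_ker, hg']
        exact hv
    have hlt : Module.length R (LinearMap.ker g') < Module.length R (LinearMap.ker g) := by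
      have hr : Function.Surjective r := by
        rintro ⟨z, hz⟩
        obtain ⟨v, rfl⟩ := hπs z
        rw [LinearMap.mem_ker, hg'] at hz
        exact ⟨⟨v, hz⟩, rfl⟩
      refine length_lt_of_surjective (r.restrictScalars R) hr (fun hinj => ?_)
        (ne_top_of_le_ne_top hne (Module.length_le_of_surjective (r.restrictScalars R) hr))
      have := hTs.nontrivial
      obtain ⟨x, hx⟩ := exists_ne (0 : T)
      apply hx
      apply Subtype.ext
      apply hinj
      exact (Subtype.ext ((hπ _).mpr ⟨x, rfl⟩) : r x = 0).trans (map_zero r).symm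
    obtain ⟨E, q, hE, hq⟩ := ih ⟨V'⟩ hg's (by
      have h3 := hlt.trans_le hℓ
      generalize Module.length R (LinearMap.ker g') = a at h3
      cases a with
      | top => simp at h3
      | coe a => norm_cast at h3 ⊢; lia)
    let W : Submodule Λ (V × E) :=
      LinearMap.ker (π ∘ₗ LinearMap.fst Λ V E - q ∘ₗ LinearMap.snd Λ V E)
    have hW : ∀ z, z ∈ W ↔ π z.1 = q z.2 := fun z => by simp [W, sub_eq_zero]
    let t' : T →ₗ[Λ] W := LinearMap.codRestrict W (t.prod 0) fun x => by
      rw [hW]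
      simp only [LinearMap.prod_apply, Function.prod_apply, LinearMap.zero_apply, map_zero]
      exact (hπ _).mpr ⟨x, rfl⟩
    have ht' : Function.Injective t' := fun x y hxy =>
      ht (congrArg (fun z : W => (z : V × E).1) hxy)
    have hex : Function.Exact t' (LinearMap.snd Λ V E ∘ₗ W.subtype) := by
      rintro ⟨⟨v, z⟩, hz⟩
      constructor
      · intro h0
        have h0' : z = 0 := h0
        subst h0'
        rw [hW, map_zero] at hz
        obtain ⟨x, hx⟩ := (hπ v).mp hz
        exact ⟨x, Subtype.ext (Prod.ext hx rfl)⟩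
      · rintro ⟨x, hx⟩
        rw [← hx]
        rfl
    have hsurj : Function.Surjective (LinearMap.snd Λ V E ∘ₗ W.subtype) := by
      intro z
      obtain ⟨v, hv⟩ := hπs (q z)
      exact ⟨⟨(v, z), (hW _).mpr hv⟩, rfl⟩
    obtain ⟨E', q', hE', hq'⟩ := h.exists_precover_of_simple hG hE ht' hex hsurj
    refine ⟨E', LinearMap.fst Λ V E ∘ₗ W.subtype ∘ₗ q', hE'.mono (by rw [add_mul]; lia), ?_⟩
    intro Z hZ f
    obtain ⟨k, hk⟩ := hq Z hZ (π ∘ₗ f)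
    obtain ⟨k', hk'⟩ := hq' Z hZ (LinearMap.codRestrict W (f.prod k) fun z => by
      rw [hW]
      exact (LinearMap.congr_fun hk z).symm)
    refine ⟨k', ?_⟩
    rw [LinearMap.comp_assoc, LinearMap.comp_assoc, hk']
    rfl

end Precovers

section ResidueEnvelope

theorem exists_injective_module {R : Type u} [CommRing R] (N : Type u) [AddCommGroup N]
    [Module R N] : ∃ (E : Type u) (_ : AddCommGroup E) (_ : Module R E) (j : N →ₗ[R] E),
      Module.Injective R E ∧ Function.Injective j := by
  have h := ModuleCat.enoughInjectives.{u, u} (R := R)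
  let E := CategoryTheory.Injective.under (ModuleCat.of R N)
  have hE : CategoryTheory.Injective (ModuleCat.of R E) :=
    inferInstanceAs (CategoryTheory.Injective (CategoryTheory.Injective.under (ModuleCat.of R N)))
  refine ⟨E, inferInstance, inferInstance, (CategoryTheory.Injective.ι (ModuleCat.of R N)).hom,
    Module.injective_module_of_injective_object R E, ?_⟩
  exact (ModuleCat.mono_iff_injective _).mp inferInstance

variable {R : Type u} [CommRing R] {E : Type u} [AddCommGroup E] [Module R E]

theorem exists_maximal_essential {k₀ : E} (h0 : ∀ r : R, r • k₀ ≠ 0 → IsUnit r) :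
    ∃ J : Submodule R E, k₀ ∈ J ∧ (∀ e ∈ J, e ≠ 0 → ∃ r : R, r • e = k₀) ∧
      ∀ J' : Submodule R E, J ≤ J' → (∀ e ∈ J', e ≠ 0 → ∃ r : R, r • e = k₀) → J' ≤ J := by
  obtain ⟨J, h1, h2, h3⟩ := zorn_le_nonempty₀
    {J : Submodule R E | ∀ e ∈ J, e ≠ 0 → ∃ r : R, r • e = k₀}
    (fun c hc hch J hJ => ⟨sSup c, fun e he hne => by
      obtain ⟨A, hA, heA⟩ := (Submodule.mem_sSup_of_directed ⟨J, hJ⟩ hch.directedOn).mp he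
      exact hc hA e heA hne, fun z hz => le_sSup hz⟩) (Submodule.span R {k₀}) (by
      intro e he hne
      obtain ⟨s, rfl⟩ := Submodule.mem_span_singleton.mp he
      obtain ⟨u, rfl⟩ := h0 s hne
      exact ⟨(u⁻¹ : Rˣ), by rw [smul_smul, Units.inv_mul, one_smul]⟩)
  exact ⟨J, h1 (Submodule.mem_span_singleton_self k₀), h2, fun J' h h' => h3 h' h⟩

theorem exists_maximal_disjoint (J : Submodule R E) :
    ∃ C : Submodule R E, (∀ c ∈ C, c ∈ J → c = 0) ∧
      ∀ e, e ∉ C → ∃ c ∈ C, ∃ r : R, c + r • e ∈ J ∧ c + r • e ≠ 0 := by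
  obtain ⟨C, -, h2, h3⟩ := zorn_le_nonempty₀
    {C : Submodule R E | ∀ c ∈ C, c ∈ J → c = 0}
    (fun c hc hch J hJ => ⟨sSup c, fun e he hne => by
      obtain ⟨A, hA, heA⟩ := (Submodule.mem_sSup_of_directed ⟨J, hJ⟩ hch.directedOn).mp he
      exact hc hA e heA hne, fun z hz => le_sSup hz⟩) ⊥ (fun c hc _ => hc)
  refine ⟨C, h2, fun e he => ?_⟩
  by_contra! hcon
  apply he
  refine h3 (y := C ⊔ Submodule.span R {e}) (fun d hd hdJ => ?_) le_sup_left
    (Submodule.mem_sup_right (Submodule.mem_span_singleton_self e))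
  obtain ⟨c, hc, z, hz, rfl⟩ := Submodule.mem_sup.mp hd
  obtain ⟨r, rfl⟩ := Submodule.mem_span_singleton.mp hz
  exact hcon c hc r hdJ

theorem exists_injective_essential [Module.Injective R E] {k₀ : E}
    (h0 : ∀ r : R, r • k₀ ≠ 0 → IsUnit r) :
    ∃ J : Submodule R E, k₀ ∈ J ∧ (∀ e ∈ J, e ≠ 0 → ∃ r : R, r • e = k₀) ∧
      Module.Injective R J := by
  obtain ⟨J, h1, h2, h3⟩ := exists_maximal_essential h0
  obtain ⟨C, h4, h5⟩ := exists_maximal_disjoint J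
  obtain ⟨h, hh⟩ := Module.Injective.out (R := R) (Q := E) (C.mkQ ∘ₗ J.subtype) (by
    rw [← LinearMap.ker_eq_bot, LinearMap.ker_eq_bot']
    intro j hj
    exact Subtype.ext (h4 j ((Submodule.Quotient.mk_eq_zero C).mp hj) j.2)) J.subtype
  have key : ∀ z : E ⧸ C, z ≠ 0 → ∃ (r : R) (j : J), r • z = C.mkQ j ∧ j ≠ 0 := by
    intro z hz
    obtain ⟨e, rfl⟩ := C.mkQ_surjective z
    obtain ⟨c, hc, r, hJ, hne⟩ := h5 e fun hc => hz ((Submodule.Quotient.mk_eq_zero C).mpr hc)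
    refine ⟨r, ⟨_, hJ⟩, ?_, fun h => hne (congrArg Subtype.val h)⟩
    rw [map_add, map_smul, (show C.mkQ c = 0 from (Submodule.Quotient.mk_eq_zero C).mpr hc),
      zero_add]
  have hr : LinearMap.range h ≤ J := by
    refine h3 _ (fun j hj => ⟨C.mkQ j, hh ⟨j, hj⟩⟩) ?_
    rintro _ ⟨z, rfl⟩ hne
    obtain ⟨r, j, hrj, hj⟩ := key z (by rintro rfl; exact hne (map_zero h))
    obtain ⟨s, hs⟩ := h2 j j.2 fun h => hj (Subtype.ext h)
    refine ⟨s * r, ?_⟩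
    rw [mul_smul, ← map_smul, hrj]
    exact (congrArg (s • ·) (hh j)).trans hs
  refine ⟨J, h1, h2, ⟨fun X Y _ _ _ _ f hf g => ?_⟩⟩
  obtain ⟨g', hg'⟩ := Module.Injective.out (R := R) (Q := E) f hf (J.subtype ∘ₗ g)
  refine ⟨LinearMap.codRestrict J (h ∘ₗ C.mkQ ∘ₗ g') fun y => hr ⟨_, rfl⟩, fun x => ?_⟩
  apply Subtype.ext
  exact (congrArg (fun e => h (C.mkQ e)) (hg' x)).trans (hh (g x))

/-- An injective module whose socle is simple, for a local ring. -/
structure IsResidueEnvelope (R : Type u) [CommRing R] [IsLocalRing R] (E : Type u)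
    [AddCommGroup E] [Module R E] : Prop where
  injective : Module.Injective R E
  exists_socle : ∃ k₀ : E, k₀ ≠ 0 ∧ (∀ r ∈ maximalIdeal R, r • k₀ = 0) ∧
    ∀ e : E, (∀ r ∈ maximalIdeal R, r • e = 0) → ∃ s : R, e = s • k₀

variable [IsLocalRing R]

theorem exists_isResidueEnvelope (R : Type u) [CommRing R] [IsLocalRing R] :
    ∃ (E : Type u) (_ : AddCommGroup E) (_ : Module R E), IsResidueEnvelope R E := by
  obtain ⟨E, _, _, j, hE, hj⟩ := exists_injective_module (R := R) (R ⧸ maximalIdeal R)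
  let k₀ := j (Submodule.Quotient.mk 1)
  have hk : ∀ r : R, r • k₀ = 0 ↔ r ∈ maximalIdeal R := fun r => by
    rw [← map_smul, map_eq_zero_iff j hj, ← Submodule.Quotient.mk_smul, smul_eq_mul, mul_one,
      Submodule.Quotient.mk_eq_zero]
  obtain ⟨J, h1, h2, h3⟩ := exists_injective_essential (k₀ := k₀) (R := R) fun r hr => by
    rw [Ne, hk] at hr
    simpa using hr
  have hk0 : k₀ ≠ 0 := fun h => by
    have := (hk 1).mp (by rw [h, smul_zero])
    exact (Ideal.ne_top_iff_one _).mp (maximalIdeal.isMaximal R).ne_top this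
  refine ⟨J, inferInstance, inferInstance, h3, ⟨k₀, h1⟩, fun h => hk0 (congrArg Subtype.val h),
    fun r hr => Subtype.ext ((hk r).mpr hr), fun e he => ?_⟩
  by_cases h0 : e = 0
  · exact ⟨0, by rw [h0, zero_smul]⟩
  obtain ⟨r, hr⟩ := h2 e e.2 fun h => h0 (Subtype.ext h)
  have hu : IsUnit r := by
    by_contra hu
    have := congrArg Subtype.val (he r hu)
    exact hk0 (hr.symm.trans this)
  obtain ⟨u, rfl⟩ := hu
  refine ⟨(u⁻¹ : Rˣ), Subtype.ext ?_⟩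
  change (e : E) = (u⁻¹ : Rˣ).1 • k₀
  rw [← hr, smul_smul, Units.inv_mul, one_smul]

variable {N : Type u} [AddCommGroup N] [Module R N]

theorem IsResidueEnvelope.exists_extend (h : IsResidueEnvelope R E) {A : Type u}
    [AddCommGroup A] [Module R A] {f : A →ₗ[R] N} (hf : Function.Injective f) (g : A →ₗ[R] E) :
    ∃ k : N →ₗ[R] E, ∀ a, k (f a) = g a :=
  h.injective.out f hf g

theorem IsResidueEnvelope.exists_extend_of_ker_le (h : IsResidueEnvelope R E) {A : Type u}
    [AddCommGroup A] [Module R A] (f : A →ₗ[R] N) (g : A →ₗ[R] E)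
    (hfg : ∀ a, f a = 0 → g a = 0) : ∃ k : N →ₗ[R] E, ∀ a, k (f a) = g a := by
  obtain ⟨k, hk⟩ := h.exists_extend (f := (LinearMap.range f).subtype)
    (Submodule.subtype_injective _)
    ((LinearMap.ker f).liftQ g (fun a ha => hfg a ha) ∘ₗ f.quotKerEquivRange.symm.toLinearMap)
  refine ⟨k, fun a => ?_⟩
  have h1 := hk ⟨f a, a, rfl⟩
  have h2 : f.quotKerEquivRange.symm ⟨f a, a, rfl⟩ = (LinearMap.ker f).mkQ a := by
    rw [LinearEquiv.symm_apply_eq]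
    rfl
  have h3 : k (f a) = (LinearMap.ker f).liftQ g (fun a ha => hfg a ha) (Submodule.Quotient.mk a) := by
    simpa [h2] using h1
  exact h3

theorem IsResidueEnvelope.exists_ne_zero (h : IsResidueEnvelope R E) {U : Submodule R N} {n : N}
    (hn : n ∉ U) : ∃ θ : N →ₗ[R] E, (∀ x ∈ U, θ x = 0) ∧ θ n ≠ 0 := by
  obtain ⟨k₀, hk, hk', -⟩ := h.exists_socle
  obtain ⟨θ, hθ⟩ := h.exists_extend_of_ker_le (LinearMap.toSpanSingleton R (N ⧸ U) (U.mkQ n))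
    (LinearMap.toSpanSingleton R E k₀) fun r hr => hk' r fun hu => by
      obtain ⟨u, rfl⟩ := hu
      apply hn
      rw [← Submodule.Quotient.mk_eq_zero]
      have : (u⁻¹ : Rˣ).1 • u.1 • U.mkQ n = 0 := by
        rw [show u.1 • U.mkQ n = 0 from hr, smul_zero]
      rwa [smul_smul, Units.inv_mul, one_smul] at this
  refine ⟨θ ∘ₗ U.mkQ, fun x hx => ?_, fun h0 => hk ?_⟩
  · rw [LinearMap.comp_apply, Submodule.mkQ_apply, (Submodule.Quotient.mk_eq_zero U).mpr hx,
      map_zero]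
  · have := hθ 1
    rw [LinearMap.toSpanSingleton_apply, LinearMap.toSpanSingleton_apply, one_smul, one_smul] at this
    exact this.symm.trans h0

theorem IsResidueEnvelope.length_hom_le_one (h : IsResidueEnvelope R E) [IsSimpleModule R N] :
    Module.length R (N →ₗ[R] E) ≤ 1 := by
  obtain ⟨k₀, hk, hk', hs⟩ := h.exists_socle
  have := IsSimpleModule.nontrivial R N
  obtain ⟨n, hn⟩ := exists_ne (0 : N)
  have hspan : ∀ z : N, ∃ r : R, r • n = z :=
    IsSimpleModule.toSpanSingleton_surjective R hn
  have hm : ∀ r ∈ maximalIdeal R, r • n = 0 := by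
    intro r hr
    by_contra hne
    obtain ⟨s, hs⟩ := IsSimpleModule.toSpanSingleton_surjective R hne n
    have h1 : (1 - s * r) • n = 0 := by
      rw [sub_smul, one_smul, mul_smul]
      exact sub_eq_zero.mpr hs.symm
    have h2 : IsUnit (1 - s * r) := by
      by_contra hc
      have : (1 : R) ∈ maximalIdeal R := by
        have := Ideal.add_mem _ (show 1 - s * r ∈ maximalIdeal R from hc)
          (Ideal.mul_mem_left _ s hr)
        rwa [sub_add_cancel] at this
      exact (Ideal.ne_top_iff_one _).mp (maximalIdeal.isMaximal R).ne_top this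
    obtain ⟨u, hu⟩ := h2
    apply hn
    have : (u⁻¹ : Rˣ).1 • u.1 • n = 0 := by rw [hu, h1, smul_zero]
    rwa [smul_smul, Units.inv_mul, one_smul] at this
  let ev : (N →ₗ[R] E) →ₗ[R] E := LinearMap.applyₗ n
  have hev : Function.Injective ev := by
    intro f g hfg
    ext z
    obtain ⟨r, rfl⟩ := hspan z
    rw [map_smul, map_smul]
    exact congrArg (r • ·) hfg
  let c : (R ⧸ maximalIdeal R) →ₗ[R] E :=
    (maximalIdeal R).liftQ (LinearMap.toSpanSingleton R E k₀) fun r hr => hk' r hr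
  have hr : ∀ φ, ev φ ∈ LinearMap.range c := fun φ => by
    obtain ⟨s, hs⟩ := hs (φ n) fun r hr => by rw [← map_smul, hm r hr, map_zero]
    exact ⟨Submodule.Quotient.mk s, hs.symm⟩
  have h1 := Module.length_le_of_injective (LinearMap.codRestrict _ ev hr)
    (fun a b hab => hev (congrArg Subtype.val hab))
  have h2 := Module.length_le_of_surjective c.rangeRestrict c.surjective_rangeRestrict
  have h3 : IsSimpleModule R (R ⧸ maximalIdeal R) :=
    isSimpleModule_iff_isCoatom.mpr (maximalIdeal.isMaximal R).out
  exact h1.trans (h2.trans (Module.length_eq_one R (R ⧸ maximalIdeal R)).le)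

theorem IsResidueEnvelope.length_hom_le (h : IsResidueEnvelope R E) :
    Module.length R (N →ₗ[R] E) ≤ Module.length R N := by
  by_cases hN : Module.length R N = ⊤
  · rw [hN]; exact le_top
  rw [← Ne, Module.length_ne_top_iff] at hN
  induction hN with
  | of_subsingleton =>
    rename_i M _ _ _
    have : Subsingleton (M →ₗ[R] E) := ⟨fun f g => LinearMap.ext fun x => by
      rw [Subsingleton.elim x 0, map_zero, map_zero]⟩
    rw [Module.length_eq_zero_iff.mpr this]
    exact zero_le
  | of_simple_quotient hA ih =>
    rename_i M _ _ A _
    let a : ((M ⧸ A) →ₗ[R] E) →ₗ[R] (M →ₗ[R] E) := LinearMap.lcomp R E A.mkQ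
    let b : (M →ₗ[R] E) →ₗ[R] (A →ₗ[R] E) := LinearMap.lcomp R E A.subtype
    have h1 := Module.length_eq_add_of_exact a b (by
        intro f g hfg
        ext z
        exact LinearMap.congr_fun hfg z) (by
        intro f
        obtain ⟨k, hk⟩ := h.exists_extend A.subtype_injective f
        exact ⟨k, LinearMap.ext hk⟩) (by
        intro f
        constructor
        · intro hf
          exact ⟨A.liftQ f fun x hx => LinearMap.congr_fun hf ⟨x, hx⟩, LinearMap.ext fun x => rfl⟩
        · rintro ⟨g, rfl⟩
          ext x
          change g (A.mkQ x) = 0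
          rw [Submodule.mkQ_apply, (Submodule.Quotient.mk_eq_zero A).mpr x.2, map_zero])
    have h2 := Module.length_eq_add_of_exact A.subtype A.mkQ A.subtype_injective A.mkQ_surjective
      (LinearMap.exact_subtype_mkQ A)
    rw [h1, h2, add_comm, Module.length_eq_one R (M ⧸ A)]
    exact add_le_add ih h.length_hom_le_one

end ResidueEnvelope

section Coinduced

/-- Right multiplication on a free left module. -/
def rightMul {Λ : Type u} [Ring Λ] (q : ℕ) (c : Λ) : (Fin q → Λ) →ₗ[Λ] (Fin q → Λ) :=
  LinearMap.pi fun i => LinearMap.toSpanSingleton Λ Λ c ∘ₗ LinearMap.proj i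

theorem rightMul_apply {Λ : Type u} [Ring Λ] {q : ℕ} (c : Λ) (v : Fin q → Λ) (i : Fin q) :
    rightMul q c v i = v i * c := rfl

/-- The `R`-linear maps from `Λ ^ q` to `E`, with `Λ` acting through right multiplication. -/
def CoInd (R : Type u) [CommRing R] (Λ : Type u) [Ring Λ] [Algebra R Λ] (q : ℕ)
    (E : Type u) [AddCommGroup E] [Module R E] : Type u := (Fin q → Λ) →ₗ[R] E

variable {R : Type u} [CommRing R] {Λ : Type u} [Ring Λ] [Algebra R Λ] {q n : ℕ}
  {E : Type u} [AddCommGroup E] [Module R E]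

instance : AddCommGroup (CoInd R Λ q E) :=
  inferInstanceAs (AddCommGroup ((Fin q → Λ) →ₗ[R] E))

instance : Module R (CoInd R Λ q E) :=
  inferInstanceAs (Module R ((Fin q → Λ) →ₗ[R] E))

/-- The underlying linear map of an element of `CoInd R Λ q E`. -/
def CoInd.toHom : CoInd R Λ q E ≃ₗ[R] ((Fin q → Λ) →ₗ[R] E) := LinearEquiv.refl R _

instance : SMul Λ (CoInd R Λ q E) :=
  ⟨fun c w => CoInd.toHom.symm (CoInd.toHom w ∘ₗ (rightMul q c).restrictScalars R)⟩

theorem CoInd.toHom_smul (c : Λ) (w : CoInd R Λ q E) (v : Fin q → Λ) :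
    toHom (c • w) v = toHom w (rightMul q c v) := rfl

theorem CoInd.ext {w w' : CoInd R Λ q E} (h : ∀ v, toHom w v = toHom w' v) : w = w' :=
  toHom.injective (LinearMap.ext h)

instance : Module Λ (CoInd R Λ q E) where
  one_smul w := CoInd.ext fun v => by
    rw [CoInd.toHom_smul]
    congr 1
    ext i
    rw [rightMul_apply, mul_one]
  mul_smul c d w := CoInd.ext fun v => by
    rw [CoInd.toHom_smul, CoInd.toHom_smul, CoInd.toHom_smul]
    congr 1
    ext i
    simp only [rightMul_apply, mul_assoc]
  smul_zero c := CoInd.ext fun v => by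
    rw [CoInd.toHom_smul, map_zero]
    rfl
  smul_add c w w' := CoInd.ext fun v => by
    simp only [map_add, LinearMap.add_apply, CoInd.toHom_smul]
  zero_smul w := CoInd.ext fun v => by
    rw [CoInd.toHom_smul, map_zero, LinearMap.zero_apply, show rightMul q (0 : Λ) v = 0 from
      funext fun i => mul_zero _, map_zero]
  add_smul c d w := CoInd.ext fun v => by
    rw [CoInd.toHom_smul, map_add, LinearMap.add_apply, CoInd.toHom_smul, CoInd.toHom_smul,
      ← map_add]
    congr 1
    ext i
    exact mul_add _ _ _

instance : IsScalarTower R Λ (CoInd R Λ q E) where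
  smul_assoc r c w := CoInd.ext fun v => by
    rw [CoInd.toHom_smul, map_smul, LinearMap.smul_apply, CoInd.toHom_smul, ← map_smul]
    congr 1
    ext i
    exact mul_smul_comm _ _ _

variable {M B : Type u} [AddCommGroup M] [Module Λ M] [Module R M] [IsScalarTower R Λ M]
  [AddCommGroup B] [Module Λ B] [Module R B] [IsScalarTower R Λ B]

/-- The map `X ^ n → X ^ q` given by a matrix with entries in `Λ`. -/
def relMap (R : Type u) [CommRing R] [Algebra R Λ] (a : Fin q → Fin n → Λ)
    (X : Type u) [AddCommGroup X] [Module Λ X] [Module R X] [IsScalarTower R Λ X] :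
    (Fin n → X) →ₗ[R] (Fin q → X) where
  toFun x i := ∑ j, a i j • x j
  map_add' x y := funext fun i => by simp [smul_add, Finset.sum_add_distrib]
  map_smul' r x := funext fun i => by
    have := IsScalarTower.to_smulCommClass (R := R) (A := Λ) (M := X)
    simp only [Pi.smul_apply, RingHom.id_apply, Finset.smul_sum]
    exact Finset.sum_congr rfl fun j _ => smul_comm _ _ _

theorem relMap_apply (a : Fin q → Fin n → Λ) (x : Fin n → M) (i : Fin q) :
    relMap R a M x i = ∑ j, a i j • x j := rfl

theorem relMap_rightMul (a : Fin q → Fin n → Λ) (u : Fin n → Λ) (c : Λ) :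
    relMap R a Λ (rightMul n c u) = rightMul q c (relMap R a Λ u) := by
  ext i
  simp only [relMap_apply, rightMul_apply, Finset.sum_mul, smul_eq_mul, mul_assoc]

/-- The map `u ↦ (u j • b)_j`. -/
def spanMap (R : Type u) [CommRing R] [Algebra R Λ] (n : ℕ) {B : Type u} [AddCommGroup B]
    [Module Λ B] [Module R B] [IsScalarTower R Λ B] (b : B) : (Fin n → Λ) →ₗ[R] (Fin n → B) :=
  (LinearMap.pi fun j => LinearMap.toSpanSingleton Λ B b ∘ₗ LinearMap.proj j).restrictScalars R

theorem spanMap_apply (b : B) (u : Fin n → Λ) (j : Fin n) : spanMap R n b u j = u j • b := rfl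

theorem relMap_spanMap (a : Fin q → Fin n → Λ) (x : M) (u : Fin n → Λ) :
    spanMap R q x (relMap R a Λ u) = relMap R a M (spanMap R n x u) := by
  ext i
  simp only [spanMap_apply, relMap_apply, Finset.sum_smul, smul_eq_mul, mul_smul]

/-- The extension of `M` by the dual of the transpose of a presentation, classified by `θ`. -/
def dualExt (I : Ideal R) (a : Fin q → Fin n → Λ) (π : M →ₗ[Λ] B) (θ : (Fin n → B) →ₗ[R] E) :
    Submodule Λ (M × CoInd R Λ q E) where
  carrier := {z | (∀ v ∈ redSub Λ I (Fin q → Λ), CoInd.toHom z.2 v = 0) ∧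
    ∀ u, CoInd.toHom z.2 (relMap R a Λ u) = θ (spanMap R n (π z.1) u)}
  add_mem' := by
    rintro z z' ⟨h1, h2⟩ ⟨h3, h4⟩
    refine ⟨fun v hv => ?_, fun u => ?_⟩
    · rw [Prod.snd_add, map_add, LinearMap.add_apply, h1 v hv, h3 v hv, add_zero]
    · rw [Prod.snd_add, Prod.fst_add, map_add, map_add, LinearMap.add_apply, h2, h4, ← map_add]
      congr 1
      ext j
      simp only [spanMap_apply, Pi.add_apply, smul_add]
  zero_mem' := by
    refine ⟨fun v _ => rfl, fun u => ?_⟩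
    rw [Prod.fst_zero, map_zero, show spanMap R n (0 : B) u = 0 from
      funext fun j => smul_zero _, map_zero]
    rfl
  smul_mem' c z := by
    rintro ⟨h1, h2⟩
    refine ⟨fun v hv => ?_, fun u => ?_⟩
    · rw [Prod.smul_snd, CoInd.toHom_smul]
      exact h1 _ (map_mem_redSub _ hv)
    · rw [Prod.smul_snd, CoInd.toHom_smul, ← relMap_rightMul, h2, Prod.smul_fst, map_smul]
      congr 1
      ext j
      simp only [spanMap_apply, rightMul_apply, mul_smul]

theorem length_ker_dualExt_le [IsLocalRing R] (hE : IsResidueEnvelope R E) (I : Ideal R)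
    (a : Fin q → Fin n → Λ) (π : M →ₗ[Λ] B) (θ : (Fin n → B) →ₗ[R] E) :
    Module.length R (LinearMap.ker (LinearMap.fst Λ M (CoInd R Λ q E) ∘ₗ
      (dualExt I a π θ).subtype)) ≤ Module.length R ((Fin q → Λ) ⧸ redSub Λ I (Fin q → Λ)) := by
  let g := LinearMap.fst Λ M (CoInd R Λ q E) ∘ₗ (dualExt I a π θ).subtype
  let Q := (Fin q → Λ) ⧸ redSub Λ I (Fin q → Λ)
  let mk : (Fin q → Λ) →ₗ[R] Q := (redSub Λ I (Fin q → Λ)).mkQ.restrictScalars R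
  have hmk : Function.Surjective mk := (redSub Λ I (Fin q → Λ)).mkQ_surjective
  let l : (Q →ₗ[R] E) →ₗ[R] ((Fin q → Λ) →ₗ[R] E) := LinearMap.lcomp R E mk
  have hl : Function.Injective l := fun f f' hff => LinearMap.ext fun z => by
    obtain ⟨v, rfl⟩ := hmk z
    exact LinearMap.congr_fun hff v
  let s : LinearMap.ker g →ₗ[R] ((Fin q → Λ) →ₗ[R] E) :=
    CoInd.toHom.toLinearMap ∘ₗ (LinearMap.snd Λ M (CoInd R Λ q E) ∘ₗ (dualExt I a π θ).subtype ∘ₗ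
      (LinearMap.ker g).subtype).restrictScalars R
  have hmk0 : ∀ v, mk v = 0 → v ∈ redSub Λ I (Fin q → Λ) := fun v hv =>
    (Submodule.Quotient.mk_eq_zero (redSub Λ I (Fin q → Λ))).mp hv
  have hsz : ∀ z, ∀ v ∈ redSub Λ I (Fin q → Λ), s z v = 0 := fun z v hv => z.1.2.1 v hv
  have hsl : ∀ z, s z ∈ LinearMap.range l := fun z => by
    obtain ⟨t, ht⟩ := exists_comp_eq_of_surjective hmk (f := s z) fun v hv => hsz z v (hmk0 v hv)
    exact ⟨t, ht⟩
  obtain ⟨k, hk⟩ := (exists_comp_eq_of_injective (Λ := R) (C := LinearMap.ker g) (j := l) hl (f := s) (by exact hsl))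
  have hs : Function.Injective s := fun z z' hzz => by
    apply Subtype.ext
    apply Subtype.ext
    refine Prod.ext ?_ (CoInd.toHom.injective hzz)
    exact (LinearMap.mem_ker.mp z.2).trans (LinearMap.mem_ker.mp z'.2).symm
  refine (Module.length_le_of_injective k ?_).trans hE.length_hom_le
  rw [← hk] at hs
  exact Function.Injective.of_comp (f := l) (by simpa using hs)

theorem eq_zero_of_section {I : Ideal R} {a : Fin q → Fin n → Λ} {π : M →ₗ[Λ] B}
    {θ : (Fin n → B) →ₗ[R] E} {s : M →ₗ[Λ] dualExt I a π θ} (hs : ∀ x, (s x).1.1 = x)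
    {m : Fin n → M} (hm : ∀ i, relMap R a M m i ∈ redSub Λ I M) :
    θ (fun j => π (m j)) = 0 := by
  classical
  let w : M →ₗ[Λ] CoInd R Λ q E := LinearMap.snd Λ M (CoInd R Λ q E) ∘ₗ (dualExt I a π θ).subtype ∘ₗ s
  have hw : ∀ x, ∀ v ∈ redSub Λ I (Fin q → Λ), CoInd.toHom (w x) v = 0 := fun x => (s x).2.1
  have hw' : ∀ x u, CoInd.toHom (w x) (relMap R a Λ u) = θ (spanMap R n (π x) u) := fun x u => by
    have := (s x).2.2 u
    rwa [hs] at this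
  have hred : ∀ x ∈ redSub Λ I M, ∀ v, CoInd.toHom (w x) v = 0 := by
    intro x hx v
    refine Submodule.smul_induction_on (p := fun x => CoInd.toHom (w x) v = 0) (mem_redSub.mp hx)
      (fun r hr y _ => ?_) fun x y hx hy => ?_
    · rw [LinearMap.map_smul_of_tower, map_smul, LinearMap.smul_apply, ← map_smul]
      exact hw y _ (smul_mem_redSub hr v)
    · rw [map_add, map_add, LinearMap.add_apply, hx, hy, add_zero]
  have h1 : (fun j => π (m j)) = ∑ j, spanMap R n (π (m j)) (Pi.single j (1 : Λ)) := by
    ext j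
    rw [Finset.sum_apply, Finset.sum_eq_single j]
    · rw [spanMap_apply, Pi.single_eq_same, one_smul]
    · intro j' _ hj
      rw [spanMap_apply, Pi.single_eq_of_ne hj.symm, zero_smul]
    · simp
  have h2 : ∀ j, relMap R a Λ (Pi.single j (1 : Λ)) = ∑ i, rightMul q (a i j) (Pi.single i (1 : Λ)) := by
    intro j
    ext i
    rw [relMap_apply, Finset.sum_apply, Finset.sum_eq_single j, Finset.sum_eq_single i]
    · rw [rightMul_apply, Pi.single_eq_same, Pi.single_eq_same, smul_eq_mul, mul_one, one_mul]
    · intro i' _ hi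
      rw [rightMul_apply, Pi.single_eq_of_ne hi.symm, zero_mul]
    · simp
    · intro j' _ hj
      rw [Pi.single_eq_of_ne hj, smul_zero]
    · simp
  rw [h1, map_sum]
  simp only [← hw', h2, map_sum, ← CoInd.toHom_smul, ← map_smul]
  rw [Finset.sum_comm]
  refine Finset.sum_eq_zero fun i _ => ?_
  rw [← LinearMap.sum_apply, ← map_sum, ← map_sum]
  exact hred _ (hm i) _

theorem exists_lift_dualExt {I : Ideal R} {a : Fin q → Fin n → Λ} {π : M →ₗ[Λ] B}
    {θ : (Fin n → B) →ₗ[R] E} [IsLocalRing R] (hE : IsResidueEnvelope R E) {X : Type u}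
    [AddCommGroup X] [Module Λ X] [Module R X] [IsScalarTower R Λ X] {f : X →ₗ[Λ] M}
    (h : ∀ x : Fin n → X, (∀ i, relMap R a X x i ∈ redSub Λ I X) → θ (fun j => π (f (x j))) = 0) :
    ∃ k : X →ₗ[Λ] dualExt I a π θ, ∀ x, (k x).1.1 = f x := by
  let mk : X →ₗ[Λ] X ⧸ redSub Λ I X := (redSub Λ I X).mkQ
  have hmk : ∀ x, mk x = 0 ↔ x ∈ redSub Λ I X := fun x => Submodule.Quotient.mk_eq_zero _
  let mks : (Fin q → X) →ₗ[R] (Fin q → X ⧸ redSub Λ I X) :=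
    (LinearMap.pi fun i => mk ∘ₗ LinearMap.proj i).restrictScalars R
  let πf : (Fin n → X) →ₗ[R] (Fin n → B) :=
    (LinearMap.pi fun j => (π ∘ₗ f) ∘ₗ LinearMap.proj j).restrictScalars R
  obtain ⟨W, hW⟩ := hE.exists_extend_of_ker_le (mks ∘ₗ relMap R a X) (θ ∘ₗ πf) fun x hx =>
    h x fun i => (hmk _).mp (congrFun hx i)
  let w : X →ₗ[Λ] CoInd R Λ q E :=
    { toFun := fun x => CoInd.toHom.symm (W ∘ₗ mks ∘ₗ spanMap R q x)
      map_add' := fun x y => CoInd.ext fun v => by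
        rw [map_add, LinearMap.add_apply]
        simp only [LinearEquiv.apply_symm_apply, LinearMap.comp_apply, ← map_add]
        congr 2
        ext i
        simp only [spanMap_apply, Pi.add_apply, smul_add]
      map_smul' := fun c x => CoInd.ext fun v => by
        rw [RingHom.id_apply, CoInd.toHom_smul]
        simp only [LinearEquiv.apply_symm_apply, LinearMap.comp_apply]
        congr 2
        ext i
        simp only [spanMap_apply, rightMul_apply, mul_smul] }
  have hw : ∀ x v, CoInd.toHom (w x) v = W (mks (spanMap R q x v)) := fun x v => rfl
  refine ⟨LinearMap.codRestrict _ (f.prod w) fun x => ⟨fun v hv => ?_, fun u => ?_⟩, fun x => rfl⟩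
  · change CoInd.toHom (w x) v = 0
    rw [hw, show mks (spanMap R q x v) = 0 from funext fun i => (hmk _).mpr ?_, map_zero]
    exact map_mem_redSub (LinearMap.toSpanSingleton Λ X x ∘ₗ LinearMap.proj i) hv
  · change CoInd.toHom (w x) _ = θ (spanMap R n (π (f x)) u)
    rw [hw, relMap_spanMap]
    refine (hW _).trans ?_
    rw [LinearMap.comp_apply]
    congr 1
    ext j
    change π (f (u j • x)) = u j • π (f x)
    rw [map_smul, map_smul]

end Coinduced

section AlmostSplitTarget

variable {R : Type u} [CommRing R] [IsLocalRing R] [IsNoetherianRing R]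
  {Λ : Type u} [Ring Λ] [Algebra R Λ] [Module.Finite R Λ]
  {ω : Type u} [AddCommGroup ω] [Module R ω] {xs : List R}
  {M : Type u} [AddCommGroup M] [Module Λ M] [Module R M] [IsScalarTower R Λ M]

theorem exists_surjective_of_length_le {n : ℕ} (N : LMod R Λ) (h : Module.length R N ≤ n) :
    ∃ p : (Fin n → Λ) →ₗ[Λ] N, Function.Surjective p := by
  induction n generalizing N with
  | zero =>
    have : Subsingleton N := Module.length_eq_zero_iff.mp (by simpa using h)
    exact ⟨0, fun x => ⟨0, Subsingleton.elim _ _⟩⟩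
  | succ n ih =>
    by_cases hs : Subsingleton N
    · exact ⟨0, fun x => ⟨0, Subsingleton.elim _ _⟩⟩
    rw [not_subsingleton_iff_nontrivial] at hs
    have hne : Module.length R N ≠ ⊤ := ne_top_of_le_ne_top (ENat.natCast_ne_top _) h
    obtain ⟨_, _⟩ := isFiniteLength_iff_isNoetherian_isArtinian.mp
      (Module.length_ne_top_iff.mp hne)
    have : IsArtinian Λ N := isArtinian_of_tower R inferInstance
    obtain ⟨T, hT⟩ := IsAtomic.exists_atom (Submodule Λ N)
    have hTs : IsSimpleModule Λ T := isSimpleModule_iff_isAtom.mpr hT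
    have := IsSimpleModule.nontrivial Λ T
    obtain ⟨t, ht⟩ := exists_ne (0 : T)
    have hq : Function.Surjective (T.mkQ.restrictScalars R) := T.mkQ_surjective
    have hlt := length_lt_of_surjective (T.mkQ.restrictScalars R) hq (fun hinj => ht (by
        apply Subtype.ext
        apply hinj
        exact ((Submodule.Quotient.mk_eq_zero T).mpr t.2 : T.mkQ t = 0).trans
          (map_zero T.mkQ).symm))
      (ne_top_of_le_ne_top hne (Module.length_le_of_surjective _ hq))
    obtain ⟨p, hp⟩ := ih ⟨N ⧸ T⟩ (by
      have h3 := hlt.trans_le h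
      generalize Module.length R (N ⧸ T) = a at h3
      cases a with
      | top => simp at h3
      | coe a => norm_cast at h3 ⊢; lia)
    obtain ⟨s, hs⟩ := exists_surjective_of_exact (n := 1) (i := T.subtype) (g := T.mkQ)
      (LinearMap.exact_subtype_mkQ T) (p := LinearMap.toSpanSingleton Λ T t ∘ₗ LinearMap.proj 0)
      (fun y => by
        obtain ⟨c, hc⟩ := IsSimpleModule.toSpanSingleton_surjective Λ ht y
        exact ⟨fun _ => c, hc⟩) hp T.mkQ_surjective
    exact exists_surjective_of_le (by lia) hs

/-- A finitely generated module over the order has a presentation modulo `I` whose size depends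
only on its number of generators. -/
theorem exists_relations {I : Ideal R} {n q : ℕ} {p : (Fin n → Λ) →ₗ[Λ] M}
    (hp : Function.Surjective p)
    (hq : Module.length R ((Fin n → Λ) ⧸ redSub Λ I (Fin n → Λ)) ≤ q) :
    ∃ a : Fin q → Fin n → Λ, (∀ i, p (a i) ∈ redSub Λ I M) ∧
      ∀ (X : LMod R Λ) (x : Fin n → X), (∀ i, relMap R a X x i = 0) →
        (∀ y ∈ redSub Λ I X, y = 0) →
        ∃ φ : M →ₗ[Λ] X, ∀ j, φ (p (Pi.single j 1)) = x j := by
  classical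
  let D := redSub Λ I (Fin n → Λ)
  let p' : ((Fin n → Λ) ⧸ D) →ₗ[Λ] (M ⧸ redSub Λ I M) :=
    Submodule.mapQ _ _ p fun v hv => map_mem_redSub p hv
  have hp' : ∀ v, p' (D.mkQ v) = (redSub Λ I M).mkQ (p v) := fun v => rfl
  have hM : ∀ y, (redSub Λ I M).mkQ y = 0 ↔ y ∈ redSub Λ I M :=
    fun y => Submodule.Quotient.mk_eq_zero _
  obtain ⟨s, hs⟩ : ∃ s : (Fin q → Λ) →ₗ[Λ] LinearMap.ker p', Function.Surjective s :=
    exists_surjective_of_length_le (R := R) (Λ := Λ) (n := q)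
    ⟨LinearMap.ker p'⟩ (le_trans (Module.length_le_of_injective
      ((LinearMap.ker p').subtype.restrictScalars R) (Submodule.subtype_injective _)) hq)
  have hlift : ∀ i, ∃ v, D.mkQ v = (s (Pi.single i 1)).1 := fun i => D.mkQ_surjective _
  choose a ha using hlift
  refine ⟨a, fun i => ?_, fun X x hx hX => ?_⟩
  · rw [← hM, ← hp', ha]
    exact (s (Pi.single i 1)).2
  · let Φ : (Fin n → Λ) →ₗ[Λ] X := Fintype.linearCombination Λ x
    have hΦ : ∀ v, Φ v = ∑ j, v j • x j := fun v => Fintype.linearCombination_apply Λ x v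
    have hΦD : ∀ v ∈ D, Φ v = 0 := fun v hv => hX _ (map_mem_redSub Φ hv)
    obtain ⟨φ, hφ⟩ := exists_comp_eq_of_surjective hp (f := Φ) fun v hv => by
      obtain ⟨c, hc⟩ := hs ⟨D.mkQ v, by rw [LinearMap.mem_ker, hp', hv, map_zero]⟩
      have h1 : D.mkQ v = D.mkQ (∑ i, c i • a i) := by
        have h2 : (s c).1 = D.mkQ v := congrArg Subtype.val hc
        have hc' : c = ∑ i, c i • Pi.single i (1 : Λ) := by
          ext i
          simp [Finset.sum_apply, Pi.single_apply]
        rw [map_sum]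
        simp only [map_smul, ha]
        refine h2.symm.trans ?_
        conv_lhs => rw [hc', map_sum]
        simp only [map_smul]
        exact Submodule.coe_sum _ _ _
      have h2 : v - ∑ i, c i • a i ∈ D := by
        rw [← Submodule.Quotient.mk_eq_zero, Submodule.Quotient.mk_sub]
        exact sub_eq_zero.mpr h1
      have h3 := hΦD _ h2
      rw [map_sub, map_sum, sub_eq_zero] at h3
      rw [h3]
      refine Finset.sum_eq_zero fun i _ => ?_
      rw [map_smul, hΦ, ← relMap_apply (R := R), hx, smul_zero]
    refine ⟨φ, fun j => ?_⟩
    rw [show φ (p (Pi.single j 1)) = Φ (Pi.single j 1) from LinearMap.congr_fun hφ _, hΦ,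
      Finset.sum_eq_single j] <;> simp +contextual

variable [IsAdicComplete (maximalIdeal R) R]

theorem bijective_of_sub_mem [Module.Finite R M] {ψ : Module.End Λ M}
    (h : ∀ x, ψ x - x ∈ (maximalIdeal R • ⊤ : Submodule R M)) : Function.Bijective ψ := by
  have : IsNoetherian Λ M := isNoetherian_of_tower R inferInstance
  refine IsNoetherian.bijective_of_surjective_endomorphism _ fun z => ?_
  have h2 : (⊤ : Submodule R M) ≤ LinearMap.range (ψ.restrictScalars R) := by
    refine Submodule.le_of_le_smul_of_le_jacobson_bot (I := maximalIdeal R)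
      (IsNoetherian.noetherian _) (maximalIdeal_le_jacobson _) fun z _ => ?_
    rw [show z = ψ z + -(ψ z - z) by abel]
    exact Submodule.add_mem_sup ⟨_, rfl⟩ (neg_mem (h z))
  exact h2 (x := z) trivial

end AlmostSplitTarget

section RightAlmostSplit

variable {R : Type u} [CommRing R] [IsLocalRing R] [IsNoetherianRing R]
  [IsAdicComplete (maximalIdeal R) R]
  {Λ : Type u} [Ring Λ] [Algebra R Λ] [Module.Finite R Λ]
  {ω : Type u} [AddCommGroup ω] [Module R ω] {xs : List R}
  {M : Type u} [AddCommGroup M] [Module Λ M] [Module R M] [IsScalarTower R Λ M]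

/-- A functional on `(M / 𝔞 M) ^ n` which detects the identity of the indecomposable module `M`
and vanishes on the maps that lift to non-automorphisms modulo `I`. -/
theorem exists_detecting_functional [Module.Finite R M] (hM : IsIndecomposable Λ M)
    {E : Type u} [AddCommGroup E] [Module R E] (hE : IsResidueEnvelope R E) {J I : Ideal R}
    (hJI : J ≤ I) (hI : I ≤ maximalIdeal R) {n : ℕ} {p : (Fin n → Λ) →ₗ[Λ] M}
    (hp : Function.Surjective p) :
    ∃ θ : (Fin n → M ⧸ redSub Λ J M) →ₗ[R] E,
      θ (fun j => (redSub Λ J M).mkQ (p (Pi.single j 1))) ≠ 0 ∧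
      ∀ (φ : M →ₗ[Λ] M ⧸ redSub Λ J M) (ψ : Module.End Λ M), ¬ Function.Bijective ψ →
        (∀ x z, (redSub Λ J M).mkQ z = φ x → ψ x - z ∈ redSub Λ I M) →
        θ (fun j => φ (p (Pi.single j 1))) = 0 := by
  classical
  let π : M →ₗ[Λ] M ⧸ redSub Λ J M := (redSub Λ J M).mkQ
  have hπ : Function.Surjective π := (redSub Λ J M).mkQ_surjective
  have hπ0 : ∀ z, π z = 0 → z ∈ redSub Λ I M := fun z hz =>
    redSub_mono hJI ((Submodule.Quotient.mk_eq_zero _).mp hz)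
  have hπR : ∀ (r : R) z, π (r • z) = r • π z := fun r z => by
    rw [← algebraMap_smul Λ r z, map_smul, algebraMap_smul]
  have hR : ∀ (r : R) (z : M), z ∈ redSub Λ I M → r • z ∈ redSub Λ I M := fun r z hz => by
    rw [← algebraMap_smul Λ r z]
    exact Submodule.smul_mem _ _ hz
  have := hM.1
  let U : Submodule R (Fin n → M ⧸ redSub Λ J M) :=
    { carrier := {u | ∃ (φ : M →ₗ[Λ] M ⧸ redSub Λ J M) (ψ : Module.End Λ M),
        ¬ Function.Bijective ψ ∧ (∀ j, u j = φ (p (Pi.single j 1))) ∧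
        ∀ x z, π z = φ x → ψ x - z ∈ redSub Λ I M}
      add_mem' := by
        rintro u v ⟨φ, ψ, h1, h2, h3⟩ ⟨φ', ψ', h1', h2', h3'⟩
        refine ⟨φ + φ', ψ + ψ', fun hb => ?_, fun j => ?_, fun x z hz => ?_⟩
        · exact (hM.bijective_or_of_add R hb).elim h1 h1'
        · rw [Pi.add_apply, h2, h2', LinearMap.add_apply]
        · obtain ⟨z', hz'⟩ := hπ (φ x)
          have h4 := h3 x z' hz'
          have h5 := h3' x (z - z') (by rw [map_sub, hz, hz', LinearMap.add_apply, add_sub_cancel_left])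
          rw [LinearMap.add_apply, show ψ x + ψ' x - z = (ψ x - z') + (ψ' x - (z - z')) by abel]
          exact add_mem h4 h5
      zero_mem' := by
        refine ⟨0, 0, fun hb => ?_, fun j => rfl, fun x z hz => ?_⟩
        · obtain ⟨y, hy⟩ := exists_ne (0 : M)
          exact hy (hb.1 rfl)
        · rw [LinearMap.zero_apply, zero_sub]
          exact neg_mem (hπ0 z hz)
      smul_mem' := by
        rintro r u ⟨φ, ψ, h1, h2, h3⟩
        refine ⟨r • φ, r • ψ, fun hb => h1 ⟨fun x y hxy => hb.1 ?_, fun y => ?_⟩, fun j => ?_,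
          fun x z hz => ?_⟩
        · rw [LinearMap.smul_apply, LinearMap.smul_apply, hxy]
        · obtain ⟨x, hx⟩ := hb.2 y
          refine ⟨algebraMap R Λ r • x, ?_⟩
          rw [map_smul, algebraMap_smul, ← hx, LinearMap.smul_apply]
        · rw [Pi.smul_apply, h2, LinearMap.smul_apply]
        · obtain ⟨z', hz'⟩ := hπ (φ x)
          have h4 := hR r _ (h3 x z' hz')
          have h5 := hπ0 (z - r • z') (by
            rw [map_sub, hπR, hz, hz', LinearMap.smul_apply, sub_self])
          rw [LinearMap.smul_apply, show r • ψ x - z = r • (ψ x - z') - (z - r • z') by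
            rw [smul_sub]; abel]
          exact sub_mem h4 h5 }
  obtain ⟨θ, hθ, hθ0⟩ := hE.exists_ne_zero (U := U) (n := fun j => π (p (Pi.single j 1))) (by
    rintro ⟨φ, ψ, h1, h2, h3⟩
    have h4 : π ∘ₗ p = φ ∘ₗ p := LinearMap.pi_ext' fun j => LinearMap.ext_ring (h2 j)
    have h5 : π = φ := (LinearMap.cancel_right hp).mp h4
    refine h1 (bijective_of_sub_mem (R := R) fun x => ?_)
    exact Submodule.smul_mono_left hI (mem_redSub.mp (h3 x x (by rw [h5]))))
  exact ⟨θ, hθ0, fun φ ψ h1 h3 => hθ _ ⟨φ, ψ, h1, fun j => rfl, h3⟩⟩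

/-- Right almost split maps in the category of lattices. -/
structure IsRightAlmostSplit (R : Type u) [CommRing R] [IsLocalRing R] (Λ : Type u) [Ring Λ]
    [Algebra R Λ] (ω : Type u) [AddCommGroup ω] [Module R ω] (xs : List R) {L M : Type u}
    [AddCommGroup L] [Module Λ L] [AddCommGroup M] [Module Λ M] (r : L →ₗ[Λ] M) : Prop where
  not_split : ∀ s : M →ₗ[Λ] L, r ∘ₗ s ≠ LinearMap.id
  lift : ∀ X : LMod R Λ, IsLat0 R Λ ω xs X → ∀ f : X →ₗ[Λ] M,
    (∀ s : M →ₗ[Λ] X, f ∘ₗ s ≠ LinearMap.id) → ∃ k : X →ₗ[Λ] L, r ∘ₗ k = f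

variable {ι : Type u} {Sfam : ι → Type u}
  [∀ i, AddCommGroup (Sfam i)] [∀ i, Module Λ (Sfam i)]
  {G : Type u} [AddCommGroup G] [Module Λ G] [Module R G] [IsScalarTower R Λ G]
  {α : G →ₗ[Λ] ∀ i, Sfam i}

theorem bijective_of_comp_ne {X : Type u} [AddCommGroup X] [Module Λ X] {f : X →ₗ[Λ] M}
    (hf : ∀ s : M →ₗ[Λ] X, f ∘ₗ s ≠ LinearMap.id) (k : M →ₗ[Λ] X) :
    ¬ Function.Bijective (f ∘ₗ k) := fun hb => by
  let e := LinearEquiv.ofBijective (f ∘ₗ k) hb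
  exact hf (k ∘ₗ e.symm.toLinearMap) (LinearMap.ext fun x => e.apply_symm_apply x)

/-- Right almost split maps onto nonprojective indecomposables exist, with uniform bounds. -/
theorem ApproxData.exists_isRightAlmostSplit (h : ApproxData R Λ ω xs Sfam α) (n : ℕ) :
    ∃ m : ℕ, ∀ M : LMod R Λ, IsBdd R Λ ω xs n M → IsIndecomposable Λ M →
      ¬ Module.Projective Λ M → ∃ (L : LMod R Λ) (r : L →ₗ[Λ] M), IsBdd R Λ ω xs m L ∧
        IsRightAlmostSplit R Λ ω xs r := by
  classical
  obtain ⟨E, _, _, hE⟩ := exists_isResidueEnvelope R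
  obtain ⟨c, hc⟩ := h.isLat0.exists_isBdd
  let J : Ideal R := Ideal.ofList (xs.map (· ^ (n + 1)))
  obtain ⟨k, hk⟩ := h.isParam.exists_pow_le (n + 1)
  have hJI : J ≤ Ideal.ofList xs := by
    refine Ideal.span_le.mpr ?_
    rintro _ hy
    obtain ⟨y, hy', rfl⟩ := List.mem_map.mp hy
    exact Ideal.pow_mem_of_mem (Ideal.ofList xs) (Ideal.subset_span hy') _ n.succ_pos
  have hfin : ∀ N : LMod R Λ, Module.Finite R N → ∃ q : ℕ,
      Module.length R (N ⧸ redSub Λ J N) ≤ q := fun N _ =>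
    ⟨_, (ENat.natCast_toNat (length_quotient_redSub_ne_top hk)).ge⟩
  obtain ⟨q, hq⟩ := hfin ⟨Fin n → Λ⟩ inferInstance
  obtain ⟨ℓ, hℓ⟩ := hfin ⟨Fin q → Λ⟩ inferInstance
  refine ⟨ℓ * c + n, fun M hM hi hproj => ?_⟩
  have : Module.Finite Λ M := hM.isLat0.finite
  have : Module.Finite R M := Module.Finite.trans Λ M
  obtain ⟨p, hp⟩ := hM.gen
  obtain ⟨θ, hθ, hθ0⟩ := exists_detecting_functional hi hE hJI h.isParam.ofList_le hp
  obtain ⟨a, ha, hφ⟩ := exists_relations (I := J) hp hq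
  let g := LinearMap.fst Λ M (CoInd R Λ q E) ∘ₗ (dualExt J a (redSub Λ J M).mkQ θ).subtype
  have hlift : ∀ X : LMod R Λ, IsLat0 R Λ ω xs X → ∀ f : X →ₗ[Λ] M,
      (∀ s : M →ₗ[Λ] X, f ∘ₗ s ≠ LinearMap.id) → ∃ k, g ∘ₗ k = f := by
    intro X hX f hf
    obtain ⟨k, hk⟩ := exists_lift_dualExt (a := a) (π := (redSub Λ J M).mkQ) (θ := θ) hE (f := f) (by
      intro x hx
      have hmk : ∀ y, (redSub Λ J X).mkQ y = 0 ↔ y ∈ redSub Λ J X :=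
        fun y => Submodule.Quotient.mk_eq_zero _
      obtain ⟨φ, hφ⟩ := hφ ⟨X ⧸ redSub Λ J X⟩ (fun j => (redSub Λ J X).mkQ (x j)) (fun i => by
          have h1 := (hmk _).mpr (hx i)
          rw [relMap_apply, map_sum] at h1
          rw [relMap_apply, ← h1]
          exact Finset.sum_congr rfl fun j _ => (map_smul _ _ _).symm) (fun y hy => by
        obtain ⟨z, hz, rfl⟩ := exists_mem_redSub_of_surjective
          (f := (redSub Λ J X).mkQ) (redSub Λ J X).mkQ_surjective hy
        exact (hmk z).mpr hz)
      obtain ⟨ψ, hψ⟩ := exists_lift_of_isWeaklyRegular (R := R) (ys := xs) (a := n)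
        (IsWeaklyRegular.map_pow (n + 1) hX.regular) (hM.mem_stableAnn h.isParam) (π := (redSub Λ J X).mkQ)
        (redSub Λ J X).mkQ_surjective (redSub Λ J X).ker_mkQ φ
      let fbar : (X ⧸ redSub Λ J X) →ₗ[Λ] (M ⧸ redSub Λ J M) :=
        Submodule.mapQ _ _ f fun v hv => map_mem_redSub f hv
      have hfbar : ∀ v, fbar ((redSub Λ J X).mkQ v) = (redSub Λ J M).mkQ (f v) := fun v => rfl
      have h2 := hθ0 (fbar ∘ₗ φ) (f ∘ₗ ψ) (bijective_of_comp_ne hf ψ) (fun y z hz => by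
        obtain ⟨w, hw⟩ := (redSub Λ J X).mkQ_surjective (φ y)
        have h3 := map_mem_redSub f (hψ y w hw)
        have h4 : (redSub Λ J M).mkQ (z - f w) = 0 := by
          rw [map_sub, hz, ← hfbar, hw, LinearMap.comp_apply, sub_self]
        have h5 := redSub_mono hJI ((Submodule.Quotient.mk_eq_zero _).mp h4)
        rw [LinearMap.comp_apply, show f (ψ y) - z = f (ψ y - w) - (z - f w) by
          rw [map_sub]; abel]
        exact sub_mem h3 h5)
      rw [← h2]
      congr 1
      funext j
      rw [LinearMap.comp_apply, hφ, hfbar])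
    exact ⟨k, LinearMap.ext hk⟩
  have hpa : ∀ i, relMap R a M (fun j => p (Pi.single j 1)) i = p (a i) := fun i => by
    rw [relMap_apply]
    conv_rhs => rw [show a i = ∑ j, a i j • Pi.single j (1 : Λ) by
      ext j
      simp [Finset.sum_apply, Pi.single_apply], map_sum]
    exact Finset.sum_congr rfl fun j _ => (map_smul _ _ _).symm
  have hg : Function.Surjective g := fun y => by
    obtain ⟨k, hk⟩ := hlift ⟨Λ⟩ h.isLat0_ring (LinearMap.toSpanSingleton Λ M y) fun s hs =>
      hproj (Module.Projective.of_split s _ hs)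
    refine ⟨k 1, ?_⟩
    have := LinearMap.congr_fun hk 1
    rwa [LinearMap.toSpanSingleton_apply, one_smul] at this
  obtain ⟨L, r, hL, hr⟩ := h.exists_precover_of_length_le hc hM ℓ
    ⟨dualExt J a (redSub Λ J M).mkQ θ⟩ hg ((length_ker_dualExt_le hE J a _ θ).trans hℓ)
  refine ⟨L, g ∘ₗ r, hL, fun s hs => hθ ?_, fun X hX f hf => ?_⟩
  · refine eq_zero_of_section (a := a) (s := r ∘ₗ s) (fun x => LinearMap.congr_fun hs x) fun i => ?_
    rw [hpa]
    exact ha i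
  · obtain ⟨k, hk⟩ := hlift X hX f hf
    obtain ⟨k', hk'⟩ := hr X hX k
    exact ⟨k', by rw [LinearMap.comp_assoc, hk', hk]⟩

end RightAlmostSplit

section RightAlmostSplitProjective

variable {R : Type u} [CommRing R] [IsLocalRing R] [IsNoetherianRing R]
  [IsAdicComplete (maximalIdeal R) R]
  {Λ : Type u} [Ring Λ] [Algebra R Λ] [Module.Finite R Λ]
  {ω : Type u} [AddCommGroup ω] [Module R ω] {xs : List R}
  {ι : Type u} {Sfam : ι → Type u}
  [∀ i, AddCommGroup (Sfam i)] [∀ i, Module Λ (Sfam i)]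
  {G : Type u} [AddCommGroup G] [Module Λ G] [Module R G] [IsScalarTower R Λ G]
  {α : G →ₗ[Λ] ∀ i, Sfam i}

theorem ApproxData.exists_isRightAlmostSplit_of_projective (h : ApproxData R Λ ω xs Sfam α)
    (X : LMod R Λ) (hX : IsLat0 R Λ ω xs X) (hi : IsIndecomposable Λ X)
    [Module.Projective Λ X] :
    ∃ (L : LMod R Λ) (r : L →ₗ[Λ] X), IsLat0 R Λ ω xs L ∧ IsRightAlmostSplit R Λ ω xs r := by
  classical
  have := hi.1
  have : Module.Finite Λ X := hX.finite
  have : Module.Finite R X := Module.Finite.trans Λ X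
  have : IsNoetherianRing Λ := IsNoetherianRing.of_finite R Λ
  obtain ⟨C, hC, -⟩ := (eq_top_or_exists_le_coatom (⊥ : Submodule Λ X)).resolve_left bot_ne_top
  have hs : IsSimpleModule Λ (X ⧸ C) := isSimpleModule_iff_isCoatom.mpr hC
  obtain ⟨i, ⟨e⟩⟩ := h.exists_equiv (X ⧸ C) hs
  let ρ : X →ₗ[Λ] Sfam i := e.toLinearMap ∘ₗ C.mkQ
  have hρ : Function.Surjective ρ := e.surjective.comp C.mkQ_surjective
  have hρC : ∀ x, ρ x = 0 ↔ x ∈ C := fun x =>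
    (map_eq_zero_iff e e.injective).trans (Submodule.Quotient.mk_eq_zero C)
  let s : Sfam i →ₗ[Λ] ∀ i, Sfam i := LinearMap.single Λ Sfam i
  have hs_i : ∀ y, s y i = y := fun y => Pi.single_eq_same i y
  obtain ⟨β, hβ⟩ := h.exists_lift X hX (s ∘ₗ ρ)
  obtain ⟨δ, hδ⟩ := h.exists_lift G h.isLat0 (α - s ∘ₗ LinearMap.proj i ∘ₗ α)
  obtain ⟨I, π, hI, hπ, hπ'⟩ := h.exists_precover
  have hβ' : ∀ x, α (β x) = s (ρ x) := LinearMap.congr_fun hβ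
  have hδ' : ∀ x, α (δ x) = α x - s (α x i) := LinearMap.congr_fun hδ
  let g : (X × (G × I)) →ₗ[Λ] G :=
    β.coprod (δ.coprod ((LinearMap.ker α).subtype ∘ₗ π))
  have hg' : ∀ z, g z = β z.1 + (δ z.2.1 + (π z.2.2).1) := fun z => rfl
  have hg : Function.Surjective g := fun y => by
    obtain ⟨x, hx⟩ := hρ (α y i)
    obtain ⟨w, hw⟩ := hπ ⟨y - β x - δ y, by
      rw [LinearMap.mem_ker, map_sub, map_sub, hβ', hδ', hx]; abel⟩
    refine ⟨(x, (y, w)), ?_⟩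
    rw [hg']
    change β x + (δ y + (π w).1) = y
    rw [hw]
    change β x + (δ y + (y - β x - δ y)) = y
    abel
  have hK : IsLat0 R Λ ω xs (LinearMap.ker g) := (hX.prod (h.isLat0.prod hI)).ker hg h.isLat0
  have hmem : ∀ z, g z = 0 → z.1 ∈ C := fun z hz => by
    rw [← hρC]
    have h1 := congrFun (congrArg α hz) i
    rw [hg', map_add, map_add, hβ', hδ', (π z.2.2).2, add_zero, map_zero, Pi.add_apply,
      Pi.sub_apply, hs_i, hs_i, sub_self, add_zero] at h1
    exact h1
  refine ⟨⟨LinearMap.ker g⟩, LinearMap.fst Λ X (G × I) ∘ₗ (LinearMap.ker g).subtype, hK,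
    fun t ht => hC.1 (eq_top_iff.mpr fun x _ => ?_), fun Z hZ f hf => ?_⟩
  · have h1 := hmem (t x).1 (t x).2
    rwa [show (t x).1.1 = x from LinearMap.congr_fun ht x] at h1
  · have hfC : ∀ z, f z ∈ C := by
      by_contra! hcon
      obtain ⟨z, hz⟩ := hcon
      have h1 : LinearMap.range f ⊔ C = ⊤ := by
        refine hC.2 _ (lt_of_le_of_ne le_sup_right fun heq => hz ?_)
        rw [heq]
        exact Submodule.mem_sup_left ⟨z, rfl⟩
      have h2 := (eq_top_or_eq_top_of_sup_eq_top R hi h1).resolve_right hC.1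
      obtain ⟨t, ht⟩ := Module.projective_lifting_property f LinearMap.id
        (LinearMap.range_eq_top.mp h2)
      exact hf t ht
    obtain ⟨k, hk⟩ : ∃ k : Z →ₗ[Λ] LinearMap.ker α, ∀ z, (k z).1 = β (f z) :=
      ⟨(β ∘ₗ f).codRestrict _ fun z => by
        rw [LinearMap.mem_ker, LinearMap.comp_apply, hβ', (hρC _).mpr (hfC z), map_zero],
        fun z => rfl⟩
    obtain ⟨k', hk'⟩ := hπ' Z hZ k
    refine ⟨(f.prod ((0 : Z →ₗ[Λ] G).prod (-k'))).codRestrict _ fun z => ?_, LinearMap.ext fun z => rfl⟩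
    rw [LinearMap.mem_ker, hg']
    change β (f z) + (δ 0 + (π (-(k' z))).1) = 0
    rw [map_zero, map_neg, show π (k' z) = k z from LinearMap.congr_fun hk' z, ← hk]
    simp

end RightAlmostSplitProjective

section AlmostSplitSequences

variable {R : Type u} [CommRing R] [IsLocalRing R] [IsNoetherianRing R]
  [IsAdicComplete (maximalIdeal R) R]
  {Λ : Type u} [Ring Λ] [Algebra R Λ] [Module.Finite R Λ]
  {ω : Type u} [AddCommGroup ω] [Module R ω] {xs : List R}

/-- Minimal right almost split maps from a lattice. -/
structure IsMinimalRightAlmostSplit (R : Type u) [CommRing R] [IsLocalRing R] (Λ : Type u)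
    [Ring Λ] [Algebra R Λ] (ω : Type u) [AddCommGroup ω] [Module R ω] (xs : List R)
    {L M : Type u} [AddCommGroup L] [Module Λ L] [Module R L] [IsScalarTower R Λ L]
    [AddCommGroup M] [Module Λ M] (r : L →ₗ[Λ] M) : Prop
    extends IsRightAlmostSplit R Λ ω xs r where
  isLat0 : IsLat0 R Λ ω xs L
  minimal : ∀ φ : Module.End Λ L, r ∘ₗ φ = r → Function.Bijective φ

theorem IsRightAlmostSplit.exists_minimal {m : ℕ} {M L : LMod R Λ} {r : L →ₗ[Λ] M}
    (hr : IsRightAlmostSplit R Λ ω xs r) (hL : IsBdd R Λ ω xs m L) (hM : Module.Finite R M) :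
    ∃ (L' : LMod R Λ) (r' : L' →ₗ[Λ] M), IsBdd R Λ ω xs m L' ∧
      IsMinimalRightAlmostSplit R Λ ω xs r' := by
  induction hn : topLength R L using Nat.strong_induction_on generalizing L with
  | _ n ih =>
    have : Module.Finite Λ L := hL.isLat0.finite
    have : Module.Finite R L := Module.Finite.trans Λ L
    by_cases hmin : ∀ φ : Module.End Λ L, r ∘ₗ φ = r → Function.Bijective φ
    · exact ⟨L, r, hL, hr, hL.isLat0, hmin⟩
    push Not at hmin
    obtain ⟨φ, hφ, hb⟩ := hmin
    obtain ⟨A, i, p, hpi, hi, hrp⟩ := exists_proper_retract (R := R) hφ hb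
    refine ih _ (hn ▸ topLength_lt hpi hi) (L := A) (r := r ∘ₗ i) ⟨fun s hs => ?_, fun X hX f hf => ?_⟩
      (hL.of_retract hpi) rfl
    · exact hr.not_split (i ∘ₗ s) hs
    · obtain ⟨k, hk⟩ := hr.lift X hX f hf
      exact ⟨p ∘ₗ k, by rw [← LinearMap.comp_assoc, hrp, hk]⟩

variable {L M : Type u} [AddCommGroup L] [Module Λ L] [Module R L] [IsScalarTower R Λ L]
  [AddCommGroup M] [Module Λ M] [Module R M] [IsScalarTower R Λ M] {r : L →ₗ[Λ] M}

theorem IsRightAlmostSplit.surjective (hr : IsRightAlmostSplit R Λ ω xs r)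
    (hΛ : IsLat0 R Λ ω xs Λ) (hM : ¬ Module.Projective Λ M) : Function.Surjective r := fun y => by
  obtain ⟨k, hk⟩ := hr.lift ⟨Λ⟩ hΛ (LinearMap.toSpanSingleton Λ M y) fun s hs =>
    hM (Module.Projective.of_split s _ hs)
  refine ⟨k 1, ?_⟩
  have := LinearMap.congr_fun hk 1
  rwa [LinearMap.toSpanSingleton_apply, one_smul] at this

theorem IsRightAlmostSplit.retraction_ne_id (hr : IsRightAlmostSplit R Λ ω xs r)
    (hs : Function.Surjective r) (γ : L →ₗ[Λ] LinearMap.ker r) :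
    γ ∘ₗ (LinearMap.ker r).subtype ≠ LinearMap.id := fun hγ => by
  obtain ⟨s, hs'⟩ := exists_comp_eq_of_surjective hs
    (f := LinearMap.id - (LinearMap.ker r).subtype ∘ₗ γ) fun a ha => by
      have h1 : γ a = ⟨a, ha⟩ := LinearMap.congr_fun hγ ⟨a, ha⟩
      change a - (γ a).1 = 0
      rw [h1, sub_self]
  refine hr.not_split s ((LinearMap.cancel_right hs).mp (LinearMap.ext fun a => ?_))
  have h1 : s (r a) = a - (γ a).1 := LinearMap.congr_fun hs' a
  change r (s (r a)) = r a
  rw [h1, map_sub, (γ a).2, sub_zero]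

/-- The kernel of a minimal right almost split map is left almost split. -/
theorem IsMinimalRightAlmostSplit.exists_extend
    (hr : IsMinimalRightAlmostSplit R Λ ω xs r) (hs : Function.Surjective r)
    (hM : IsLat0 R Λ ω xs M) {Z : Type u} [AddCommGroup Z] [Module Λ Z] [Module R Z]
    [IsScalarTower R Λ Z] (hZ : IsLat0 R Λ ω xs Z) {β : LinearMap.ker r →ₗ[Λ] Z}
    (hβ : ∀ t : Z →ₗ[Λ] LinearMap.ker r, t ∘ₗ β ≠ LinearMap.id) :
    ∃ γ : L →ₗ[Λ] Z, γ ∘ₗ (LinearMap.ker r).subtype = β := by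
  have hex : Function.Exact (LinearMap.ker r).subtype r := LinearMap.exact_subtype_ker_map r
  obtain ⟨E, j, l, q, hjl, hql, hj, hjq, hq⟩ := exists_pushout (R := R)
    (Submodule.subtype_injective (LinearMap.ker r)) hex hs β
  have hjl' : ∀ x : LinearMap.ker r, j (β x) = l x.1 := LinearMap.congr_fun hjl
  have hql' : ∀ x, q (l x) = r x := LinearMap.congr_fun hql
  by_cases hsplit : ∃ s : M →ₗ[Λ] E, q ∘ₗ s = LinearMap.id
  · obtain ⟨s, hs⟩ := hsplit
    obtain ⟨ρ, hρ⟩ := exists_retraction hj hjq hs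
    refine ⟨ρ ∘ₗ l, ?_⟩
    rw [LinearMap.comp_assoc, ← hjl, ← LinearMap.comp_assoc, hρ, LinearMap.id_comp]
  · push Not at hsplit
    obtain ⟨k, hk⟩ := hr.lift E (.of_exact_mid hj hjq hq hZ hM) q hsplit
    have hk' : ∀ x, r (k x) = q x := LinearMap.congr_fun hk
    have hrφ : ∀ x, r (k (l x)) = r x := fun x => by rw [hk', hql']
    let φ := LinearEquiv.ofBijective (k ∘ₗ l) (hr.minimal (k ∘ₗ l) (LinearMap.ext hrφ))
    have hφ : ∀ x, φ x = k (l x) := fun x => rfl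
    have hsymm : ∀ x, r (φ.symm x) = r x := fun x => by
      rw [← hrφ, ← hφ, LinearEquiv.apply_symm_apply]
    refine (hβ ((φ.symm.toLinearMap ∘ₗ k ∘ₗ j).codRestrict _ fun z => ?_) ?_).elim
    · rw [LinearMap.mem_ker]
      change r (φ.symm (k (j z))) = 0
      rw [hsymm, hk', hjq.apply_apply_eq_zero]
    · refine LinearMap.ext fun x => Subtype.ext ?_
      change φ.symm (k (j (β x))) = x.1
      rw [hjl', ← hφ, LinearEquiv.symm_apply_apply]

theorem IsMinimalRightAlmostSplit.isIndecomposable_ker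
    (hr : IsMinimalRightAlmostSplit R Λ ω xs r) (hs : Function.Surjective r)
    (hM : IsLat0 R Λ ω xs M) : IsIndecomposable Λ (LinearMap.ker r) := by
  have : IsNoetherianRing Λ := IsNoetherianRing.of_finite R Λ
  have hK := hr.isLat0.ker hs hM
  refine ⟨?_, fun A B hAB => ?_⟩
  · rw [Submodule.nontrivial_iff_ne_bot]
    intro h0
    let e := LinearEquiv.ofBijective r ⟨LinearMap.ker_eq_bot.mp h0, hs⟩
    exact hr.not_split e.symm.toLinearMap (LinearMap.ext fun x => e.apply_symm_apply x)
  · by_contra! hne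
    have key : ∀ A B : Submodule Λ (LinearMap.ker r), ∀ hAB : IsCompl A B, B ≠ ⊥ →
        ∃ γ : L →ₗ[Λ] A, γ ∘ₗ (LinearMap.ker r).subtype = A.projectionOnto B hAB := by
      intro A B hAB hB
      refine hr.exists_extend hs hM (hK.of_retract (i := A.subtype) (p := A.projectionOnto B hAB)
        (LinearMap.ext fun x => Submodule.projectionOnto_apply_left hAB x)) fun t ht => hB ?_
      rw [eq_bot_iff]
      intro x hx
      have h1 : t (A.projectionOnto B hAB x) = x := LinearMap.congr_fun ht x
      rw [(Submodule.projectionOnto_apply_eq_zero_iff hAB).mpr hx, map_zero] at h1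
      exact h1.symm
    obtain ⟨γ, hγ⟩ := key A B hAB hne.2
    obtain ⟨γ', hγ'⟩ := key B A hAB.symm hne.1
    refine hr.retraction_ne_id hs (A.subtype ∘ₗ γ + B.subtype ∘ₗ γ') (LinearMap.ext fun x => ?_)
    have h1 : γ x.1 = A.projectionOnto B hAB x := LinearMap.congr_fun hγ x
    have h2 : γ' x.1 = B.projectionOnto A hAB.symm x := LinearMap.congr_fun hγ' x
    change ((γ x.1 : A) : LinearMap.ker r) + (γ' x.1 : B) = x
    rw [h1, h2]
    exact Submodule.projection_add_projection_eq_self hAB x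

theorem IsMinimalRightAlmostSplit.bijective_of_comm
    (hr : IsMinimalRightAlmostSplit R Λ ω xs r) (hs : Function.Surjective r)
    (hM : IsLat0 R Λ ω xs M) {φ : Module.End Λ L} (hφ : ∀ x, r x = 0 → φ x = x)
    {w : Module.End Λ M} (hw : w ∘ₗ r = r ∘ₗ φ) : Function.Bijective w := by
  have : Module.Finite Λ M := hM.finite
  have : IsNoetherianRing Λ := IsNoetherianRing.of_finite R Λ
  by_cases hsplit : ∃ s : M →ₗ[Λ] M, w ∘ₗ s = LinearMap.id
  · obtain ⟨s, hs⟩ := hsplit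
    exact IsNoetherian.bijective_of_surjective_endomorphism _ fun x =>
      ⟨s x, LinearMap.congr_fun hs x⟩
  · push Not at hsplit
    obtain ⟨k, hk⟩ := hr.lift ⟨M⟩ hM w hsplit
    have hk' : ∀ x, r (k x) = w x := LinearMap.congr_fun hk
    have hw' : ∀ x, w (r x) = r (φ x) := LinearMap.congr_fun hw
    refine (hr.retraction_ne_id hs ((φ - k ∘ₗ r).codRestrict _ fun x => ?_) ?_).elim
    · rw [LinearMap.mem_ker]
      change r (φ x - k (r x)) = 0
      rw [map_sub, hk', hw', sub_self]
    · refine LinearMap.ext fun x => Subtype.ext ?_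
      change φ x.1 - k (r x.1) = x.1
      rw [x.2, map_zero, sub_zero, hφ _ x.2]

variable {L' M' : Type u} [AddCommGroup L'] [Module Λ L'] [Module R L'] [IsScalarTower R Λ L']
  [AddCommGroup M'] [Module Λ M'] [Module R M'] [IsScalarTower R Λ M'] {r' : L' →ₗ[Λ] M'}

theorem IsMinimalRightAlmostSplit.exists_map_of_equiv_ker
    (hr : IsMinimalRightAlmostSplit R Λ ω xs r) (hs : Function.Surjective r)
    (hM : IsLat0 R Λ ω xs M) (hr' : IsMinimalRightAlmostSplit R Λ ω xs r')
    (hs' : Function.Surjective r') (e : LinearMap.ker r ≃ₗ[Λ] LinearMap.ker r') :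
    ∃ (u : L →ₗ[Λ] L') (v : M →ₗ[Λ] M'), (∀ x : LinearMap.ker r, u x.1 = (e x).1) ∧
      v ∘ₗ r = r' ∘ₗ u := by
  obtain ⟨u, hu⟩ := hr.exists_extend hs hM hr'.isLat0
    (β := (LinearMap.ker r').subtype ∘ₗ e.toLinearMap) fun t ht =>
      hr'.retraction_ne_id hs' (e.toLinearMap ∘ₗ t) (LinearMap.ext fun x => by
        have h1 := LinearMap.congr_fun ht (e.symm x)
        change t (e (e.symm x)).1 = e.symm x at h1
        change e (t x.1) = x
        rw [e.apply_symm_apply] at h1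
        rw [h1, e.apply_symm_apply])
  have hu' : ∀ x : LinearMap.ker r, u x.1 = (e x).1 := LinearMap.congr_fun hu
  obtain ⟨v, hv⟩ := exists_comp_eq_of_surjective hs (f := r' ∘ₗ u) fun a ha => by
    rw [LinearMap.comp_apply, hu' ⟨a, ha⟩]
    exact (e ⟨a, ha⟩).2
  exact ⟨u, v, hu', hv⟩

theorem IsMinimalRightAlmostSplit.nonempty_equiv_of_equiv_ker
    (hr : IsMinimalRightAlmostSplit R Λ ω xs r) (hs : Function.Surjective r)
    (hM : IsLat0 R Λ ω xs M) (hr' : IsMinimalRightAlmostSplit R Λ ω xs r')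
    (hs' : Function.Surjective r') (hM' : IsLat0 R Λ ω xs M')
    (e : LinearMap.ker r ≃ₗ[Λ] LinearMap.ker r') : Nonempty (M ≃ₗ[Λ] M') := by
  obtain ⟨u, v, hu, hv⟩ := hr.exists_map_of_equiv_ker hs hM hr' hs' e
  obtain ⟨u', v', hu', hv'⟩ := hr'.exists_map_of_equiv_ker hs' hM' hr hs e.symm
  have h1 : Function.Bijective (v' ∘ₗ v) := hr.bijective_of_comm hs hM (φ := u' ∘ₗ u)
    (fun x hx => by
      rw [LinearMap.comp_apply, hu ⟨x, hx⟩, hu' (e ⟨x, hx⟩), e.symm_apply_apply])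
    (by rw [LinearMap.comp_assoc, hv, ← LinearMap.comp_assoc, hv', LinearMap.comp_assoc])
  have h2 : Function.Bijective (v ∘ₗ v') := hr'.bijective_of_comm hs' hM' (φ := u ∘ₗ u')
    (fun x hx => by
      rw [LinearMap.comp_apply, hu' ⟨x, hx⟩, hu (e.symm ⟨x, hx⟩), e.apply_symm_apply])
    (by rw [LinearMap.comp_assoc, hv', ← LinearMap.comp_assoc, hv, LinearMap.comp_assoc])
  exact ⟨LinearEquiv.ofBijective v ⟨Function.Injective.of_comp h1.1,
    Function.Surjective.of_comp (g := v') h2.2⟩⟩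

/-- If `X` is an indecomposable direct summand of the middle term of an almost split sequence
ending in `M`, then the left term is a summand of the source of each right almost split map
onto `X`. -/
theorem IsMinimalRightAlmostSplit.exists_retract
    (hr : IsMinimalRightAlmostSplit R Λ ω xs r) (hs : Function.Surjective r)
    (hM : IsLat0 R Λ ω xs M) (hMi : IsIndecomposable Λ M) {X : Type u} [AddCommGroup X]
    [Module Λ X] [Module R X] [IsScalarTower R Λ X] [Module.Finite R X]
    (hX : IsIndecomposable Λ X) {i : X →ₗ[Λ] L}
    {p : L →ₗ[Λ] X} (hpi : p ∘ₗ i = LinearMap.id) (hL' : IsLat0 R Λ ω xs L')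
    {f : L' →ₗ[Λ] X} (hf : IsRightAlmostSplit R Λ ω xs f) :
    ∃ (v : LinearMap.ker r →ₗ[Λ] L') (t : L' →ₗ[Λ] LinearMap.ker r),
      t ∘ₗ v = LinearMap.id := by
  have : IsNoetherianRing Λ := IsNoetherianRing.of_finite R Λ
  have := hX.1
  have hpi' : ∀ x, p (i x) = x := LinearMap.congr_fun hpi
  obtain ⟨v, hv⟩ := hf.lift ⟨LinearMap.ker r⟩ (hr.isLat0.ker hs hM)
    (p ∘ₗ (LinearMap.ker r).subtype) fun s hs => by
      have hs' : ∀ x, p (s x).1 = x := LinearMap.congr_fun hs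
      have hb := hr.minimal (LinearMap.id - (LinearMap.ker r).subtype ∘ₗ s ∘ₗ p)
        (LinearMap.ext fun x => by
          change r (x - (s (p x)).1) = r x
          rw [map_sub, (s (p x)).2, sub_zero])
      obtain ⟨x, hx⟩ := exists_ne (0 : X)
      have h0 : (s x).1 = 0 := hb.1 (by
        rw [map_zero]
        change (s x).1 - (s (p (s x).1)).1 = 0
        rw [hs', sub_self])
      exact hx (by rw [← hs' x, h0, map_zero])
  by_contra! hcon
  obtain ⟨v', hv'⟩ := hr.exists_extend hs hM hL' (hcon v)
  obtain ⟨w, hw⟩ := exists_comp_eq_of_surjective hs (f := p - f ∘ₗ v') fun a ha => by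
    have h1 : f (v ⟨a, ha⟩) = p a := LinearMap.congr_fun hv ⟨a, ha⟩
    have h2 : v' a = v ⟨a, ha⟩ := LinearMap.congr_fun hv' ⟨a, ha⟩
    rw [LinearMap.sub_apply, LinearMap.comp_apply, h2, h1, sub_self]
  have hw' : ∀ a, w (r a) = p a - f (v' a) := LinearMap.congr_fun hw
  have hsum : (f ∘ₗ v' ∘ₗ i : Module.End Λ X) + w ∘ₗ r ∘ₗ i = 1 := LinearMap.ext fun x => by
    change f (v' (i x)) + w (r (i x)) = x
    rw [hw', hpi', add_sub_cancel]
  rcases hX.bijective_or_of_add R (φ := f ∘ₗ v' ∘ₗ i) (ψ := w ∘ₗ r ∘ₗ i)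
    (by rw [hsum]; exact Function.bijective_id) with hb | hb
  · let e := LinearEquiv.ofBijective (f ∘ₗ v' ∘ₗ i) hb
    exact hf.not_split (v' ∘ₗ i ∘ₗ e.symm.toLinearMap)
      (LinearMap.ext fun x => e.apply_symm_apply x)
  · let e := LinearEquiv.ofBijective (w ∘ₗ r ∘ₗ i) hb
    have hb' : Function.Bijective (r ∘ₗ i) := bijective_of_retract hMi
      (p := e.symm.toLinearMap ∘ₗ w) (LinearMap.ext fun x => e.symm_apply_apply x)
    let e' := LinearEquiv.ofBijective (r ∘ₗ i) hb'
    exact hr.not_split (i ∘ₗ e'.symm.toLinearMap) (LinearMap.ext fun x => e'.apply_symm_apply x)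

end AlmostSplitSequences

section HaradaSai

variable {R : Type u} [CommRing R] {Λ : Type u} [Ring Λ] [Algebra R Λ]

/-- Composites of `2 ^ m - 1` nonisomorphisms through indecomposable modules of length at
most `b`. -/
def IsRadicalChain (b : ℕ) : ℕ → ∀ X Y : LMod R Λ, (X →ₗ[Λ] Y) → Prop
  | 0, X, _, _ => Module.length R X ≤ b
  | m + 1, X, W, f => ∃ (Y Z : LMod R Λ) (f₁ : X →ₗ[Λ] Y) (g : Y →ₗ[Λ] Z) (f₂ : Z →ₗ[Λ] W),
      IsRadicalChain b m X Y f₁ ∧ IsRadicalChain b m Z W f₂ ∧ ¬ Function.Bijective g ∧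
      IsIndecomposable Λ Y ∧ IsIndecomposable Λ Z ∧ Module.length R Y ≤ b ∧
      Module.length R Z ≤ b ∧ f = f₂ ∘ₗ g ∘ₗ f₁

variable {X Y W : Type u} [AddCommGroup X] [Module Λ X] [Module R X] [IsScalarTower R Λ X]
  [AddCommGroup Y] [Module Λ Y] [Module R Y] [IsScalarTower R Λ Y]
  [AddCommGroup W] [Module Λ W] [Module R W] [IsScalarTower R Λ W]

variable (R) in
theorem length_range_comp_le_left (f : X →ₗ[Λ] Y) (g : Y →ₗ[Λ] W) :
    Module.length R (LinearMap.range (g ∘ₗ f)) ≤ Module.length R (LinearMap.range g) :=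
  Module.length_le_of_injective
    ((Submodule.inclusion (LinearMap.range_comp_le_range f g)).restrictScalars R)
    (Submodule.inclusion_injective (LinearMap.range_comp_le_range f g))

variable (R) in
theorem length_range_comp_le_right (f : X →ₗ[Λ] Y) (g : Y →ₗ[Λ] W) :
    Module.length R (LinearMap.range (g ∘ₗ f)) ≤ Module.length R (LinearMap.range f) := by
  let k : LinearMap.range f →ₗ[Λ] LinearMap.range (g ∘ₗ f) :=
    (g ∘ₗ (LinearMap.range f).subtype).codRestrict _ fun y => by
      obtain ⟨_, x, rfl⟩ := y
      exact ⟨x, rfl⟩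
  refine Module.length_le_of_surjective (k.restrictScalars R) ?_
  rintro ⟨_, x, rfl⟩
  exact ⟨⟨f x, x, rfl⟩, rfl⟩

variable (R) in
/-- If the image of `h ∘ f` has the lengths of the images of `f` and of `h`, then the middle
module splits as the image of `f` and the kernel of `h`. -/
theorem isCompl_of_length_range_eq (f : X →ₗ[Λ] Y) (h : Y →ₗ[Λ] W)
    (hfin : Module.length R Y ≠ ⊤)
    (h1 : Module.length R (LinearMap.range (h ∘ₗ f)) = Module.length R (LinearMap.range f))
    (h2 : Module.length R (LinearMap.range (h ∘ₗ f)) = Module.length R (LinearMap.range h)) :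
    IsCompl (LinearMap.range f) (LinearMap.ker h) := by
  have hle : ∀ {A : Type u} [AddCommGroup A] [Module Λ A] [Module R A] [IsScalarTower R Λ A]
      (k : A →ₗ[Λ] W) (j : A →ₗ[Λ] Y), h ∘ₗ j = k →
      Module.length R (LinearMap.range k) ≠ ⊤ := fun k j hk => by
    subst hk
    exact ne_top_of_le_ne_top (ne_top_of_le_ne_top hfin (Module.length_le_of_surjective
      (h.rangeRestrict.restrictScalars R) h.surjective_rangeRestrict))
      (length_range_comp_le_left R j h)
  constructor
  · rw [disjoint_iff, eq_bot_iff]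
    rintro _ ⟨⟨x, rfl⟩, hx⟩
    by_contra hne
    let k : LinearMap.range f →ₗ[Λ] LinearMap.range (h ∘ₗ f) :=
      (h ∘ₗ (LinearMap.range f).subtype).codRestrict _ fun y => by
        obtain ⟨_, x, rfl⟩ := y
        exact ⟨x, rfl⟩
    refine (length_lt_of_surjective (k.restrictScalars R) ?_ (fun hinj => hne ?_)
      (hle (h ∘ₗ f) f rfl)).ne h1
    · rintro ⟨_, x, rfl⟩
      exact ⟨⟨f x, x, rfl⟩, rfl⟩
    · have h3 : k ⟨f x, x, rfl⟩ = k 0 := Subtype.ext (by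
        rw [map_zero]
        exact hx)
      exact congrArg Subtype.val (hinj h3)
  · rw [codisjoint_iff, eq_top_iff]
    intro y _
    by_contra hne
    have hlt : LinearMap.range (h ∘ₗ f) < LinearMap.range h := by
      refine lt_of_le_of_ne (LinearMap.range_comp_le_range f h) fun heq => hne ?_
      obtain ⟨x, hx⟩ : h y ∈ LinearMap.range (h ∘ₗ f) := heq ▸ ⟨y, rfl⟩
      rw [show y = f x + (y - f x) by abel]
      refine Submodule.add_mem_sup ⟨x, rfl⟩ ?_
      rw [LinearMap.mem_ker, map_sub, ← hx, LinearMap.comp_apply, sub_self]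
    let S : Submodule R (LinearMap.range h) := LinearMap.range
      ((Submodule.inclusion hlt.le).restrictScalars R)
    have hS : S < ⊤ := by
      refine lt_top_iff_ne_top.mpr fun hS => hlt.not_ge fun w hw => ?_
      obtain ⟨v, hv⟩ : (⟨w, hw⟩ : LinearMap.range h) ∈ S := hS ▸ trivial
      have hvw : v.1 = w := congrArg Subtype.val hv
      exact hvw ▸ v.2
    have h3 : Module.length R (LinearMap.range h) ≠ ⊤ := hle h LinearMap.id rfl
    obtain ⟨_, _⟩ := isFiniteLength_iff_isNoetherian_isArtinian.mp
      (Module.length_ne_top_iff.mp h3)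
    have h4 := Submodule.length_lt (R := R) hS.ne
    refine h4.ne ?_
    rw [← h2]
    exact (LinearEquiv.ofInjective ((Submodule.inclusion hlt.le).restrictScalars R)
      (Submodule.inclusion_injective hlt.le)).length_eq.symm

/-- The Harada–Sai lemma. -/
theorem IsRadicalChain.length_range_le {b m : ℕ} {X W : LMod R Λ} {f : X →ₗ[Λ] W}
    (hf : IsRadicalChain b m X W f) :
    Module.length R (LinearMap.range f) + m ≤ b ∨ Module.length R (LinearMap.range f) = 0 := by
  induction m generalizing X W with
  | zero =>
    left
    rw [Nat.cast_zero, add_zero]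
    exact (Module.length_le_of_surjective (f.rangeRestrict.restrictScalars R)
      f.surjective_rangeRestrict).trans hf
  | succ m ih =>
    obtain ⟨Y, Z, f₁, g, f₂, h1, h2, hg, hY, hZ, hYb, hZb, rfl⟩ := hf
    have hYt : Module.length R Y ≠ ⊤ := ne_top_of_le_ne_top (ENat.natCast_ne_top _) hYb
    have hZt : Module.length R Z ≠ ⊤ := ne_top_of_le_ne_top (ENat.natCast_ne_top _) hZb
    have e1 := ih h1
    have e2 := ih h2
    have l1 := length_range_comp_le_right R f₁ (f₂ ∘ₗ g)
    have l2 := length_range_comp_le_left R f₁ (f₂ ∘ₗ g)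
    have l3 := length_range_comp_le_left R g f₂
    have l4 := length_range_comp_le_right R (g ∘ₗ f₁) f₂
    have l5 := length_range_comp_le_right R f₁ g
    rw [LinearMap.comp_assoc] at l1 l2
    by_contra! hcon
    obtain ⟨hc1, hc2⟩ := hcon
    have hne : ∀ {S : Submodule Λ W}, Module.length R S ≠ 0 → S ≠ ⊥ := by
      rintro S hS rfl
      exact hS (Module.length_eq_zero_iff.mpr inferInstance)
    have hne1 : LinearMap.range (f₂ ∘ₗ g ∘ₗ f₁) ≠ ⊥ := hne hc2
    have hne2 : f₂ ∘ₗ g ∘ₗ f₁ ≠ 0 := fun h0 => hne1 (LinearMap.range_eq_bot.mpr h0)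
    have key : Module.length R (LinearMap.range (f₂ ∘ₗ g ∘ₗ f₁)) =
        Module.length R (LinearMap.range f₁) ∧
        Module.length R (LinearMap.range (f₂ ∘ₗ g ∘ₗ f₁)) =
        Module.length R (LinearMap.range f₂) := by
      generalize Module.length R (LinearMap.range (f₂ ∘ₗ g ∘ₗ f₁)) = a at *
      generalize Module.length R (LinearMap.range f₁) = a₁ at *
      generalize Module.length R (LinearMap.range f₂) = a₂ at *
      generalize Module.length R (LinearMap.range (f₂ ∘ₗ g)) = a₃ at *
      clear l4 l5
      have h12 := l1
      have h22 := l2.trans l3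
      clear l1 l2 l3
      have e1' := e1.resolve_right (by rintro rfl; exact hc2 (nonpos_iff_eq_zero.mp h12))
      have e2' := e2.resolve_right (by rintro rfl; exact hc2 (nonpos_iff_eq_zero.mp h22))
      cases a₁ with
      | top => simp at e1'
      | coe a₁ =>
        cases a₂ with
        | top => simp at e2'
        | coe a₂ =>
          cases a with
          | top => simp at h12
          | coe a =>
            norm_cast at *
            lia
    have c1 : IsCompl (LinearMap.range f₁) (LinearMap.ker (f₂ ∘ₗ g)) :=
      isCompl_of_length_range_eq R f₁ (f₂ ∘ₗ g) hYt (by rw [LinearMap.comp_assoc]; exact key.1)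
        (by
          rw [LinearMap.comp_assoc]
          exact le_antisymm l2 (l3.trans key.2.ge))
    have c2 : IsCompl (LinearMap.range (g ∘ₗ f₁)) (LinearMap.ker f₂) :=
      isCompl_of_length_range_eq R (g ∘ₗ f₁) f₂ hZt
        (le_antisymm l4 (l5.trans key.1.ge)) key.2
    have k1 : LinearMap.ker (f₂ ∘ₗ g) = ⊥ := (hY.2 _ _ c1).resolve_left fun h0 => hne2 (by
      rw [LinearMap.range_eq_bot.mp h0, LinearMap.comp_zero, LinearMap.comp_zero])
    have k2 : LinearMap.ker f₂ = ⊥ := (hZ.2 _ _ c2).resolve_left fun h0 => hne2 (by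
      rw [LinearMap.range_eq_bot.mp h0, LinearMap.comp_zero])
    refine hg ⟨?_, ?_⟩
    · exact Function.Injective.of_comp (f := f₂) (LinearMap.ker_eq_bot.mp k1)
    · have h3 : LinearMap.range (g ∘ₗ f₁) = ⊤ := by
        have := c2.sup_eq_top
        rwa [k2, sup_bot_eq] at this
      exact Function.Surjective.of_comp (g := f₁) (LinearMap.range_eq_top.mp h3)

end HaradaSai

section Reduction

variable {R : Type u} [CommRing R] {Λ : Type u} [Ring Λ] [Algebra R Λ]

/-- The reduction of a module modulo an ideal of `R`. -/
abbrev LMod.red (J : Ideal R) (X : LMod R Λ) : LMod R Λ := ⟨X ⧸ redSub Λ J X⟩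

/-- The reduction of a homomorphism modulo an ideal of `R`. -/
def redMap (J : Ideal R) {X Y : LMod R Λ} (f : X →ₗ[Λ] Y) : X.red J →ₗ[Λ] Y.red J :=
  Submodule.mapQ _ _ f fun _ hv => map_mem_redSub f hv

theorem mkQ_redSub_eq_zero {J : Ideal R} {X : LMod R Λ} {x : X} :
    (redSub Λ J X).mkQ x = 0 ↔ x ∈ redSub Λ J X := Submodule.Quotient.mk_eq_zero _

theorem redMap_comp (J : Ideal R) {X Y Z : LMod R Λ} (g : Y →ₗ[Λ] Z) (f : X →ₗ[Λ] Y) :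
    redMap J (g ∘ₗ f) = redMap J g ∘ₗ redMap J f :=
  LinearMap.ext fun z => by
    obtain ⟨x, rfl⟩ := (redSub Λ J X).mkQ_surjective z
    rfl

variable [IsLocalRing R] [IsNoetherianRing R] [Module.Finite R Λ]

theorem surjective_of_sub_mem {X Y : Type u} [AddCommGroup X] [Module Λ X] [Module R X]
    [IsScalarTower R Λ X] [AddCommGroup Y] [Module Λ Y] [Module R Y] [IsScalarTower R Λ Y]
    [Module.Finite R Y] {f : X →ₗ[Λ] Y}
    (h : ∀ y, ∃ x, y - f x ∈ (maximalIdeal R • ⊤ : Submodule R Y)) : Function.Surjective f := by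
  intro z
  have h2 : (⊤ : Submodule R Y) ≤ LinearMap.range (f.restrictScalars R) := by
    refine Submodule.le_of_le_smul_of_le_jacobson_bot (I := maximalIdeal R)
      (IsNoetherian.noetherian _) (maximalIdeal_le_jacobson _) fun z _ => ?_
    obtain ⟨x, hx⟩ := h z
    rw [show z = f x + (z - f x) by abel]
    exact Submodule.add_mem_sup ⟨_, rfl⟩ hx
  exact h2 (x := z) trivial

variable {ω : Type u} [AddCommGroup ω] [Module R ω] {xs : List R} {n : ℕ}

/-- The ideal generated by the `n`-th powers of the elements of `xs`. -/
abbrev powIdeal (xs : List R) (n : ℕ) : Ideal R := Ideal.ofList (xs.map (· ^ n))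

theorem powIdeal_succ_le (xs : List R) (n : ℕ) : powIdeal xs (n + 1) ≤ Ideal.ofList xs := by
  refine Ideal.span_le.mpr ?_
  rintro _ hy
  obtain ⟨y, hy', rfl⟩ := List.mem_map.mp hy
  exact Ideal.pow_mem_of_mem (Ideal.ofList xs) (Ideal.subset_span hy') _ n.succ_pos

theorem IsBdd.exists_lift_red (h : IsParam R xs) {X Y : LMod R Λ} (hX : IsBdd R Λ ω xs n X)
    (hY : IsLat0 R Λ ω xs Y) (φ : X →ₗ[Λ] Y.red (powIdeal xs (n + 1))) :
    ∃ ψ : X →ₗ[Λ] Y, ∀ x z, (redSub Λ (powIdeal xs (n + 1)) Y).mkQ z = φ x →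
      ψ x - z ∈ (maximalIdeal R • ⊤ : Submodule R Y) := by
  obtain ⟨ψ, hψ⟩ := exists_lift_of_isWeaklyRegular (R := R) (ys := xs) (a := n)
    (IsWeaklyRegular.map_pow (n + 1) hY.regular) (hX.mem_stableAnn h)
    (redSub Λ (powIdeal xs (n + 1)) Y).mkQ_surjective (redSub Λ (powIdeal xs (n + 1)) Y).ker_mkQ φ
  exact ⟨ψ, fun x z hz => Submodule.smul_mono_left h.ofList_le (mem_redSub.mp (hψ x z hz))⟩

theorem powIdeal_le (h : IsParam R xs) (n : ℕ) : powIdeal xs (n + 1) ≤ maximalIdeal R :=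
  (powIdeal_succ_le xs n).trans h.ofList_le

theorem nontrivial_red {J : Ideal R} (hJ : J ≤ maximalIdeal R) (X : LMod R Λ) [Nontrivial X]
    [Module.Finite R X] : Nontrivial (X.red J) := by
  by_contra hn
  rw [not_nontrivial_iff_subsingleton] at hn
  obtain ⟨x, hx⟩ := exists_ne (0 : X)
  obtain ⟨y, hy⟩ := surjective_of_sub_mem (f := (0 : X →ₗ[Λ] X)) (R := R) (fun y => ⟨0, by
    rw [map_zero, sub_zero]
    exact Submodule.smul_mono_left hJ (mem_redSub.mp (mkQ_redSub_eq_zero.mp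
      (Subsingleton.elim _ _)))⟩) x
  exact hx hy.symm

theorem mem_of_mkQ_eq {J : Ideal R} (hJ : J ≤ maximalIdeal R) {X : LMod R Λ} {x y : X}
    (h : (redSub Λ J X).mkQ x = (redSub Λ J X).mkQ y) :
    x - y ∈ (maximalIdeal R • ⊤ : Submodule R X) :=
  Submodule.smul_mono_left hJ (mem_redSub.mp (mkQ_redSub_eq_zero.mp (by
    rw [map_sub, h, sub_self])))

variable [IsAdicComplete (maximalIdeal R) R]

theorem IsBdd.isIndecomposable_red (h : IsParam R xs) {X : LMod R Λ} (hX : IsBdd R Λ ω xs n X)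
    (hi : IsIndecomposable Λ X) : IsIndecomposable Λ (X.red (powIdeal xs (n + 1))) := by
  have := hi.1
  have : Module.Finite Λ X := hX.isLat0.finite
  have : Module.Finite R X := Module.Finite.trans Λ X
  have hJ := powIdeal_le h n
  refine ⟨nontrivial_red hJ X, fun A B hAB => ?_⟩
  let mk := (redSub Λ (powIdeal xs (n + 1)) X).mkQ
  have hmk : Function.Surjective mk := (redSub Λ (powIdeal xs (n + 1)) X).mkQ_surjective
  let e := A.projection B hAB
  have heA : ∀ x, e x ∈ A := fun x => Submodule.projection_apply_mem hAB x
  have heB : ∀ x, x - e x ∈ B := fun x => Submodule.sub_projection_mem hAB x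
  obtain ⟨ψ, hψ⟩ := hX.exists_lift_red h hX.isLat0 (e ∘ₗ mk)
  have hsurj : ∀ (e' : Module.End Λ (X.red (powIdeal xs (n + 1)))) (ψ' : Module.End Λ X),
      (∀ x z, mk z = e' (mk x) → ψ' x - z ∈ (maximalIdeal R • ⊤ : Submodule R X)) →
      Function.Bijective ψ' → Function.Surjective e' := by
    intro e' ψ' hψ' hb
    have h1 : Function.Surjective (e' ∘ₗ mk) := surjective_of_sub_mem (R := R) fun y => by
      obtain ⟨z, rfl⟩ := hmk y
      obtain ⟨x, rfl⟩ := hb.2 z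
      obtain ⟨z, hz⟩ := hmk (e' (mk x))
      refine ⟨x, ?_⟩
      have h2 := map_mem_smul_top (maximalIdeal R) mk (hψ' x z hz)
      rwa [map_sub, hz] at h2
    exact Function.Surjective.of_comp h1
  rcases hi.bijective_or_of_add R (φ := ψ) (ψ := 1 - ψ)
    (by rw [add_sub_cancel]; exact Function.bijective_id) with hb | hb
  · right
    have h1 : A = ⊤ := eq_top_iff.mpr fun y _ => by
      obtain ⟨x, rfl⟩ := hsurj e ψ hψ hb y
      exact heA x
    have := hAB.inf_eq_bot
    rwa [h1, top_inf_eq] at this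
  · left
    have h1 : B = ⊤ := eq_top_iff.mpr fun y _ => by
      obtain ⟨x, rfl⟩ := hsurj (1 - e) (1 - ψ) (fun x z hz => by
        have h2 := hψ x (x - z) (by
          rw [map_sub, hz]
          change mk x - (mk x - e (mk x)) = e (mk x)
          abel)
        rw [show (1 - ψ) x - z = -(ψ x - (x - z)) by
          change x - ψ x - z = _
          abel]
        exact neg_mem h2) hb y
      exact heB x
    have := hAB.inf_eq_bot
    rwa [h1, inf_top_eq] at this

theorem IsBdd.bijective_of_redMap (h : IsParam R xs) {X Y : LMod R Λ}
    (hX : IsLat0 R Λ ω xs X) (hY : IsBdd R Λ ω xs n Y) {g : X →ₗ[Λ] Y}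
    (hg : Function.Bijective (redMap (powIdeal xs (n + 1)) g)) : Function.Bijective g := by
  have : Module.Finite Λ Y := hY.isLat0.finite
  have : Module.Finite R Y := Module.Finite.trans Λ Y
  have : Module.Finite Λ X := hX.finite
  have : Module.Finite R X := Module.Finite.trans Λ X
  have hJ := powIdeal_le h n
  let e := LinearEquiv.ofBijective _ hg
  have he : ∀ x, e ((redSub Λ (powIdeal xs (n + 1)) X).mkQ x) =
    (redSub Λ (powIdeal xs (n + 1)) Y).mkQ (g x) := fun x => rfl
  obtain ⟨ψ, hψ⟩ := hY.exists_lift_red h hX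
    (e.symm.toLinearMap ∘ₗ (redSub Λ (powIdeal xs (n + 1)) Y).mkQ)
  have h1 : Function.Bijective (ψ ∘ₗ g) := bijective_of_sub_mem (R := R) fun x =>
    hψ (g x) x (by
      change _ = e.symm _
      rw [← he, e.symm_apply_apply])
  have h2 : Function.Bijective (g ∘ₗ ψ) := bijective_of_sub_mem (R := R) fun y => by
    obtain ⟨z, hz⟩ := (redSub Λ (powIdeal xs (n + 1)) X).mkQ_surjective
      (e.symm ((redSub Λ (powIdeal xs (n + 1)) Y).mkQ y))
    have h3 := map_mem_smul_top (maximalIdeal R) g (hψ y z hz)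
    have h4 : g z - y ∈ (maximalIdeal R • ⊤ : Submodule R Y) := mem_of_mkQ_eq hJ (by
      rw [← he, hz, e.apply_symm_apply])
    rw [show (g ∘ₗ ψ) y - y = g (ψ y - z) + (g z - y) by
      rw [map_sub, LinearMap.comp_apply]
      abel]
    exact add_mem h3 h4
  exact ⟨Function.Injective.of_comp h1.1, Function.Surjective.of_comp (g := ψ) h2.2⟩

end Reduction

section FiniteUpToIso

variable {R : Type u} [CommRing R] {Λ : Type u} [Ring Λ] [Algebra R Λ]

/-- Only finitely many isomorphism classes of modules satisfy `P`. -/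
def FiniteUpToIso (P : LMod R Λ → Prop) : Prop :=
  ∃ s : Set (LMod R Λ), s.Finite ∧ ∀ M, P M → ∃ N ∈ s, Nonempty (M ≃ₗ[Λ] N)

variable {P Q : LMod R Λ → Prop}

theorem FiniteUpToIso.mono (h : FiniteUpToIso Q) (hPQ : ∀ M, P M → Q M) : FiniteUpToIso P := by
  obtain ⟨s, hs, h⟩ := h
  exact ⟨s, hs, fun M hM => h M (hPQ M hM)⟩

theorem FiniteUpToIso.iUnion {κ : Type*} {t : Set κ} (ht : t.Finite) {P : κ → LMod R Λ → Prop}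
    (h : ∀ j ∈ t, FiniteUpToIso (P j)) : FiniteUpToIso fun M => ∃ j ∈ t, P j M := by
  choose! s hs h using h
  refine ⟨⋃ j ∈ t, s j, ht.biUnion hs, fun M ⟨j, hj, hM⟩ => ?_⟩
  obtain ⟨N, hN, e⟩ := h j hj M hM
  exact ⟨N, Set.mem_biUnion hj hN, e⟩

theorem FiniteUpToIso.or (hP : FiniteUpToIso P) (hQ : FiniteUpToIso Q) :
    FiniteUpToIso fun M => P M ∨ Q M := by
  obtain ⟨s, hs, hP⟩ := hP
  obtain ⟨t, ht, hQ⟩ := hQ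
  refine ⟨s ∪ t, hs.union ht, fun M hM => hM.elim (fun h => ?_) fun h => ?_⟩
  · obtain ⟨N, hN, e⟩ := hP M h
    exact ⟨N, .inl hN, e⟩
  · obtain ⟨N, hN, e⟩ := hQ M h
    exact ⟨N, .inr hN, e⟩

theorem FiniteUpToIso.exists_mem (h : FiniteUpToIso P) :
    ∃ s : Set (LMod R Λ), s.Finite ∧ (∀ N ∈ s, P N) ∧
      ∀ M, P M → ∃ N ∈ s, Nonempty (M ≃ₗ[Λ] N) := by
  classical
  obtain ⟨s, hs, h⟩ := h
  have hc : ∀ N : LMod R Λ, ∃ N' : LMod R Λ, (∃ M, P M ∧ Nonempty (M ≃ₗ[Λ] N)) →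
      P N' ∧ Nonempty (N' ≃ₗ[Λ] N) := fun N => by
    by_cases hN : ∃ M, P M ∧ Nonempty (M ≃ₗ[Λ] N)
    · obtain ⟨M, hM⟩ := hN
      exact ⟨M, fun _ => hM⟩
    · exact ⟨N, fun h => (hN h).elim⟩
  choose c hc using hc
  refine ⟨c '' {N ∈ s | ∃ M, P M ∧ Nonempty (M ≃ₗ[Λ] N)}, (hs.subset fun N hN => hN.1).image c,
    ?_, fun M hM => ?_⟩
  · rintro _ ⟨N, hN, rfl⟩
    exact (hc N hN.2).1
  · obtain ⟨N, hN, ⟨e⟩⟩ := h M hM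
    obtain ⟨-, ⟨e'⟩⟩ := hc N ⟨M, hM, ⟨e⟩⟩
    exact ⟨c N, ⟨N, ⟨hN, M, hM, ⟨e⟩⟩, rfl⟩, ⟨e.trans e'.symm⟩⟩

theorem exists_seq_of_not_finiteUpToIso (h : ¬ FiniteUpToIso P) :
    ∃ F : ℕ → LMod R Λ, (∀ n, P (F n)) ∧ ∀ m n, m ≠ n → IsEmpty (F m ≃ₗ[Λ] F n) := by
  obtain ⟨F, hF, hlt⟩ := exists_seq_of_forall_finset_exists P
    (fun M N => IsEmpty (N ≃ₗ[Λ] M)) fun s _ => by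
      by_contra! hcon
      refine h ⟨s, s.finite_toSet, fun M hM => ?_⟩
      obtain ⟨N, hN, he⟩ := hcon M hM
      exact ⟨N, hN, he⟩
  refine ⟨F, hF, fun m n hmn => ⟨fun e => ?_⟩⟩
  rcases hmn.lt_or_gt with hl | hl
  · exact (hlt m n hl).elim e.symm
  · exact (hlt n m hl).elim e

theorem not_finiteUpToIso_of_seq {F : ℕ → LMod R Λ} (hF : ∀ n, P (F n))
    (hne : ∀ m n, m ≠ n → IsEmpty (F m ≃ₗ[Λ] F n)) : ¬ FiniteUpToIso P := by
  rintro ⟨s, hs, h⟩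
  choose N hN e using fun n => h (F n) (hF n)
  have : Finite s := hs
  obtain ⟨m, n, hmn, heq⟩ := Finite.exists_ne_map_eq_of_infinite
    (fun n => (⟨N n, hN n⟩ : s))
  obtain ⟨e₁⟩ := e m
  have h2 : N m = N n := congrArg Subtype.val heq
  rw [h2] at e₁
  obtain ⟨e₂⟩ := e n
  exact (hne m n hmn).elim (e₁.trans e₂.symm)

end FiniteUpToIso

section Successor

variable {R : Type u} [CommRing R] [IsLocalRing R] [IsNoetherianRing R]
  [IsAdicComplete (maximalIdeal R) R]
  {Λ : Type u} [Ring Λ] [Algebra R Λ] [Module.Finite R Λ]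
  {ω : Type u} [AddCommGroup ω] [Module R ω] {xs : List R}

/-- `M` is a nonprojective indecomposable lattice and `X` is a direct summand of the source of
a minimal right almost split map onto `M`. -/
structure IsSuccessor (R : Type u) [CommRing R] [IsLocalRing R] (Λ : Type u)
    [Ring Λ] [Algebra R Λ] (ω : Type u) [AddCommGroup ω] [Module R ω] (xs : List R)
    (X M : LMod R Λ) : Prop where
  isIndecomposable : IsIndecomposable Λ M
  isLat0 : IsLat0 R Λ ω xs M
  not_projective : ¬ Module.Projective Λ M
  exists_summand : ∃ (L : LMod R Λ) (r : L →ₗ[Λ] M) (i : X →ₗ[Λ] L) (p : L →ₗ[Λ] X),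
    IsMinimalRightAlmostSplit R Λ ω xs r ∧ p ∘ₗ i = LinearMap.id

theorem IsSuccessor.congr {X X' M : LMod R Λ} (h : IsSuccessor R Λ ω xs X M)
    (e : X ≃ₗ[Λ] X') : IsSuccessor R Λ ω xs X' M := by
  obtain ⟨h1, h2, h3, L, r, i, p, hr, hpi⟩ := h
  refine ⟨h1, h2, h3, L, r, i ∘ₗ e.symm.toLinearMap, e.toLinearMap ∘ₗ p, hr,
    LinearMap.ext fun x => ?_⟩
  have := LinearMap.congr_fun hpi (e.symm x)
  change e (p (i (e.symm x))) = x
  change p (i (e.symm x)) = e.symm x at this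
  rw [this, e.apply_symm_apply]

/-- Indecomposable lattices reachable from the class `P` in `k` steps. -/
def IsReachable (R : Type u) [CommRing R] [IsLocalRing R] (Λ : Type u)
    [Ring Λ] [Algebra R Λ] (ω : Type u) [AddCommGroup ω] [Module R ω] (xs : List R)
    (P : LMod R Λ → Prop) : ℕ → LMod R Λ → Prop
  | 0, M => P M
  | k + 1, M => ∃ X, IsReachable R Λ ω xs P k X ∧ IsSuccessor R Λ ω xs X M

variable {ι : Type u} {Sfam : ι → Type u}
  [∀ i, AddCommGroup (Sfam i)] [∀ i, Module Λ (Sfam i)]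
  {G : Type u} [AddCommGroup G] [Module Λ G] [Module R G] [IsScalarTower R Λ G]
  {α : G →ₗ[Λ] ∀ i, Sfam i}

theorem finiteUpToIso_isSuccessor (h : ApproxData R Λ ω xs Sfam α) {X : LMod R Λ}
    (hX : IsLat0 R Λ ω xs X) (hi : IsIndecomposable Λ X) :
    FiniteUpToIso (IsSuccessor R Λ ω xs X) := by
  classical
  have hras : ∃ (L : LMod R Λ) (f : L →ₗ[Λ] X), IsLat0 R Λ ω xs L ∧
      IsRightAlmostSplit R Λ ω xs f := by
    by_cases hp : Module.Projective Λ X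
    · exact h.exists_isRightAlmostSplit_of_projective X hX hi
    · obtain ⟨n, hn⟩ := hX.exists_isBdd
      obtain ⟨m, hm⟩ := h.exists_isRightAlmostSplit n
      obtain ⟨L, f, hL, hf⟩ := hm X hn hi hp
      exact ⟨L, f, hL.isLat0, hf⟩
  obtain ⟨L, f, hL, hf⟩ := hras
  have : IsNoetherianRing Λ := IsNoetherianRing.of_finite R Λ
  have : Module.Finite Λ L := hL.finite
  have : Module.Finite R L := Module.Finite.trans Λ L
  have : Module.Finite Λ X := hX.finite
  have : Module.Finite R X := Module.Finite.trans Λ X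
  obtain ⟨κ, _, Q, i, p, hQ, -, hip⟩ := exists_decomposition L
  have hker : ∀ M, IsSuccessor R Λ ω xs X M → ∃ (j : κ) (E : LMod R Λ) (r : E →ₗ[Λ] M),
      IsMinimalRightAlmostSplit R Λ ω xs r ∧ Nonempty (LinearMap.ker r ≃ₗ[Λ] Q j) := by
    rintro M ⟨hMi, hM, hMp, E, r, i', p', hr, hpi⟩
    have hs := hr.surjective h.isLat0_ring hMp
    obtain ⟨v, t, htv⟩ := hr.exists_retract hs hM hMi hi hpi hL hf
    have hK := (hr.isLat0.ker hs hM).finite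
    have : Module.Finite R (LinearMap.ker r) := Module.Finite.trans Λ _
    obtain ⟨j, hj⟩ := IsIndecomposable.exists_equiv_of_sum_eq_id R
      (hr.isIndecomposable_ker hs hM) hQ hip htv
    exact ⟨j, E, r, hr, hj⟩
  let P : κ → LMod R Λ → Prop := fun j M => IsSuccessor R Λ ω xs X M ∧
    ∃ (E : LMod R Λ) (r : E →ₗ[Λ] M),
      IsMinimalRightAlmostSplit R Λ ω xs r ∧ Nonempty (LinearMap.ker r ≃ₗ[Λ] Q j)
  have hP : ∀ j, FiniteUpToIso (P j) := fun j => by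
    by_cases hj : ∃ M, P j M
    · obtain ⟨M, hM, E, r, hr, ⟨e⟩⟩ := hj
      refine ⟨{M}, Set.finite_singleton M, ?_⟩
      rintro M' ⟨hM', E', r', hr', ⟨e'⟩⟩
      exact ⟨M, rfl, hr'.nonempty_equiv_of_equiv_ker
        (hr'.surjective h.isLat0_ring hM'.not_projective) hM'.isLat0 hr
        (hr.surjective h.isLat0_ring hM.not_projective) hM.isLat0 (e'.trans e.symm)⟩
    · exact ⟨∅, Set.finite_empty, fun M hM => (hj ⟨M, hM⟩).elim⟩
  refine (FiniteUpToIso.iUnion Set.finite_univ fun j _ => hP j).mono fun M hM => ?_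
  obtain ⟨j, hj⟩ := hker M hM
  exact ⟨j, trivial, hM, hj⟩

theorem finiteUpToIso_isReachable (h : ApproxData R Λ ω xs Sfam α) {P : LMod R Λ → Prop}
    (hP : FiniteUpToIso P) (hPl : ∀ M, P M → IsLat0 R Λ ω xs M ∧ IsIndecomposable Λ M)
    (k : ℕ) : FiniteUpToIso (IsReachable R Λ ω xs P k) := by
  induction k with
  | zero => exact hP
  | succ k ih =>
    obtain ⟨s, hs, hsk, h2⟩ := ih.exists_mem
    refine (FiniteUpToIso.iUnion hs (P := fun X => IsSuccessor R Λ ω xs X) fun X hX => ?_).mono ?_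
    · have hX' : IsLat0 R Λ ω xs X ∧ IsIndecomposable Λ X := by
        cases k with
        | zero => exact hPl X (hsk X hX)
        | succ k =>
          obtain ⟨Y, -, hY⟩ := hsk X hX
          exact ⟨hY.isLat0, hY.isIndecomposable⟩
      exact finiteUpToIso_isSuccessor h hX'.1 hX'.2
    · rintro M ⟨X, hX, hXM⟩
      obtain ⟨N, hN, ⟨e⟩⟩ := h2 X hX
      exact ⟨N, hN, hXM.congr e⟩

theorem finiteUpToIso_projective :
    FiniteUpToIso fun X : LMod R Λ => IsIndecomposable Λ X ∧ Module.Finite Λ X ∧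
      Module.Projective Λ X := by
  classical
  obtain ⟨κ, _, Q, i, p, hQ, -, hip⟩ := exists_decomposition (⟨Λ⟩ : LMod R Λ)
  refine ⟨Set.range Q, Set.finite_range Q, ?_⟩
  rintro X ⟨hX, hfin, hproj⟩
  have : Module.Finite R X := Module.Finite.trans Λ X
  obtain ⟨n, f, g, -, -, hfg⟩ := Module.Finite.exists_comp_eq_id_of_projective Λ X
  have hsum : ∑ a : Fin n, (f ∘ₗ LinearMap.single Λ (fun _ => Λ) a ∘ₗ LinearMap.proj a ∘ₗ g :
      Module.End Λ X) = 1 := by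
    ext x
    have h1 : ∑ a, LinearMap.single Λ (fun _ : Fin n => Λ) a (g x a) = g x :=
      Finset.univ_sum_single (g x)
    have h2 : f (g x) = x := LinearMap.congr_fun hfg x
    rw [← h1, map_sum] at h2
    rw [LinearMap.sum_apply]
    exact h2
  obtain ⟨a, -, ha⟩ := IsIndecomposable.exists_bijective_of_sum R hX Finset.univ _ (by
    rw [hsum]
    exact Function.bijective_id)
  let e := LinearEquiv.ofBijective _ ha
  obtain ⟨j, ⟨e'⟩⟩ := IsIndecomposable.exists_equiv_of_sum_eq_id R hX hQ hip
    (a := LinearMap.proj (R := Λ) (φ := fun _ : Fin n => Λ) a ∘ₗ g)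
    (b := e.symm.toLinearMap ∘ₗ f ∘ₗ LinearMap.single Λ (fun _ => Λ) a)
    (LinearMap.ext e.symm_apply_apply)
  exact ⟨Q j, ⟨j, rfl⟩, ⟨e'⟩⟩

/-- Nonprojective indecomposable lattices of `h`-length at most `N`. -/
structure IsShort (R : Type u) [CommRing R] [IsLocalRing R] (Λ : Type u)
    [Ring Λ] [Algebra R Λ] (ω : Type u) [AddCommGroup ω] [Module R ω] (xs : List R)
    (G : Type u) [AddCommGroup G] [Module Λ G] [Module R G] [IsScalarTower R Λ G] (N : ℕ)
    (X : LMod R Λ) : Prop where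
  isIndecomposable : IsIndecomposable Λ X
  isLat0 : IsLat0 R Λ ω xs X
  not_projective : ¬ Module.Projective Λ X
  length_le : Module.length R (stableHom R Λ X (X × G)) ≤ N

theorem IsShort.isBdd (h : ApproxData R Λ ω xs Sfam α) {N : ℕ} {X : LMod R Λ}
    (hX : IsShort R Λ ω xs G N X) : IsBdd R Λ ω xs N X :=
  h.isBdd_of_length_le hX.isLat0 hX.isIndecomposable hX.not_projective hX.length_le

/-- Each short lattice is the target of a minimal right almost split map such that the
indecomposable summands of the source are short or satisfy `P`. -/
def IsFrontier (R : Type u) [CommRing R] [IsLocalRing R] (Λ : Type u)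
    [Ring Λ] [Algebra R Λ] (ω : Type u) [AddCommGroup ω] [Module R ω] (xs : List R)
    (G : Type u) [AddCommGroup G] [Module Λ G] [Module R G] [IsScalarTower R Λ G] (N : ℕ)
    (P : LMod R Λ → Prop) : Prop :=
  ∀ M, IsShort R Λ ω xs G N M → ∃ (L : LMod R Λ) (r : L →ₗ[Λ] M),
    IsMinimalRightAlmostSplit R Λ ω xs r ∧
    ∀ (Q : LMod R Λ) (i : Q →ₗ[Λ] L) (p : L →ₗ[Λ] Q), IsIndecomposable Λ Q →
      p ∘ₗ i = LinearMap.id → IsShort R Λ ω xs G N Q ∨ P Q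

/-- Short lattices that cannot be reached from `P` in at most `i` steps. -/
def IsFar (R : Type u) [CommRing R] [IsLocalRing R] (Λ : Type u)
    [Ring Λ] [Algebra R Λ] (ω : Type u) [AddCommGroup ω] [Module R ω] (xs : List R)
    (G : Type u) [AddCommGroup G] [Module Λ G] [Module R G] [IsScalarTower R Λ G] (N : ℕ)
    (P : LMod R Λ → Prop) (i : ℕ) (M : LMod R Λ) : Prop :=
  IsShort R Λ ω xs G N M ∧ ∀ j ≤ i, ¬ IsReachable R Λ ω xs P j M

theorem IsFar.exists_step (h : ApproxData R Λ ω xs Sfam α) {N : ℕ} {P : LMod R Λ → Prop}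
    (hP : IsFrontier R Λ ω xs G N P) {i : ℕ} {M M₀ : LMod R Λ} {J : Ideal R}
    (hM : IsFar R Λ ω xs G N P (i + 1) M) {f : M →ₗ[Λ] M₀} {x : M}
    (hx : f x ∉ redSub Λ J M₀) :
    ∃ (Q : LMod R Λ) (w : Q →ₗ[Λ] M) (y : Q), IsFar R Λ ω xs G N P i Q ∧
      ¬ Function.Bijective w ∧ f (w y) ∉ redSub Λ J M₀ := by
  obtain ⟨L, r, hr, hL⟩ := hP M hM.1
  have hs := hr.surjective h.isLat0_ring hM.1.not_projective
  have : Module.Finite Λ L := hr.isLat0.finite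
  have : Module.Finite R L := Module.Finite.trans Λ L
  obtain ⟨κ, _, Q, a, p, hQ, hpa, hap⟩ := exists_decomposition L
  obtain ⟨z, rfl⟩ := hs x
  have hz : z = ∑ j, a j (p j z) := by
    conv_lhs => rw [← LinearMap.id_apply (R := Λ) z, ← hap]
    rw [LinearMap.sum_apply]
    rfl
  have hj : ∃ j, f (r (a j (p j z))) ∉ redSub Λ J M₀ := by
    by_contra! hcon
    refine hx ?_
    rw [hz, map_sum, map_sum]
    exact Submodule.sum_mem _ fun j _ => hcon j
  obtain ⟨j, hj⟩ := hj
  have hsucc : IsSuccessor R Λ ω xs (Q j) M :=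
    ⟨hM.1.isIndecomposable, hM.1.isLat0, hM.1.not_projective, L, r, a j, p j, hr, hpa j⟩
  have hfar : ∀ k ≤ i, ¬ IsReachable R Λ ω xs P k (Q j) := fun k hk hk' =>
    hM.2 (k + 1) (Nat.succ_le_succ hk) ⟨Q j, hk', hsucc⟩
  refine ⟨Q j, r ∘ₗ a j, p j z, ⟨(hL (Q j) (a j) (p j) (hQ j) (hpa j)).resolve_right
    (hfar 0 (Nat.zero_le i)), hfar⟩, fun hb => ?_, hj⟩
  let e := LinearEquiv.ofBijective _ hb
  exact hr.not_split (a j ∘ₗ e.symm.toLinearMap) (LinearMap.ext fun y => e.apply_symm_apply y)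

theorem IsFar.exists_isRadicalChain (h : ApproxData R Λ ω xs Sfam α) {N B : ℕ}
    {P : LMod R Λ → Prop} (hP : IsFrontier R Λ ω xs G N P)
    (hB : ∀ X, IsShort R Λ ω xs G N X →
      Module.length R (X.red (powIdeal xs (N + 1))) ≤ B) (m i : ℕ) {M M₀ : LMod R Λ}
    (hM : IsFar R Λ ω xs G N P (2 ^ m - 1 + i) M) {f : M →ₗ[Λ] M₀} {x : M}
    (hx : f x ∉ redSub Λ (powIdeal xs (N + 1)) M₀) :
    ∃ (X : LMod R Λ) (u : X →ₗ[Λ] M) (y : X), IsFar R Λ ω xs G N P i X ∧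
      IsRadicalChain B m (X.red (powIdeal xs (N + 1))) (M.red (powIdeal xs (N + 1)))
        (redMap (powIdeal xs (N + 1)) u) ∧
      f (u y) ∉ redSub Λ (powIdeal xs (N + 1)) M₀ := by
  induction m generalizing i M f x with
  | zero =>
    rw [pow_zero, Nat.sub_self, zero_add] at hM
    exact ⟨M, LinearMap.id, x, hM, hB M hM.1, hx⟩
  | succ m ih =>
    have hnum : 2 ^ (m + 1) - 1 + i = 2 ^ m - 1 + (2 ^ m - 1 + i + 1) := by
      have := Nat.one_le_two_pow (n := m)
      lia
    rw [hnum] at hM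
    obtain ⟨X, u, x', hX, hu, hx'⟩ := ih _ hM hx
    obtain ⟨Y, w, y, hY, hw, hy⟩ := hX.exists_step h hP (f := f ∘ₗ u) hx'
    obtain ⟨Z, u', z, hZ, hu', hz⟩ := ih i hY (f := f ∘ₗ u ∘ₗ w) hy
    refine ⟨Z, u ∘ₗ w ∘ₗ u', z, hZ, ⟨Y.red _, X.red _, redMap _ u', redMap _ w, redMap _ u, hu', hu,
      fun hb => hw ((hX.1.isBdd h).bijective_of_redMap h.isParam hY.1.isLat0 hb),
      (hY.1.isBdd h).isIndecomposable_red h.isParam hY.1.isIndecomposable,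
      (hX.1.isBdd h).isIndecomposable_red h.isParam hX.1.isIndecomposable,
      hB Y hY.1, hB X hX.1, ?_⟩, hz⟩
    rw [redMap_comp, redMap_comp]

theorem IsShort.exists_isReachable (h : ApproxData R Λ ω xs Sfam α) {N : ℕ}
    {P : LMod R Λ → Prop} (hP : IsFrontier R Λ ω xs G N P) :
    ∃ k, ∀ M, IsShort R Λ ω xs G N M → ∃ j ≤ k, IsReachable R Λ ω xs P j M := by
  obtain ⟨B, hB⟩ := exists_length_quotient_le (Λ := Λ) (ω := ω) h.isParam N (N + 1)
  refine ⟨2 ^ B - 1, fun M hM => ?_⟩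
  by_contra! hcon
  have : Module.Finite Λ M := hM.isLat0.finite
  have : Module.Finite R M := Module.Finite.trans Λ M
  have := hM.isIndecomposable.1
  have := nontrivial_red (powIdeal_le h.isParam N) M
  obtain ⟨z, hz⟩ := exists_ne (0 : M.red (powIdeal xs (N + 1)))
  obtain ⟨x, rfl⟩ := (redSub Λ (powIdeal xs (N + 1)) M).mkQ_surjective z
  obtain ⟨X, u, y, -, hu, hy⟩ := IsFar.exists_isRadicalChain h hP
    (fun X hX => hB X (hX.isBdd h)) B 0 (M := M) (f := LinearMap.id) ⟨hM, hcon⟩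
    fun hx => hz (mkQ_redSub_eq_zero.mpr hx)
  have hlen : Module.length R (LinearMap.range (redMap (powIdeal xs (N + 1)) u)) = 0 := by
    refine hu.length_range_le.elim (fun h3 => ?_) id
    generalize Module.length R (LinearMap.range (redMap (powIdeal xs (N + 1)) u)) = a at h3 ⊢
    cases a with
    | top => simp at h3
    | coe a => norm_cast at h3 ⊢; lia
  have hsub : Subsingleton (LinearMap.range (redMap (powIdeal xs (N + 1)) u)) :=
    Module.length_eq_zero_iff.mp hlen
  have h1 := hsub.elim ⟨_, (redSub Λ (powIdeal xs (N + 1)) X).mkQ y, rfl⟩ 0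
  exact hy (mkQ_redSub_eq_zero.mp (congrArg Subtype.val h1))

/-- Indecomposable lattices of `h`-length `t`. -/
def IsIndecLat (R : Type u) [CommRing R] [IsLocalRing R] (Λ : Type u)
    [Ring Λ] [Algebra R Λ] (ω : Type u) [AddCommGroup ω] [Module R ω] (xs : List R)
    (G : Type u) [AddCommGroup G] [Module Λ G] [Module R G] [IsScalarTower R Λ G] (t : ℕ)
    (X : LMod R Λ) : Prop :=
  IsIndecomposable Λ X ∧ IsLat0 R Λ ω xs X ∧ Module.length R (stableHom R Λ X (X × G)) = t

theorem exists_not_finiteUpToIso (h : ApproxData R Λ ω xs Sfam α) {N : ℕ}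
    (hN : ¬ FiniteUpToIso fun X : LMod R Λ => IsIndecomposable Λ X ∧ IsLat0 R Λ ω xs X ∧
      Module.length R (stableHom R Λ X (X × G)) ≤ N) :
    ∃ t > N, ¬ FiniteUpToIso (IsIndecLat R Λ ω xs G t) := by
  by_contra! hcon
  obtain ⟨m, hm⟩ := h.exists_isRightAlmostSplit N
  obtain ⟨c, hc⟩ := exists_hLength_le h.isParam h.isLat0 m
  have hproj : FiniteUpToIso fun X : LMod R Λ => IsIndecomposable Λ X ∧ IsLat0 R Λ ω xs X ∧
      Module.Projective Λ X :=
    (finiteUpToIso_projective (R := R) (Λ := Λ)).mono fun X hX => ⟨hX.1, hX.2.1.finite, hX.2.2⟩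
  let P : LMod R Λ → Prop := fun X => (∃ t ∈ Set.Ioc N c, IsIndecLat R Λ ω xs G t X) ∨
    (IsIndecomposable Λ X ∧ IsLat0 R Λ ω xs X ∧ Module.Projective Λ X)
  have hPfin : FiniteUpToIso P :=
    (FiniteUpToIso.iUnion (Set.finite_Ioc N c) fun t ht => hcon t ht.1).or hproj
  have hP : IsFrontier R Λ ω xs G N P := fun M hM => by
    obtain ⟨L', r', hL', hr'⟩ := hm M (hM.isBdd h) hM.isIndecomposable hM.not_projective
    have : Module.Finite Λ M := hM.isLat0.finite
    obtain ⟨L, r, hL, hr⟩ := hr'.exists_minimal hL' (Module.Finite.trans Λ M)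
    refine ⟨L, r, hr, fun Q i p hQ hpi => ?_⟩
    have hQb := hL.of_retract hpi
    have h1 := hc Q hQb
    by_cases hp : Module.Projective Λ Q
    · exact .inr (.inr ⟨hQ, hQb.isLat0, hp⟩)
    by_cases hl : Module.length R (stableHom R Λ Q (Q × G)) ≤ N
    · exact .inl ⟨hQ, hQb.isLat0, hp, hl⟩
    · refine .inr (.inl ?_)
      obtain ⟨a, ha⟩ := ENat.ne_top_iff_exists.mp (ne_top_of_le_ne_top (ENat.natCast_ne_top c) h1)
      rw [← ha] at h1 hl
      norm_cast at h1 hl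
      exact ⟨a, ⟨not_le.mp hl, h1⟩, hQ, hQb.isLat0, ha.symm⟩
  obtain ⟨k, hk⟩ := IsShort.exists_isReachable h hP
  have hreach := FiniteUpToIso.iUnion (Set.finite_Iic k) fun j _ =>
    finiteUpToIso_isReachable h hPfin (fun M hM => hM.elim (fun ⟨t, _, hM⟩ => ⟨hM.2.1, hM.1⟩)
      fun hM => ⟨hM.2.1, hM.1⟩) j
  refine hN ((hreach.or hproj).mono fun X hX => ?_)
  by_cases hp : Module.Projective Λ X
  · exact .inr ⟨hX.1, hX.2.1, hp⟩
  · exact .inl (hk X ⟨hX.1, hX.2.1, hp, hX.2.2⟩)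

theorem hLength_eq (X : LMod R Λ) :
    hLength R Λ X G = (Module.length R (stableHom R Λ X (X × G)) : WithBot ℕ∞) :=
  (Module.coe_length R _).symm

end Successor

/-- If a class of `Λ`-lattices of bounded `h`-length contains infinitely many
pairwise non-isomorphic indecomposable objects, then `Λ` has strongly
unbounded lattice type. -/
theorem strongly_unbounded_of_bounded_infinite_class
    (R : Type u) [CommRing R] [IsNoetherianRing R] [IsLocalRing R]
    [IsAdicComplete (maximalIdeal R) R]
    (d : ℕ) (hdim : ringKrullDim R = (d : WithBot ℕ∞))
    (hCM : IsMCM R R)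
    (ω : Type u) [AddCommGroup ω] [Module R ω] (hω : IsCanonicalModule R ω)
    (Λ : Type u) [Ring Λ] [Algebra R Λ] [Module.Finite R Λ]
    (hord : IsLattice R Λ ω Λ)
    (ι : Type u) [Fintype ι] (Sfam : ι → Type u) [∀ i, AddCommGroup (Sfam i)]
    [∀ i, Module Λ (Sfam i)]
    (G : Type u) [AddCommGroup G] [Module Λ G] [Module R G] [IsScalarTower R Λ G]
    (α : G →ₗ[Λ] ∀ i, Sfam i) (happrox : IsSimplesApprox R Λ ω ι Sfam G α)
    (b : ℕ) (F : ℕ → Type u) [∀ n, AddCommGroup (F n)] [∀ n, Module Λ (F n)]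
    [∀ n, Module R (F n)] [∀ n, IsScalarTower R Λ (F n)]
    (hF : ∀ n, IsLattice R Λ ω (F n) ∧ IsIndecomposable Λ (F n) ∧
      hLength R Λ (F n) G ≤ (b : WithBot ℕ∞))
    (hpairwise : ∀ m n : ℕ, m ≠ n → IsEmpty (F m ≃ₗ[Λ] F n)) :
    StronglyUnboundedLatType R Λ ω G := by
  obtain ⟨xs, hmem, hreg, hlen⟩ := hCM
  have h := happrox.approxData ⟨hreg, hmem, hlen⟩ hord
  have step : ∀ N ≥ b, ∃ t > N, ¬ FiniteUpToIso (IsIndecLat R Λ ω xs G t) := fun N hN =>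
    exists_not_finiteUpToIso h (not_finiteUpToIso_of_seq (F := fun n => ⟨F n⟩) (fun n => by
      obtain ⟨h1, h2, h3⟩ := hF n
      refine ⟨h2, ((isLattice_iff h.isParam).mp h1).1, ?_⟩
      have h4 := (hLength_eq (G := G) (⟨F n⟩ : LMod R Λ)).symm.trans_le
        (h3.trans (Nat.cast_le.mpr hN))
      exact WithBot.coe_le_coe.mp h4) hpairwise)
  choose! t hgt ht using step
  let B : ℕ → ℕ := fun i => t^[i + 1] b
  have hB : ∀ i, B (i + 1) = t (B i) := fun i => Function.iterate_succ_apply' t (i + 1) b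
  have hBb : ∀ i, b ≤ B i := fun i => by
    induction i with
    | zero => exact (hgt b le_rfl).le
    | succ i ih =>
      rw [hB]
      exact ih.trans (hgt _ ih).le
  refine ⟨B, strictMono_nat_of_lt_succ fun i => ?_, fun i => ?_⟩
  · rw [hB]
    exact hgt _ (hBb i)
  · have hfin : ¬ FiniteUpToIso (IsIndecLat R Λ ω xs G (B i)) := by
      cases i with
      | zero => exact ht b le_rfl
      | succ i =>
        rw [hB]
        exact ht _ (hBb i)
    obtain ⟨F', hF', hne⟩ := exists_seq_of_not_finiteUpToIso hfin
    refine ⟨fun n => F' n, fun n => inferInstance, fun n => inferInstance,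
      fun n => inferInstance, fun n => inferInstance, fun n => ?_, hne⟩
    obtain ⟨h1, h2, h3⟩ := hF' n
    refine ⟨(isLattice_iff h.isParam).mpr ⟨h2, h1.1⟩, h1, ?_⟩
    rw [hLength_eq, h3]
    rfl

end BT
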